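/- arXiv:2510.01110 — 11 statements merged into one kernel-verified Lean document; each statement's English description precedes it below -/
import Mathlib

section
/- Let n ∈ ℕ and let d_1 ≥ d_2 ≥ … ≥ d_n ≥ 1 be integers. Then the sequence (d_1, d_2, …, d_n) can realize a perfect matching (i.e., some graph G with vertex set [n] and deg_G(i) = d_i for all i contains a perfect matching) if and only if (d_1, …, d_n) can realize the specific perfect matching M⁻ = {(1,n), (2,n−1), …, (n/2, n/2+1)}. -/
/-- `(d_1, …, d_n)` can realize the matching `M` (a set of edges of `K_n`):
there is a simple graph `G` on `[n]` with `deg_G(i) = d i` and `M ⊆ E(G)`. -/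
def Realizes {n : ℕ} (d : Fin n → ℕ) (M : Set (Sym2 (Fin n))) : Prop :=
  ∃ G : SimpleGraph (Fin n), (∀ i, (G.neighborSet i).ncard = d i) ∧ M ⊆ G.edgeSet

/-- `M` is a perfect matching of the complete graph on `Fin n`:
a set of non-loop edges such that every vertex lies in exactly one edge. -/
def IsPerfectMatchingOn (n : ℕ) (M : Set (Sym2 (Fin n))) : Prop :=
  (∀ e ∈ M, ¬ e.IsDiag) ∧ ∀ v : Fin n, ∃! e, e ∈ M ∧ v ∈ e

/-- The matching `M⁻ = {(1,n), (2,n−1), …, (n/2, n/2+1)}` (0-indexed: pairs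
`{u,v}` with `u + v = n - 1`). -/
def Mminus (n : ℕ) : Set (Sym2 (Fin n)) :=
  {e | ∃ u v : Fin n, e = s(u, v) ∧ (u : ℕ) + (v : ℕ) = n - 1}

namespace SimpleGraph

variable {V : Type*} {G : SimpleGraph V}

/-- The 2-switch: edges `pq`, `rs` are replaced by the non-edges `ps`, `rq`; degrees are kept. -/
theorem exists_switch {p q r s : V} (hpq : G.Adj p q) (hrs : G.Adj r s)
    (hps : ¬ G.Adj p s) (hrq : ¬ G.Adj r q) (hne : p ≠ s) (hne' : r ≠ q) :
    ∃ H : SimpleGraph V, (∀ v, (H.neighborSet v).ncard = (G.neighborSet v).ncard) ∧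
      H.Adj p s ∧ H.Adj r q ∧
      ∀ u v, G.Adj u v → s(u, v) ≠ s(p, q) → s(u, v) ≠ s(r, s) → H.Adj u v := by
  have hpr : p ≠ r := by rintro rfl; exact hrq hpq
  have hqs : q ≠ s := by rintro rfl; exact hps hpq
  have hpq' := hpq.ne
  have hrs' := hrs.ne
  let H : SimpleGraph V :=
    { Adj := fun u v => (G.Adj u v ∧ s(u, v) ≠ s(p, q) ∧ s(u, v) ≠ s(r, s)) ∨
        s(u, v) = s(p, s) ∨ s(u, v) = s(r, q)
      symm := ⟨fun u v h => by rwa [Sym2.eq_swap, G.adj_comm]⟩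
      loopless := ⟨fun v h => by
        rcases h with h | h | h
        · exact h.1.ne rfl
        all_goals simp only [Sym2.eq_iff] at h; grind⟩ }
  have hH : ∀ u v, H.Adj u v ↔ (G.Adj u v ∧ s(u, v) ≠ s(p, q) ∧ s(u, v) ≠ s(r, s)) ∨
        s(u, v) = s(p, s) ∨ s(u, v) = s(r, q) := fun _ _ => Iff.rfl
  refine ⟨H, fun v => ?_, by simp [hH], by simp [hH], fun u v h h1 h2 => Or.inl ⟨h, h1, h2⟩⟩
  have exchange : ∀ a b, a ∉ G.neighborSet v → b ∈ G.neighborSet v →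
      H.neighborSet v = insert a (G.neighborSet v \ {b}) →
      (H.neighborSet v).ncard = (G.neighborSet v).ncard := fun a b ha hb h => by
    rw [h, Set.ncard_exchange ha hb]
  have hsp : ¬ G.Adj s p := fun h => hps h.symm
  have hqr : ¬ G.Adj q r := fun h => hrq h.symm
  by_cases hvp : v = p
  · subst hvp
    refine exchange s q hps hpq ?_
    ext u
    simp only [mem_neighborSet, hH, Set.mem_insert_iff, Set.mem_sdiff, Set.mem_singleton_iff, ne_eq,
      Sym2.eq_iff]
    grind
  by_cases hvr : v = r
  · subst hvr
    refine exchange q s hrq hrs ?_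
    ext u
    simp only [mem_neighborSet, hH, Set.mem_insert_iff, Set.mem_sdiff, Set.mem_singleton_iff, ne_eq,
      Sym2.eq_iff]
    grind
  by_cases hvq : v = q
  · subst hvq
    refine exchange r p hqr hpq.symm ?_
    ext u
    simp only [mem_neighborSet, hH, Set.mem_insert_iff, Set.mem_sdiff, Set.mem_singleton_iff, ne_eq,
      Sym2.eq_iff]
    grind
  by_cases hvs : v = s
  · subst hvs
    refine exchange p r hsp hrs.symm ?_
    ext u
    simp only [mem_neighborSet, hH, Set.mem_insert_iff, Set.mem_sdiff, Set.mem_singleton_iff, ne_eq,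
      Sym2.eq_iff]
    grind
  · congr 1
    ext u
    simp only [mem_neighborSet, hH, ne_eq, Sym2.eq_iff]
    grind

theorem exists_adj_not_adj_of_ncard_le [Finite V] {x b y : V}
    (hle : (G.neighborSet b).ncard ≤ (G.neighborSet x).ncard)
    (hby : G.Adj b y) (hxy : ¬ G.Adj x y) (hne : x ≠ y) :
    ∃ w, G.Adj x w ∧ ¬ G.Adj b w ∧ w ≠ b := by
  classical
  by_contra! h
  have hsub : Equiv.swap x b '' G.neighborSet x ⊂ G.neighborSet b := by
    refine (Set.ssubset_iff_of_subset ?_).2 ⟨y, hby, ?_⟩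
    · rintro _ ⟨w, hw, rfl⟩
      by_cases hwb : w = b
      · subst hwb
        rw [Equiv.swap_apply_right]
        exact hw.symm
      · rw [Equiv.swap_apply_of_ne_of_ne hw.ne' hwb]
        by_contra hbw
        exact hwb (h w hw hbw)
    · rintro ⟨w, hw, hwy⟩
      rw [Equiv.swap_apply_eq_iff, Equiv.swap_apply_of_ne_of_ne hne.symm hby.ne'] at hwy
      exact hxy (hwy ▸ hw)
  have hlt := Set.ncard_lt_ncard hsub
  rw [Set.ncard_image_of_injective _ (Equiv.swap x b).injective] at hlt
  omega

/-- If `G` contains the matching given by the involution `σ`, its edges `{x, σ x}` and `{y, σ y}`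
can be replaced by `{x, y}` and `{σ x, σ y}` after a degree-preserving modification of `G`. -/
theorem exists_rematch [Finite V] {σ : V → V} (hσ : Function.Involutive σ)
    (hG : ∀ v, G.Adj v (σ v)) {x y : V} (hxy : x ≠ y) (hσxy : σ x ≠ y)
    (hx : (G.neighborSet (σ y)).ncard ≤ (G.neighborSet x).ncard)
    (hy : (G.neighborSet y).ncard ≤ (G.neighborSet (σ x)).ncard) :
    ∃ H : SimpleGraph V, (∀ v, (H.neighborSet v).ncard = (G.neighborSet v).ncard) ∧
      H.Adj x y ∧ H.Adj (σ x) (σ y) ∧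
      ∀ v, v ≠ x → v ≠ y → v ≠ σ x → v ≠ σ y → H.Adj v (σ v) := by
  have hxx := hσ x
  have hyy := hσ y
  have hGx := hG x
  have hGy := hG y
  have hab : σ x ≠ σ y := hσ.injective.ne hxy
  by_cases h1 : G.Adj x y <;> by_cases h2 : G.Adj (σ x) (σ y)
  · exact ⟨G, fun _ => rfl, h1, h2, fun v _ _ _ _ => hG v⟩
  · obtain ⟨w, haw, hyw, hwy⟩ := exists_adj_not_adj_of_ncard_le hy hGy h2 hab
    obtain ⟨H, hdeg, hAB, -, hkeep⟩ := exists_switch haw hGy h2 hyw hab hwy.symm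
    have hwx : w ≠ x := by rintro rfl; exact hyw h1.symm
    refine ⟨H, hdeg, hkeep _ _ h1 ?_ ?_, hAB, fun v _ _ _ _ =>
      have hvv := hσ v; hkeep _ _ (hG v) ?_ ?_⟩ <;>
      rw [ne_eq, Sym2.eq_iff] <;> grind
  · obtain ⟨w, hxw, hbw, hwb⟩ := exists_adj_not_adj_of_ncard_le hx hGy.symm h1 hxy
    obtain ⟨H, hdeg, hXY, -, hkeep⟩ := exists_switch hxw hGy.symm h1 hbw hxy hwb.symm
    have hwa : w ≠ σ x := by rintro rfl; exact hbw h2.symm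
    refine ⟨H, hdeg, hXY, hkeep _ _ h2 ?_ ?_, fun v _ _ _ _ =>
      have hvv := hσ v; hkeep _ _ (hG v) ?_ ?_⟩ <;>
      rw [ne_eq, Sym2.eq_iff] <;> grind
  · obtain ⟨H, hdeg, hXY, hBA, hkeep⟩ := exists_switch hGx hGy.symm h1
      (fun h => h2 h.symm) hxy hab.symm
    refine ⟨H, hdeg, hXY, hBA.symm, fun v _ _ _ _ =>
      have hvv := hσ v; hkeep _ _ (hG v) ?_ ?_⟩ <;>
      rw [ne_eq, Sym2.eq_iff] <;> grind

end SimpleGraph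

theorem IsPerfectMatchingOn.exists_involutive {n : ℕ} {M : Set (Sym2 (Fin n))}
    (hM : IsPerfectMatchingOn n M) :
    ∃ σ : Fin n → Fin n, Function.Involutive σ ∧ ∀ v, s(v, σ v) ∈ M := by
  have h : ∀ v, ∃ u, s(v, u) ∈ M := fun v => by
    obtain ⟨e, ⟨he, u, rfl⟩, -⟩ := hM.2 v
    exact ⟨u, he⟩
  choose σ hσ using h
  refine ⟨σ, fun v => ?_, hσ⟩
  have heq := (hM.2 (σ v)).unique ⟨hσ v, Sym2.mem_mk_right _ _⟩
    ⟨hσ (σ v), Sym2.mem_mk_left _ _⟩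
  rw [Sym2.eq_iff] at heq
  grind

theorem isPerfectMatchingOn_mminus {n : ℕ} (hn : Even n) :
    IsPerfectMatchingOn n (Mminus n) := by
  constructor
  · rintro _ ⟨u, v, rfl, huv⟩ h
    rw [Sym2.mk_isDiag_iff] at h
    subst h
    have := u.isLt
    grind
  · intro v
    refine ⟨s(v, v.rev), ⟨⟨v, v.rev, rfl, ?_⟩, Sym2.mem_mk_left _ _⟩, ?_⟩
    · rw [Fin.val_rev]
      omega
    · rintro _ ⟨⟨a, b, rfl, hab⟩, hv⟩
      rw [Sym2.mem_iff] at hv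
      rw [Sym2.eq_iff]
      simp only [Fin.ext_iff, Fin.val_rev] at hv ⊢
      omega

/-- The matching can be made to pair the first `k` vertices with the last `k` in reverse order. -/
theorem exists_realization_rev {n : ℕ} (hn : Even n) {d : Fin n → ℕ} (hd : Antitone d)
    {G : SimpleGraph (Fin n)} (hG : ∀ i, (G.neighborSet i).ncard = d i)
    {σ : Fin n → Fin n} (hσ : Function.Involutive σ) (hσG : ∀ v, G.Adj v (σ v)) (k : ℕ)
    (hk : 2 * k ≤ n) :
    ∃ (H : SimpleGraph (Fin n)) (τ : Fin n → Fin n), (∀ i, (H.neighborSet i).ncard = d i) ∧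
      Function.Involutive τ ∧ (∀ v, H.Adj v (τ v)) ∧ ∀ i : Fin n, (i : ℕ) < k → τ i = i.rev := by
  induction k with
  | zero => exact ⟨G, σ, hG, hσ, hσG, fun i hi => absurd hi (Nat.not_lt_zero _)⟩
  | succ k ih =>
    obtain ⟨H, τ, hH, hτ, hτH, hrev⟩ := ih (by omega)
    let x : Fin n := ⟨k, by omega⟩
    have hlast : ∀ i : Fin n, (i.rev : ℕ) < k → τ i = i.rev := fun i hi => by
      have := hrev _ hi
      rw [Fin.rev_rev] at this
      rw [← this, hτ, this]
    by_cases hx : τ x = x.rev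
    · refine ⟨H, τ, hH, hτ, hτH, fun i hi => ?_⟩
      rcases Nat.lt_succ_iff_lt_or_eq.1 hi with h | h
      · exact hrev i h
      · rwa [show i = x from Fin.ext h]
    have hinner : ∀ v : Fin n, k ≤ (v : ℕ) → k ≤ (v.rev : ℕ) →
        k ≤ (τ v : ℕ) ∧ k ≤ ((τ v).rev : ℕ) := fun v h1 h2 => by
      constructor <;> by_contra! h
      · have := hrev _ h
        rw [hτ] at this
        rw [this, Fin.rev_rev] at h2
        omega
      · have := hlast _ h
        rw [hτ] at this
        rw [this] at h1
        omega
    have hxy : x ≠ x.rev := fun h => by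
      have := congrArg Fin.val h
      simp only [x, Fin.val_rev] at this
      omega
    have hxr : k ≤ (x.rev : ℕ) := by simp only [x, Fin.val_rev]; omega
    have ha := hinner x le_rfl hxr
    have hb := hinner x.rev hxr (by rw [Fin.rev_rev])
    have hxb : x ≤ τ x.rev := hb.1
    have hay : τ x ≤ x.rev := by
      rw [Fin.le_iff_val_le_val]
      simp only [x, Fin.val_rev] at ha ⊢
      omega
    obtain ⟨H', hdeg, hXY, hAB, hkeep⟩ := SimpleGraph.exists_rematch hτ hτH hxy hx
      (by rw [hH, hH]; exact hd hxb) (by rw [hH, hH]; exact hd hay)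
    have hτx := hτ x
    have hτy := hτ x.rev
    let π := Equiv.swap (τ x) x.rev
    have hπ : ∀ v, π v = if v = τ x then x.rev else if v = x.rev then τ x else v :=
      Equiv.swap_apply_def _ _
    have hτ' : Function.Involutive (fun v => π (τ (π v))) := fun v => by
      change π (τ (π (π (τ (π v))))) = v
      simp only [π, Equiv.swap_apply_self, hτ _]
    have hxa := (hτH x).ne
    have hyb := (hτH x.rev).ne
    have hab : τ x ≠ τ x.rev := hτ.injective.ne hxy
    refine ⟨H', fun v => π (τ (π v)), fun i => (hdeg i).trans (hH i), hτ', fun v => ?_,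
      fun i hi => ?_⟩
    · have := hkeep v
      have := hXY.symm
      have := hAB.symm
      have := hτ v
      simp only [hπ]
      grind
    · rcases Nat.lt_succ_iff_lt_or_eq.1 hi with h | h
      · have h1 := hrev i h
        have h2 : i ≠ τ x := fun h' => by rw [← h'] at ha; omega
        have h3 : i ≠ x.rev := fun h' => by rw [← h'] at hxr; omega
        have h4 : i.rev ≠ τ x := fun h' => by
          rw [← h', Fin.rev_rev] at ha
          omega
        have h5 : i.rev ≠ x.rev := fun h' => by
          have := congrArg Fin.val (Fin.rev_injective h')
          simp only [x] at this
          omega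
        simp only [hπ, if_neg h2, if_neg h3, h1, if_neg h4, if_neg h5]
      · rw [show i = x from Fin.ext h]
        simp only [hπ, if_neg hxa, if_neg hxy, if_true]

theorem stmt_0 {n : ℕ} (hn : Even n) (d : Fin n → ℕ) (hd : Antitone d)
    (hd1 : ∀ i, 1 ≤ d i) :
    (∃ M : Set (Sym2 (Fin n)), IsPerfectMatchingOn n M ∧ Realizes d M) ↔
      Realizes d (Mminus n) := by
  refine ⟨?_, fun h => ⟨Mminus n, isPerfectMatchingOn_mminus hn, h⟩⟩
  rintro ⟨M, hM, G, hG, hMG⟩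
  obtain ⟨σ, hσ, hσM⟩ := hM.exists_involutive
  obtain ⟨H, τ, hH, -, hτH, hrev⟩ := exists_realization_rev hn hd hG hσ
    (fun v => hMG (hσM v)) (n / 2) (Nat.mul_div_le n 2)
  have hadj : ∀ u v : Fin n, (u : ℕ) + v = n - 1 → (u : ℕ) < n / 2 → H.Adj u v := by
    intro u v huv hu
    have h := hτH u
    rwa [hrev u hu, show u.rev = v by rw [Fin.ext_iff, Fin.val_rev]; omega] at h
  refine ⟨H, hH, ?_⟩
  rintro _ ⟨u, v, rfl, huv⟩
  have hu := u.isLt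
  rcases lt_or_ge (u : ℕ) (n / 2) with h | h
  · exact hadj u v huv h
  · exact (hadj v u (by omega) (by grind)).symm
end

section
/- Let n ∈ ℕ and let d_1 ≥ d_2 ≥ … ≥ d_n ≥ 1 be integers. Then the sequence (d_1, d_2, …, d_n) can realize every perfect matching M ∈ M_n if and only if it can realize the specific perfect matching M⁺ = {(1,2), (3,4), …, (n−1,n)}. -/
/-- The matching `M⁺ = {(1,2), (3,4), …, (n−1,n)}` (0-indexed: pairs
`{u, u+1}` with `u` even). -/
def Mplus (n : ℕ) : Set (Sym2 (Fin n)) :=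
  {e | ∃ u v : Fin n, e = s(u, v) ∧ (u : ℕ) % 2 = 0 ∧ (v : ℕ) = (u : ℕ) + 1}

namespace SimpleGraph

variable {V : Type*}

/-- Replace the edges `pq` and `rs` of `G` by `pr` and `qs`. -/
def edgeSwitch (G : SimpleGraph V) (p q r s : V) : SimpleGraph V :=
  G.deleteEdges {s(p, q), s(r, s)} ⊔ fromEdgeSet {s(p, r), s(q, s)}

theorem edgeSwitch_adj {G : SimpleGraph V} {p q r s u v : V} :
    (G.edgeSwitch p q r s).Adj u v ↔
      (G.Adj u v ∧ s(u, v) ≠ s(p, q) ∧ s(u, v) ≠ s(r, s)) ∨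
        ((s(u, v) = s(p, r) ∨ s(u, v) = s(q, s)) ∧ u ≠ v) := by
  simp only [edgeSwitch, sup_adj, deleteEdges_adj, fromEdgeSet_adj, Set.mem_insert_iff,
    Set.mem_singleton_iff, not_or, ne_eq]

theorem ncard_neighborSet_edgeSwitch [Finite V] {G : SimpleGraph V} {p q r s : V}
    (hpq : G.Adj p q) (hrs : G.Adj r s) (hpr : ¬ G.Adj p r) (hqs : ¬ G.Adj q s)
    (hpr' : p ≠ r) (hqs' : q ≠ s) (v : V) :
    ((G.edgeSwitch p q r s).neighborSet v).ncard = (G.neighborSet v).ncard := by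
  have hps : p ≠ s := by rintro rfl; exact hpr hrs.symm
  have hqr : q ≠ r := by rintro rfl; exact hpr hpq
  have hpq' := hpq.ne
  have hrs' := hrs.ne
  have exchange : ∀ x y : V, G.Adj v x → ¬ G.Adj v y →
      (∀ w, (G.edgeSwitch p q r s).Adj v w ↔ w = y ∨ (G.Adj v w ∧ w ≠ x)) →
      ((G.edgeSwitch p q r s).neighborSet v).ncard = (G.neighborSet v).ncard := by
    intro x y hx hy h
    rw [← Set.ncard_exchange (s := G.neighborSet v) (a := y) (b := x) hy hx]
    congr 1
    ext w
    simp [h]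
  by_cases hp : v = p
  · subst hp
    refine exchange q r hpq hpr fun w => ?_
    clear exchange
    simp only [edgeSwitch_adj, ne_eq, Sym2.eq_iff]
    grind [adj_comm]
  by_cases hq : v = q
  · subst hq
    refine exchange p s hpq.symm hqs fun w => ?_
    clear exchange
    simp only [edgeSwitch_adj, ne_eq, Sym2.eq_iff]
    grind [adj_comm]
  by_cases hr : v = r
  · subst hr
    refine exchange s p hrs (fun h => hpr h.symm) fun w => ?_
    clear exchange
    simp only [edgeSwitch_adj, ne_eq, Sym2.eq_iff]
    grind [adj_comm]
  by_cases hs : v = s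
  · subst hs
    refine exchange r q hrs.symm (fun h => hqs h.symm) fun w => ?_
    clear exchange
    simp only [edgeSwitch_adj, ne_eq, Sym2.eq_iff]
    grind [adj_comm]
  congr 1
  ext w
  clear exchange
  simp only [mem_neighborSet, edgeSwitch_adj, ne_eq, Sym2.eq_iff]
  grind

theorem exists_adj_not_adj_of_ncard_le_s1 [Finite V] {G : SimpleGraph V} {b c d : V}
    (hle : (G.neighborSet c).ncard ≤ (G.neighborSet b).ncard)
    (hcd : G.Adj c d) (hbd : ¬ G.Adj b d) (hne : d ≠ b) :
    ∃ z, G.Adj b z ∧ ¬ G.Adj c z ∧ z ≠ c := by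
  by_contra! h
  have hlt : (G.neighborSet b \ {c}).ncard < (G.neighborSet c \ {b}).ncard := by
    refine Set.ncard_lt_ncard ⟨fun z hz => ⟨?_, ?_⟩, fun hsub => ?_⟩
    · by_contra hcz
      exact hz.2 (h z hz.1 hcz)
    · rintro rfl
      exact G.irrefl hz.1
    · exact hbd (hsub (show d ∈ G.neighborSet c \ {b} from ⟨hcd, hne⟩)).1
  by_cases hbc : G.Adj b c
  · have h1 := Set.ncard_sdiff_singleton_add_one (s := G.neighborSet b) (a := c) hbc
    have h2 := Set.ncard_sdiff_singleton_add_one (s := G.neighborSet c) (a := b) hbc.symm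
    omega
  · rw [Set.sdiff_singleton_eq_self (s := G.neighborSet b) (a := c) hbc,
      Set.sdiff_singleton_eq_self (s := G.neighborSet c) (a := b) fun h => hbc h.symm] at hlt
    omega

/-- If a graph contains a matching with edges `ab` and `cd`, where `b` has degree at least that of
`c` and `a` at least that of `d`, then some graph with the same degrees contains the matching with
`ab, cd` replaced by `ac, bd`. -/
theorem exists_same_degrees_of_rematch [Finite V] {G : SimpleGraph V} {a b c d : V}
    (hab : G.Adj a b) (hcd : G.Adj c d) (hac : a ≠ c) (had : a ≠ d) (hbc : b ≠ c) (hbd : b ≠ d)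
    (hcb : (G.neighborSet c).ncard ≤ (G.neighborSet b).ncard)
    (hda : (G.neighborSet d).ncard ≤ (G.neighborSet a).ncard) :
    ∃ G' : SimpleGraph V, (∀ v, (G'.neighborSet v).ncard = (G.neighborSet v).ncard) ∧
      G'.Adj a c ∧ G'.Adj b d ∧
      ∀ u v, G.Adj u v → u ∉ ({a, b, c, d} : Set V) → v ∉ ({a, b, c, d} : Set V) → G'.Adj u v := by
  simp only [Set.mem_insert_iff, Set.mem_singleton_iff]
  by_cases h1 : G.Adj a c <;> by_cases h2 : G.Adj b d
  · exact ⟨G, fun _ => rfl, h1, h2, fun u v h _ _ => h⟩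
  · obtain ⟨z, hbz, hcz, hzc⟩ := exists_adj_not_adj_of_ncard_le_s1 hcb hcd h2 hbd.symm
    refine ⟨G.edgeSwitch d c b z, ncard_neighborSet_edgeSwitch hcd.symm hbz
      (fun h => h2 h.symm) hcz hbd.symm hzc.symm, ?_, ?_, fun u v h hu hv => ?_⟩ <;>
      simp only [edgeSwitch_adj, ne_eq, Sym2.eq_iff] <;> grind [adj_comm, Adj.ne]
  · obtain ⟨z, haz, hdz, hzd⟩ := exists_adj_not_adj_of_ncard_le_s1 hda hcd.symm h1 hac.symm
    refine ⟨G.edgeSwitch c d a z, ncard_neighborSet_edgeSwitch hcd haz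
      (fun h => h1 h.symm) hdz hac.symm hzd.symm, ?_, ?_, fun u v h hu hv => ?_⟩ <;>
      simp only [edgeSwitch_adj, ne_eq, Sym2.eq_iff] <;> grind [adj_comm, Adj.ne]
  · refine ⟨G.edgeSwitch a b c d, ncard_neighborSet_edgeSwitch hab hcd h1 h2 hac hbd,
      ?_, ?_, fun u v h hu hv => ?_⟩ <;>
      simp only [edgeSwitch_adj, ne_eq, Sym2.eq_iff] <;> grind [adj_comm, Adj.ne]

end SimpleGraph

theorem isPerfectMatchingOn_Mplus {n : ℕ} (hn : Even n) : IsPerfectMatchingOn n (Mplus n) := by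
  obtain ⟨m, hm⟩ := hn
  refine ⟨?_, fun v => ?_⟩
  · rintro _ ⟨u, v, rfl, hu, hv⟩ h
    rw [Sym2.mk_isDiag_iff] at h
    subst h
    omega
  · rcases Nat.mod_two_eq_zero_or_one v with h | h
    · refine ⟨s(v, ⟨v + 1, by omega⟩), ⟨⟨v, ⟨v + 1, by omega⟩, rfl, h, rfl⟩, by simp⟩, ?_⟩
      rintro _ ⟨⟨x, y, rfl, hx, hy⟩, hv⟩
      rcases Sym2.mem_iff.1 hv with rfl | rfl
      · congr 2
        exact Fin.ext hy
      · omega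
    · refine ⟨s(⟨v - 1, by omega⟩, v),
        ⟨⟨⟨v - 1, by omega⟩, v, rfl, by simp only; omega, by simp only; omega⟩, by simp⟩, ?_⟩
      rintro _ ⟨⟨x, y, rfl, hx, hy⟩, hv⟩
      rcases Sym2.mem_iff.1 hv with rfl | rfl
      · omega
      · congr 2
        exact Fin.ext (by simp only; omega)

theorem IsPerfectMatchingOn.exists_involution {n : ℕ} {M : Set (Sym2 (Fin n))}
    (hM : IsPerfectMatchingOn n M) :
    ∃ f : Fin n → Fin n, (∀ v, f (f v) = v) ∧ (∀ v, f v ≠ v) ∧ ∀ e ∈ M, ∃ v, e = s(v, f v) := by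
  obtain ⟨hdiag, huniq⟩ := hM
  have partner : ∀ v, ∃ w, s(v, w) ∈ M := fun v => by
    obtain ⟨e, ⟨he, w, rfl⟩, -⟩ := huniq v
    exact ⟨w, he⟩
  choose f hf using partner
  have eq_of_mem : ∀ v w, s(v, w) ∈ M → w = f v := fun v w h =>
    Sym2.congr_right.1 ((huniq v).unique ⟨h, Sym2.mem_mk_left _ _⟩ ⟨hf v, Sym2.mem_mk_left _ _⟩)
  refine ⟨f, fun v => ?_, fun v hv => ?_, fun e he => ?_⟩
  · exact (eq_of_mem (f v) v (Sym2.eq_swap ▸ hf v)).symm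
  · exact hdiag _ (hf v) (Sym2.mk_isDiag_iff.2 hv.symm)
  · induction e using Sym2.ind with
    | _ x y => exact ⟨x, by rw [← eq_of_mem x y he]⟩

theorem exists_graph_of_realizes_Mplus {n : ℕ} (hn : Even n) {d : Fin n → ℕ} (hd : Antitone d)
    (h : Realizes d (Mplus n)) {k : ℕ} (hk : 2 * k ≤ n) :
    ∀ f : Fin n → Fin n, (∀ v, f (f v) = v) → (∀ v, f v ≠ v) →
      (∀ u v : Fin n, (u : ℕ) % 2 = 0 → (v : ℕ) = u + 1 → (u : ℕ) < 2 * k → f u = v) →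
      ∃ G : SimpleGraph (Fin n), (∀ i, (G.neighborSet i).ncard = d i) ∧ ∀ v, G.Adj v (f v) := by
  obtain ⟨m, hm⟩ := hn
  have hkm : k ≤ m := by omega
  clear hk
  induction hkm using Nat.decreasingInduction with
  | self =>
    intro f hinv _ hagree
    obtain ⟨G, hdeg, hsub⟩ := h
    refine ⟨G, hdeg, fun v => ?_⟩
    rcases Nat.mod_two_eq_zero_or_one v with hv | hv
    · rw [hagree v ⟨v + 1, by omega⟩ hv rfl (by omega)]
      exact hsub ⟨v, _, rfl, hv, rfl⟩
    · have hu : f ⟨v - 1, by omega⟩ = v :=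
        hagree ⟨v - 1, by omega⟩ v (by simp only; omega) (by simp only; omega)
          (by simp only; omega)
      have hfv : f v = ⟨v - 1, by omega⟩ := by rw [← hinv ⟨v - 1, by omega⟩, hu]
      rw [hfv]
      refine SimpleGraph.Adj.symm (hsub ⟨_, v, rfl, ?_, ?_⟩) <;> simp only <;> omega
  | of_succ k hkm ih =>
    intro f hinv hfix hagree
    obtain ⟨a, ha⟩ : ∃ a : Fin n, (a : ℕ) = 2 * k := ⟨⟨2 * k, by omega⟩, rfl⟩
    obtain ⟨b, hb⟩ : ∃ b : Fin n, (b : ℕ) = 2 * k + 1 := ⟨⟨2 * k + 1, by omega⟩, rfl⟩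
    by_cases hfab : f a = b
    · refine ih f hinv hfix fun u v hu hv huk => ?_
      by_cases hlt : (u : ℕ) < 2 * k
      · exact hagree u v hu hv hlt
      · rwa [show u = a from Fin.ext (by omega), show v = b from Fin.ext (by omega)]
    have low : ∀ v : Fin n, (v : ℕ) < 2 * k → (f v : ℕ) < 2 * k := by
      intro v hv
      rcases Nat.mod_two_eq_zero_or_one v with h0 | h1
      · rw [hagree v ⟨v + 1, by omega⟩ h0 rfl hv]
        simp only
        omega
      · have hu : f ⟨v - 1, by omega⟩ = v :=
          hagree ⟨v - 1, by omega⟩ v (by simp only; omega) (by simp only; omega)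
            (by simp only; omega)
        rw [← hu, hinv]
        simp only
        omega
    have high : ∀ v : Fin n, 2 * k ≤ (v : ℕ) → 2 * k ≤ (f v : ℕ) := by
      intro v hv
      by_contra! hlt
      have := low _ hlt
      rw [hinv] at this
      omega
    have hfa := high a ha.ge
    have hfb := high b (by omega)
    have hab : a ≠ b := fun h => by rw [h] at ha; omega
    have hac : a ≠ f a := (hfix a).symm
    have had : a ≠ f b := fun h => hfab (by rw [h, hinv])
    have hbc : b ≠ f a := fun h => hfab h.symm
    have hbd : b ≠ f b := (hfix b).symm
    have hcd : f a ≠ f b := fun h => hab (by rw [← hinv a, h, hinv])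
    set σ := Equiv.swap b (f a) with hσ
    have hσσ : ∀ v, σ (σ v) = v := fun v => by simp [hσ]
    obtain ⟨G, hdeg, hadj⟩ := ih (fun v => σ (f (σ v))) (fun v => by simp [hσσ, hinv])
      (fun v hv => hfix (σ v) (by rw [← hσσ (f (σ v)), hv])) (by
        intro u v hu hv huk
        by_cases hlt : (u : ℕ) < 2 * k
        · have hub : u ≠ b := by rintro rfl; omega
          have hua : u ≠ f a := by rintro rfl; omega
          have hvb : v ≠ b := by rintro rfl; omega
          have hva : v ≠ f a := by rintro rfl; omega
          simp only [hσ]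
          rw [Equiv.swap_apply_of_ne_of_ne hub hua, hagree u v hu hv hlt,
            Equiv.swap_apply_of_ne_of_ne hvb hva]
        · rw [show u = a from Fin.ext (by omega), show v = b from Fin.ext (by omega)]
          simp only [hσ]
          rw [Equiv.swap_apply_of_ne_of_ne hab hac, Equiv.swap_apply_right])
    have hGab : G.Adj a b := by
      have := hadj a
      simp only [hσ] at this
      rwa [Equiv.swap_apply_of_ne_of_ne hab hac, Equiv.swap_apply_right] at this
    have hGcd : G.Adj (f a) (f b) := by
      have := hadj (f a)
      simp only [hσ] at this
      rwa [Equiv.swap_apply_right, Equiv.swap_apply_of_ne_of_ne hbd.symm hcd.symm] at this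
    obtain ⟨G', hdeg', hG'ac, hG'bd, hG'⟩ :=
      SimpleGraph.exists_same_degrees_of_rematch hGab hGcd hac had hbc hbd
        (by
          rw [hdeg, hdeg]
          refine hd (Fin.le_def.2 ?_)
          have := Fin.val_ne_of_ne hac
          omega)
        (by rw [hdeg, hdeg]; exact hd (Fin.le_def.2 (by omega)))
    refine ⟨G', fun i => (hdeg' i).trans (hdeg i), fun v => ?_⟩
    by_cases hva : v = a
    · rwa [hva]
    by_cases hvb : v = b
    · rwa [hvb]
    by_cases hvc : v = f a
    · rw [hvc, hinv]; exact hG'ac.symm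
    by_cases hvd : v = f b
    · rw [hvd, hinv]; exact hG'bd.symm
    have hfva : f v ≠ a := fun h => hvc (by rw [← h, hinv])
    have hfvb : f v ≠ b := fun h => hvd (by rw [← h, hinv])
    have hfvc : f v ≠ f a := fun h => hva (by rw [← hinv v, h, hinv])
    have hfvd : f v ≠ f b := fun h => hvb (by rw [← hinv v, h, hinv])
    refine hG' v (f v) ?_ (by simp [hva, hvb, hvc, hvd]) (by simp [hfva, hfvb, hfvc, hfvd])
    have := hadj v
    simp only [hσ] at this
    rwa [Equiv.swap_apply_of_ne_of_ne hvb hvc, Equiv.swap_apply_of_ne_of_ne hfvb hfvc] at this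

theorem stmt_1 {n : ℕ} (hn : Even n) (d : Fin n → ℕ) (hd : Antitone d)
    (hd1 : ∀ i, 1 ≤ d i) :
    (∀ M : Set (Sym2 (Fin n)), IsPerfectMatchingOn n M → Realizes d M) ↔
      Realizes d (Mplus n) := by
  refine ⟨fun h => h _ (isPerfectMatchingOn_Mplus hn), fun h M hM => ?_⟩
  obtain ⟨f, hinv, hfix, hMf⟩ := hM.exists_involution
  obtain ⟨G, hdeg, hadj⟩ := exists_graph_of_realizes_Mplus hn hd h (Nat.zero_le n) (k := 0) f
    hinv hfix fun u v _ _ hu => by omega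
  refine ⟨G, hdeg, fun e he => ?_⟩
  obtain ⟨v, rfl⟩ := hMf e he
  exact hadj v
end

section
/- Let n ∈ ℕ and let d_1 ≥ d_2 ≥ … ≥ d_n ≥ 1 be integers. The sequence (d_1, d_2, …, d_n) can realize M⁺ = {(1,2), (3,4), …, (n−1,n)} if and only if Σ_{i=1}^n d_i is even, n is even, and for every k ∈ [n]: Σ_{i=1}^k d_i ≤ k(k−1) + Σ_{i=k+1}^n min{d_i − 1, k} when k is even, and Σ_{i=1}^k d_i ≤ k(k−1) + min{d_{k+1}, k} + Σ_{i=k+2}^n min{d_i − 1, k} when k is odd (sums over empty index ranges are zero). -/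
/-- `(d_1, …, d_n)` can realize the perfect matching
`M⁺ = {(1,2), (3,4), …, (n−1,n)}`: there is a simple graph `G` on `[n]` with
`deg_G(i) = d i` which, for every even (0-indexed) vertex `i`, contains the
edge from `i` to `i+1`.  (In particular this forces `n` to be even, since the
pairing must cover every vertex.) -/
def RealizesMplus {n : ℕ} (d : Fin n → ℕ) : Prop :=
  ∃ G : SimpleGraph (Fin n), (∀ i, (G.neighborSet i).ncard = d i) ∧
    ∀ i : Fin n, (i : ℕ) % 2 = 0 → ∃ h : (i : ℕ) + 1 < n, G.Adj i ⟨(i : ℕ) + 1, h⟩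

open Classical in
/-- The neighbours of `v` in `G`, as a finset. -/
noncomputable def nbrs {n : ℕ} (G : SimpleGraph (Fin n)) (v : Fin n) : Finset (Fin n) :=
  Finset.univ.filter fun w => G.Adj v w

lemma mem_nbrs {n : ℕ} {G : SimpleGraph (Fin n)} {v w : Fin n} :
    w ∈ nbrs G v ↔ G.Adj v w := by
  simp [nbrs]

lemma card_nbrs_eq_ncard {n : ℕ} (G : SimpleGraph (Fin n)) (v : Fin n) :
    (nbrs G v).card = (G.neighborSet v).ncard := by
  rw [← Set.ncard_coe_finset]
  congr 1
  ext w
  simp [mem_nbrs]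

lemma even_sum_card_nbrs {n : ℕ} (G : SimpleGraph (Fin n)) :
    Even (∑ v, (nbrs G v).card) := by
  classical
  have h := G.sum_degrees_eq_twice_card_edges
  have h2 : ∀ v, (nbrs G v).card = G.degree v := by
    intro v
    rw [← SimpleGraph.card_neighborFinset_eq_degree]
    congr 1
    ext w
    simp [mem_nbrs]
  simp only [h2, h]
  exact even_two_mul _

lemma exists_add_edge {n : ℕ} (G : SimpleGraph (Fin n)) {a b : Fin n} (hab : a ≠ b)
    (h : ¬ G.Adj a b) : ∃ G' : SimpleGraph (Fin n),
      (∀ x y, G'.Adj x y ↔ G.Adj x y ∨ (x = a ∧ y = b) ∨ (x = b ∧ y = a)) ∧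
      ∀ v, (nbrs G' v).card =
        (nbrs G v).card + (if v = a then 1 else 0) + (if v = b then 1 else 0) := by
  have hba : ¬ G.Adj b a := fun h' => h h'.symm
  refine ⟨⟨fun x y => G.Adj x y ∨ (x = a ∧ y = b) ∨ (x = b ∧ y = a), ?_, ?_⟩,
    fun x y => Iff.rfl, fun v => ?_⟩
  · refine ⟨fun x y hxy => ?_⟩
    rcases hxy with hxy | hxy | hxy
    · exact Or.inl hxy.symm
    · exact Or.inr (Or.inr hxy.symm)
    · exact Or.inr (Or.inl hxy.symm)
  · refine ⟨fun x hx => ?_⟩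
    rcases hx with hx | hx | hx
    · exact G.loopless.irrefl x hx
    · exact hab (hx.1.symm.trans hx.2)
    · exact hab (hx.2.symm.trans hx.1)
  · by_cases hva : v = a
    · subst hva
      rw [if_pos rfl, if_neg hab, add_zero,
        ← Finset.card_insert_of_notMem (a := b) (s := nbrs G v) (by simpa [mem_nbrs] using h)]
      congr 1
      ext w
      simp only [mem_nbrs, Finset.mem_insert]
      grind
    · by_cases hvb : v = b
      · subst hvb
        rw [if_pos rfl, if_neg hva, add_zero,
          ← Finset.card_insert_of_notMem (a := a) (s := nbrs G v) (by simpa [mem_nbrs] using hba)]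
        congr 1
        ext w
        simp only [mem_nbrs, Finset.mem_insert]
        grind
      · rw [if_neg hva, if_neg hvb]
        simp only [add_zero]
        congr 1
        ext w
        simp only [mem_nbrs]
        grind

lemma exists_delete_edge {n : ℕ} (G : SimpleGraph (Fin n)) {a b : Fin n}
    (h : G.Adj a b) : ∃ G' : SimpleGraph (Fin n),
      (∀ x y, G'.Adj x y ↔ G.Adj x y ∧ ¬ (x = a ∧ y = b) ∧ ¬ (x = b ∧ y = a)) ∧
      ∀ v, (nbrs G' v).card + (if v = a then 1 else 0) + (if v = b then 1 else 0) =
        (nbrs G v).card := by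
  let G' : SimpleGraph (Fin n) :=
    ⟨fun x y => G.Adj x y ∧ ¬ (x = a ∧ y = b) ∧ ¬ (x = b ∧ y = a),
      ⟨fun x y hxy => ⟨hxy.1.symm, fun h' => hxy.2.2 h'.symm, fun h' => hxy.2.1 h'.symm⟩⟩,
      ⟨fun x hx => G.loopless.irrefl x hx.1⟩⟩
  obtain ⟨G'', hadj, hcard⟩ := exists_add_edge G' (a := a) (b := b) h.ne
    (fun h' => h'.2.1 ⟨rfl, rfl⟩)
  have hGG : G'' = G := by
    ext x y
    rw [hadj]
    constructor
    · rintro (h' | ⟨rfl, rfl⟩ | ⟨rfl, rfl⟩)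
      · exact h'.1
      · exact h
      · exact h.symm
    · intro h'
      by_cases h1 : x = a ∧ y = b
      · exact Or.inr (Or.inl h1)
      · by_cases h2 : x = b ∧ y = a
        · exact Or.inr (Or.inr h2)
        · exact Or.inl ⟨h', h1, h2⟩
  subst hGG
  exact ⟨G', fun x y => Iff.rfl, fun v => (hcard v).symm⟩

lemma exists_mem_sdiff_notMem {α : Type*} [DecidableEq α] {A B X Y : Finset α}
    (hXA : X ⊆ A) (hXB : Disjoint X B) (hcard : A.card + Y.card < B.card + X.card) :
    ∃ u ∈ B, u ∉ A ∧ u ∉ Y := by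
  by_contra! hcon
  have h1 : B ∪ X ⊆ A ∪ Y := by
    intro u hu
    rcases Finset.mem_union.1 hu with hu | hu
    · by_cases hA : u ∈ A
      · exact Finset.mem_union_left _ hA
      · exact Finset.mem_union_right _ (hcon u hu hA)
    · exact Finset.mem_union_left _ (hXA hu)
  have h2 := Finset.card_le_card h1
  rw [Finset.card_union_of_disjoint hXB.symm] at h2
  have := Finset.card_union_le A Y
  omega

/-- `G` avoids the pairs `{v, p v}`, has degrees bounded by `e` with equality below `r`, and
has no edge above `r`. -/
structure IsSubrealization {n : ℕ} (e : Fin n → ℕ) (p : Fin n → Fin n) (r : Fin n)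
    (G : SimpleGraph (Fin n)) : Prop where
  avoid : ∀ v, ¬ G.Adj v (p v)
  le : ∀ v, (nbrs G v).card ≤ e v
  sat : ∀ v, v < r → (nbrs G v).card = e v
  indep : ∀ v w, r < v → r < w → ¬ G.Adj v w

section Stuck

variable {n : ℕ} {e : Fin n → ℕ} {p : Fin n → Fin n} {r : Fin n} {G : SimpleGraph (Fin n)}

lemma IsSubrealization.adj_of_deficient (hG : IsSubrealization e p r G)
    (hp : ∀ v, p (p v) = v)
    (hmax : ∀ G', IsSubrealization e p r G' → (nbrs G' r).card ≤ (nbrs G r).card)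
    (hr : (nbrs G r).card < e r) {k : Fin n} (hk : r < k) (hdk : (nbrs G k).card < e k)
    (hkp : k ≠ p r) : G.Adj r k := by
  by_contra hadj
  obtain ⟨G₁, a₁, d₁⟩ := exists_add_edge G hk.ne hadj
  obtain ⟨g1, g2, g3, g4⟩ := hG
  have := hmax G₁ ⟨by grind, by grind, by grind, by grind⟩
  grind

lemma IsSubrealization.not_adj_above (hG : IsSubrealization e p r G)
    (hp : ∀ v, p (p v) = v)
    (hmax : ∀ G', IsSubrealization e p r G' → (nbrs G' r).card ≤ (nbrs G r).card)
    (hr : (nbrs G r).card < e r) {i u : Fin n} (hi : i < r) (hip : i ≠ p r)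
    (hir : ¬ G.Adj i r) (hu : r < u) : ¬ G.Adj i u := by
  intro hiu
  obtain ⟨G₁, a₁, d₁⟩ := exists_delete_edge G hiu
  obtain ⟨G₂, a₂, d₂⟩ := exists_add_edge G₁ (a := i) (b := r) hi.ne (by grind)
  obtain ⟨g1, g2, g3, g4⟩ := hG
  have := hmax G₂ ⟨by grind, by grind, by grind, by grind⟩
  grind

/-- Replacing the edge `ab` by `ar` and `bk` is an improvement. -/
lemma IsSubrealization.false_of_exchange (hG : IsSubrealization e p r G)
    (hp : ∀ v, p (p v) = v)
    (hmax : ∀ G', IsSubrealization e p r G' → (nbrs G' r).card ≤ (nbrs G r).card)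
    (hr : (nbrs G r).card < e r) {a b k : Fin n} (hab : G.Adj a b)
    (har : ¬ G.Adj a r) (har' : a ≠ r) (hap : a ≠ p r) (hk : r < k)
    (hdk : (nbrs G k).card < e k) (hb : b < r) (hbk : ¬ G.Adj b k) (hbp : b ≠ p k)
    (hak : a ≠ k) : False := by
  have hrb : r ≠ b := hb.ne'
  have hsymm : ∀ x y, G.Adj x y → G.Adj y x := fun _ _ h => h.symm
  obtain ⟨G₁, a₁, d₁⟩ := exists_delete_edge G hab
  obtain ⟨G₂, a₂, d₂⟩ := exists_add_edge G₁ (a := a) (b := r) har' (by grind)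
  obtain ⟨G₃, a₃, d₃⟩ := exists_add_edge G₂ (a := b) (b := k) (hb.trans hk).ne (by grind)
  have hab' := hab.ne
  obtain ⟨g1, g2, g3, g4⟩ := hG
  have := hmax G₃ ⟨by grind, by grind, by grind, by grind⟩
  grind

lemma IsSubrealization.adj_below (hG : IsSubrealization e p r G)
    (hp : ∀ v, p (p v) = v) (he : Antitone e) (heven : Even (∑ v, e v))
    (hmax : ∀ G', IsSubrealization e p r G' → (nbrs G' r).card ≤ (nbrs G r).card)
    (hr : (nbrs G r).card < e r) {i : Fin n} (hi : i < r) (hip : i ≠ p r) : G.Adj i r := by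
  by_contra hir
  have hri : ¬ G.Adj r i := fun h => hir h.symm
  have hei : e r ≤ e i := he hi.le
  have hsi := hG.sat i hi
  have habove : ∀ u, r < u → ¬ G.Adj i u := fun u hu =>
    hG.not_adj_above hp hmax hr hi hip hir hu
  have hsymm : ∀ x y, G.Adj x y → G.Adj y x := fun _ _ h => h.symm
  by_cases hdef : (nbrs G r).card + 2 ≤ e r
  · obtain ⟨u, hu, hur, huY⟩ := exists_mem_sdiff_notMem (A := nbrs G r) (B := nbrs G i)
      (X := ∅) (Y := {p r}) (by simp) (by simp) (by simp; omega)
    rw [mem_nbrs] at hu hur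
    rw [Finset.mem_singleton] at huY
    have hur' : u ≠ r := by grind
    have hab' := hu.ne
    obtain ⟨G₁, a₁, d₁⟩ := exists_delete_edge G hu
    obtain ⟨G₂, a₂, d₂⟩ := exists_add_edge G₁ (a := u) (b := r) hur' (by grind)
    obtain ⟨G₃, a₃, d₃⟩ := exists_add_edge G₂ (a := i) (b := r) hi.ne (by grind)
    obtain ⟨g1, g2, g3, g4⟩ := hG
    have := hmax G₃ ⟨by grind, by grind, by grind, by grind⟩
    grind
  · obtain ⟨k, hk, hdk⟩ : ∃ k, r < k ∧ (nbrs G k).card < e k := by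
      by_contra! hcon
      have h1 : ∑ v, e v = ∑ v, ((nbrs G v).card + if v = r then 1 else 0) := by
        refine Finset.sum_congr rfl fun v _ => ?_
        have := hG.le v
        rcases lt_trichotomy v r with h | h | h
        · rw [if_neg h.ne, hG.sat v h, add_zero]
        · subst h
          simp only [if_true]
          omega
        · rw [if_neg h.ne']
          have := hcon v h
          omega
      rw [Finset.sum_add_distrib] at h1
      simp only [Finset.sum_ite_eq', Finset.mem_univ, if_true] at h1
      have h2 := even_sum_card_nbrs G
      rw [h1] at heven
      exact Nat.not_even_iff_odd.2 (h2.add_one) heven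
    by_cases hkp : k = p r
    · obtain ⟨u, hu, hur, -⟩ := exists_mem_sdiff_notMem (A := nbrs G r) (B := nbrs G i)
        (X := ∅) (Y := ∅) (by simp) (by simp) (by simp; omega)
      rw [mem_nbrs] at hu hur
      have hur' : u < r := by
        rcases lt_trichotomy u r with h | h | h
        · exact h
        · exact absurd (h ▸ hu) hir
        · exact absurd hu (habove u h)
      have hur'' : ¬ G.Adj u r := fun h => hur h.symm
      have hup : u ≠ p r := by
        rw [← hkp]
        exact (hur'.trans hk).ne
      have huk := hG.not_adj_above hp hmax hr hur' hup hur'' hk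
      refine hG.false_of_exchange hp hmax hr hu hir hi.ne hip hk hdk hur' huk ?_
        (hi.trans hk).ne
      rw [hkp, hp]
      exact hur'.ne
    · have hrk := hG.adj_of_deficient hp hmax hr hk hdk hkp
      have hik := habove k hk
      obtain ⟨u, hu, hur, huY⟩ := exists_mem_sdiff_notMem (A := nbrs G r) (B := nbrs G i)
        (X := {k}) (Y := {p r}) (by simpa [mem_nbrs] using hrk)
        (by simpa [mem_nbrs] using hik) (by simp; omega)
      rw [mem_nbrs] at hu hur
      rw [Finset.mem_singleton] at huY
      have hur' : u ≠ r := by grind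
      have huk : u ≠ k := by grind
      have hki : k ≠ i := (hi.trans hk).ne'
      have hui := hu.ne
      obtain ⟨G₀, a₀, d₀⟩ := exists_delete_edge G hrk
      obtain ⟨G₁, a₁, d₁⟩ := exists_delete_edge G₀ (a := i) (b := u) (by grind)
      obtain ⟨G₂, a₂, d₂⟩ := exists_add_edge G₁ (a := u) (b := r) hur' (by grind)
      obtain ⟨G₃, a₃, d₃⟩ := exists_add_edge G₂ (a := i) (b := r) hi.ne (by grind)
      obtain ⟨g1, g2, g3, g4⟩ := hG
      have := hmax G₃ ⟨by grind, by grind, by grind, by grind⟩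
      grind

lemma IsSubrealization.adj_above (hG : IsSubrealization e p r G)
    (hp : ∀ v, p (p v) = v) (he : Antitone e) (heven : Even (∑ v, e v))
    (hmax : ∀ G', IsSubrealization e p r G' → (nbrs G' r).card ≤ (nbrs G r).card)
    (hr : (nbrs G r).card < e r) {k i : Fin n} (hk : r < k) (hdk : (nbrs G k).card < e k)
    (hi : i ≤ r) (hik : i ≠ p k) : G.Adj k i := by
  by_contra hki
  have hik' : ¬ G.Adj i k := fun h => hki h.symm
  have hir : i < r := by
    refine lt_of_le_of_ne hi fun h => ?_
    subst h
    exact hik' (hG.adj_of_deficient hp hmax hr hk hdk fun h => hik (by rw [h, hp]))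
  have hei : e r ≤ e i := he hi
  have hsi := hG.sat i hir
  have hki' : i ≠ k := (hir.trans hk).ne
  obtain ⟨u, hu, hur, hur', hup⟩ : ∃ u, G.Adj i u ∧ ¬ G.Adj r u ∧ u ≠ r ∧ u ≠ p r := by
    have hbelow : i ≠ p r → G.Adj r i := fun h =>
      (hG.adj_below hp he heven hmax hr hir h).symm
    by_cases hkp : k = p r
    · have hri : G.Adj r i := hbelow fun h => hki' (h.trans hkp.symm)
      obtain ⟨u, hu, hur, huY⟩ := exists_mem_sdiff_notMem (A := nbrs G r) (B := nbrs G i)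
        (X := {i}) (Y := {r}) (by simpa [mem_nbrs] using hri)
        (by simp [mem_nbrs]) (by simp; omega)
      rw [mem_nbrs] at hu hur
      rw [Finset.mem_singleton] at huY
      exact ⟨u, hu, hur, huY, fun h => hik' (by rwa [hkp, ← h])⟩
    · have hrk := hG.adj_of_deficient hp hmax hr hk hdk hkp
      by_cases hip : i = p r
      · obtain ⟨u, hu, hur, huY⟩ := exists_mem_sdiff_notMem (A := nbrs G r) (B := nbrs G i)
          (X := {k}) (Y := {r}) (by simpa [mem_nbrs] using hrk)
          (by simpa [mem_nbrs] using hik') (by simp; omega)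
        rw [mem_nbrs] at hu hur
        rw [Finset.mem_singleton] at huY
        exact ⟨u, hu, hur, huY, fun h => hu.ne (hip.trans h.symm)⟩
      · obtain ⟨u, hu, hur, huY⟩ := exists_mem_sdiff_notMem (A := nbrs G r) (B := nbrs G i)
          (X := {i, k}) (Y := {r, p r})
          (by intro x; simp only [Finset.mem_insert, Finset.mem_singleton, mem_nbrs]
              rintro (rfl | rfl)
              · exact hbelow hip
              · exact hrk)
          (by simp [mem_nbrs, hik'])
          (by
            have := Finset.card_le_two (a := r) (b := p r)
            rw [Finset.card_pair hki']; omega)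
        rw [mem_nbrs] at hu hur
        simp only [Finset.mem_insert, Finset.mem_singleton, not_or] at huY
        exact ⟨u, hu, hur, huY⟩
  exact hG.false_of_exchange hp hmax hr hu.symm (fun h => hur h.symm) hur' hup hk hdk hir
    hik' hik fun h => hik' (h ▸ hu)

lemma IsSubrealization.exists_neighbor_above (hG : IsSubrealization e p r G)
    (hp : ∀ v, p (p v) = v) (hp' : ∀ v, p v ≠ v) (hpr : ∀ v, v < r → p v ≤ r)
    (he : Antitone e) (heven : Even (∑ v, e v))
    (hmax : ∀ G', IsSubrealization e p r G' → (nbrs G' r).card ≤ (nbrs G r).card)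
    (hr : (nbrs G r).card < e r) {i : Fin n} (hi : i < r) (hip : i ≠ p r) :
    ∃ u, G.Adj i u ∧ r < u ∧ ¬ G.Adj r u ∧ u ≠ p r := by
  have hbelow : ∀ {i}, i < r → i ≠ p r → G.Adj r i := fun h h' =>
    (hG.adj_below hp he heven hmax hr h h').symm
  have hei : e r ≤ e i := he hi.le
  have hsi := hG.sat i hi
  have h1 : p i < r := lt_of_le_of_ne (hpr i hi) fun h => hip (by rw [← h, hp])
  have h2 : p i ≠ p r := fun h => hi.ne (by rw [← hp i, h, hp])
  obtain ⟨u, hu, hur, huY⟩ := exists_mem_sdiff_notMem (A := nbrs G r) (B := nbrs G i)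
    (X := {i, p i}) (Y := {r, p r})
    (by intro x; simp only [Finset.mem_insert, Finset.mem_singleton, mem_nbrs]
        rintro (rfl | rfl)
        · exact hbelow hi hip
        · exact hbelow h1 h2)
    (by simp [mem_nbrs, hG.avoid i])
    (by
      have := Finset.card_le_two (a := r) (b := p r)
      rw [Finset.card_pair (hp' i).symm]; omega)
  rw [mem_nbrs] at hu hur
  simp only [Finset.mem_insert, Finset.mem_singleton, not_or] at huY
  refine ⟨u, hu, ?_, hur, huY.2⟩
  by_contra h
  exact hur (hbelow (lt_of_le_of_ne (not_lt.1 h) huY.1) huY.2)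

lemma IsSubrealization.clique_below (hG : IsSubrealization e p r G)
    (hp : ∀ v, p (p v) = v) (hp' : ∀ v, p v ≠ v) (hpr : ∀ v, v < r → p v ≤ r)
    (he : Antitone e) (heven : Even (∑ v, e v))
    (hmax : ∀ G', IsSubrealization e p r G' → (nbrs G' r).card ≤ (nbrs G r).card)
    (hr : (nbrs G r).card < e r) {i j : Fin n} (hi : i < r) (hj : j < r) (hij : i ≠ j)
    (hjp : j ≠ p i) : G.Adj i j := by
  by_contra hadj
  wlog hip : i ≠ p r generalizing i j
  · push Not at hip
    exact this hj hi hij.symm (fun h => hjp (by rw [h, hp])) (fun h => hadj h.symm)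
      fun h => hij (hip.trans h.symm)
  obtain ⟨u, hu, hru, hur, hup⟩ :=
    hG.exists_neighbor_above hp hp' hpr he heven hmax hr hi hip
  obtain ⟨w, hw, hrw⟩ : ∃ w, G.Adj j w ∧ r < w := by
    by_cases hj' : j = p r
    · have hri := (hG.adj_below hp he heven hmax hr hi hip).symm
      have hej : e r ≤ e j := he hj.le
      have hsj := hG.sat j hj
      obtain ⟨w, hw, hwr, hwY⟩ := exists_mem_sdiff_notMem (A := nbrs G r) (B := nbrs G j)
        (X := {i}) (Y := {r}) (by simpa [mem_nbrs] using hri)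
        (by simpa [mem_nbrs, G.adj_comm j i] using hadj) (by simp; omega)
      rw [mem_nbrs] at hw hwr
      rw [Finset.mem_singleton] at hwY
      refine ⟨w, hw, ?_⟩
      by_contra h
      refine hwr (hG.adj_below hp he heven hmax hr (lt_of_le_of_ne (not_lt.1 h) hwY) ?_).symm
      exact fun h => hw.ne (hj'.trans h.symm)
    · obtain ⟨w, hw, hrw, -⟩ :=
        hG.exists_neighbor_above hp hp' hpr he heven hmax hr hj hj'
      exact ⟨w, hw, hrw⟩
  have hsymm : ∀ x y, G.Adj x y → G.Adj y x := fun _ _ h => h.symm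
  obtain ⟨G₀, a₀, d₀⟩ := exists_delete_edge G hu
  obtain ⟨G₁, a₁, d₁⟩ := exists_delete_edge G₀ (a := j) (b := w) (by grind)
  obtain ⟨G₂, a₂, d₂⟩ := exists_add_edge G₁ (a := i) (b := j) hij (by grind)
  obtain ⟨G₃, a₃, d₃⟩ := exists_add_edge G₂ (a := u) (b := r) hru.ne' (by grind)
  have hiw : i < w := hi.trans hrw
  have hjw : j < w := hj.trans hrw
  have hiu : i < u := hi.trans hru
  have hju : j < u := hj.trans hru
  obtain ⟨g1, g2, g3, g4⟩ := hG
  have := hmax G₃ ⟨by grind, by grind, by grind (splits := 20), by grind⟩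
  grind

end Stuck

/-- The number of neighbours of `v` among the first `k` vertices. -/
noncomputable def lowDegree {n : ℕ} (G : SimpleGraph (Fin n)) (k : ℕ) (v : Fin n) : ℕ :=
  ((nbrs G v).filter fun w : Fin n => (w : ℕ) < k).card

lemma sum_card_nbrs_lt {n : ℕ} (G : SimpleGraph (Fin n)) (k : ℕ) :
    ∑ i ∈ Finset.univ.filter (fun i : Fin n => (i : ℕ) < k), (nbrs G i).card =
      ∑ i ∈ Finset.univ.filter (fun i : Fin n => (i : ℕ) < k), lowDegree G k i +
      ∑ i ∈ Finset.univ.filter (fun i : Fin n => k ≤ (i : ℕ)), lowDegree G k i := by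
  classical
  have h1 : ∀ i, (nbrs G i).card =
      lowDegree G k i + ((nbrs G i).filter fun w : Fin n => k ≤ (w : ℕ)).card := by
    intro i
    rw [lowDegree, ← Finset.card_filter_add_card_filter_not (s := nbrs G i)
      (fun w : Fin n => (w : ℕ) < k)]
    simp only [not_lt]
  simp only [h1, Finset.sum_add_distrib]
  congr 1
  have h2 := Finset.sum_card_bipartiteAbove_eq_sum_card_bipartiteBelow
    (s := Finset.univ.filter (fun i : Fin n => (i : ℕ) < k))
    (t := Finset.univ.filter (fun i : Fin n => k ≤ (i : ℕ))) G.Adj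
  convert h2 using 2 with i hi j hj
  · congr 1
    ext w
    simp [mem_nbrs, Finset.bipartiteAbove, and_comm]
  · rw [lowDegree]
    congr 1
    ext w
    simp [mem_nbrs, Finset.bipartiteBelow, and_comm, G.adj_comm]

lemma card_filter_val_lt {n k : ℕ} (hk : k ≤ n) :
    (Finset.univ.filter fun i : Fin n => (i : ℕ) < k).card = k := by
  rw [Fin.card_filter_val_lt, min_eq_right hk]

lemma lowDegree_le {n k : ℕ} (hk : k ≤ n) (G : SimpleGraph (Fin n)) (v : Fin n) :
    lowDegree G k v ≤ k := by
  refine (Finset.card_le_card ?_).trans (card_filter_val_lt hk).le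
  intro w
  simp

lemma card_erase_filter_val_lt {n k : ℕ} (hk : k ≤ n) {v : Fin n} (hv : (v : ℕ) < k) :
    ((Finset.univ.filter fun i : Fin n => (i : ℕ) < k).erase v).card = k - 1 := by
  rw [Finset.card_erase_of_mem (by simpa using hv), card_filter_val_lt hk]

lemma lowDegree_le_pred {n k : ℕ} (hk : k ≤ n) (G : SimpleGraph (Fin n)) {v : Fin n}
    (hv : (v : ℕ) < k) : lowDegree G k v ≤ k - 1 := by
  rw [← card_erase_filter_val_lt hk hv]
  refine Finset.card_le_card fun w => ?_
  simp only [Finset.mem_filter, mem_nbrs, Finset.mem_erase, Finset.mem_univ, true_and]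
  exact fun h => ⟨h.1.ne', h.2⟩

/-- The partner of a vertex in the matching `{(0, 1), (2, 3), …}`. -/
def partner {n : ℕ} (hn : Even n) (i : Fin n) : Fin n :=
  ⟨if (i : ℕ) % 2 = 0 then i + 1 else i - 1, by
    have := i.2
    have := Nat.even_iff.1 hn
    split_ifs <;> omega⟩

lemma partner_val {n : ℕ} (hn : Even n) (i : Fin n) :
    (partner hn i : ℕ) = if (i : ℕ) % 2 = 0 then (i : ℕ) + 1 else i - 1 := rfl

lemma partner_partner {n : ℕ} (hn : Even n) (i : Fin n) : partner hn (partner hn i) = i := by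
  ext
  simp only [partner_val]
  grind

lemma partner_ne {n : ℕ} (hn : Even n) (i : Fin n) : partner hn i ≠ i := by
  intro h
  have := congrArg Fin.val h
  rw [partner_val] at this
  grind

lemma realizesMplus_iff {n : ℕ} (hn : Even n) (d : Fin n → ℕ) :
    RealizesMplus d ↔ ∃ G : SimpleGraph (Fin n), (∀ i, (nbrs G i).card = d i) ∧
      ∀ i, G.Adj i (partner hn i) := by
  simp only [RealizesMplus, card_nbrs_eq_ncard]
  refine exists_congr fun G => and_congr_right fun _ => ⟨fun h i => ?_, fun h i hi => ?_⟩
  · by_cases hi : (i : ℕ) % 2 = 0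
    · obtain ⟨h1, h2⟩ := h i hi
      convert h2
      rw [partner_val, if_pos hi]
    · obtain ⟨h1, h2⟩ := h (partner hn i) (by rw [partner_val]; grind)
      convert h2.symm
      simp only [partner_val]
      grind
  · have h1 : (partner hn i : ℕ) = i + 1 := by rw [partner_val, if_pos hi]
    have h2 := (partner hn i).2
    refine ⟨by omega, ?_⟩
    convert h i
    exact h1.symm

lemma sum_min_partner {n : ℕ} (hn : Even n) (d : Fin n → ℕ) (k : ℕ) :
    (Even k → ∑ i ∈ Finset.univ.filter (fun i : Fin n => k ≤ (i : ℕ)),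
      min (d i - if k ≤ (partner hn i : ℕ) then 1 else 0) k =
        ∑ i ∈ Finset.univ.filter (fun i : Fin n => k ≤ (i : ℕ)), min (d i - 1) k) ∧
    (Odd k → ∑ i ∈ Finset.univ.filter (fun i : Fin n => k ≤ (i : ℕ)),
      min (d i - if k ≤ (partner hn i : ℕ) then 1 else 0) k =
        ∑ i ∈ Finset.univ.filter (fun i : Fin n => (i : ℕ) = k), min (d i) k +
          ∑ i ∈ Finset.univ.filter (fun i : Fin n => k + 1 ≤ (i : ℕ)), min (d i - 1) k) := by
  constructor
  · intro hk
    refine Finset.sum_congr rfl fun i hi => ?_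
    simp only [Finset.mem_filter, Finset.mem_univ, true_and] at hi
    rw [if_pos (by rw [partner_val]; grind)]
  · intro hk
    have hsplit : Finset.univ.filter (fun i : Fin n => k ≤ (i : ℕ)) =
        Finset.univ.filter (fun i : Fin n => (i : ℕ) = k) ∪
          Finset.univ.filter (fun i : Fin n => k + 1 ≤ (i : ℕ)) := by
      ext i
      simp only [Finset.mem_filter, Finset.mem_univ, true_and, Finset.mem_union]
      omega
    rw [hsplit, Finset.sum_union]
    · congr 1
      · refine Finset.sum_congr rfl fun i hi => ?_
        simp only [Finset.mem_filter, Finset.mem_univ, true_and] at hi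
        rw [if_neg (by rw [partner_val]; grind), Nat.sub_zero]
      · refine Finset.sum_congr rfl fun i hi => ?_
        simp only [Finset.mem_filter, Finset.mem_univ, true_and] at hi
        rw [if_pos (by rw [partner_val]; grind)]
    · rw [Finset.disjoint_left]
      intro i
      simp only [Finset.mem_filter, Finset.mem_univ, true_and]
      omega

lemma sum_le_of_perfect_matching {n : ℕ} (G : SimpleGraph (Fin n)) {p : Fin n → Fin n}
    (hG : ∀ i, G.Adj i (p i)) {k : ℕ} (hk : k ≤ n) :
    ∑ i ∈ Finset.univ.filter (fun i : Fin n => (i : ℕ) < k), (nbrs G i).card ≤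
      k * (k - 1) + ∑ i ∈ Finset.univ.filter (fun i : Fin n => k ≤ (i : ℕ)),
        min ((nbrs G i).card - if k ≤ (p i : ℕ) then 1 else 0) k := by
  rw [sum_card_nbrs_lt]
  refine add_le_add ?_ (Finset.sum_le_sum fun i _ => le_min ?_ (lowDegree_le hk G i))
  · calc _ ≤ ∑ i ∈ Finset.univ.filter (fun i : Fin n => (i : ℕ) < k), (k - 1) :=
          Finset.sum_le_sum fun i hi => lowDegree_le_pred hk G (by simpa using hi)
      _ = k * (k - 1) := by
          rw [Finset.sum_const, card_filter_val_lt hk, smul_eq_mul]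
  · split_ifs with h
    · rw [← Finset.card_erase_of_mem (mem_nbrs.2 (hG i))]
      refine Finset.card_le_card fun w => ?_
      simp only [Finset.mem_filter, Finset.mem_erase]
      rintro ⟨h1, h2⟩
      refine ⟨?_, h1⟩
      rintro rfl
      omega
    · exact Finset.card_filter_le _ _

lemma exists_sup_involution {n : ℕ} (F : SimpleGraph (Fin n)) {p : Fin n → Fin n}
    (hp : ∀ v, p (p v) = v) (hp' : ∀ v, p v ≠ v) (hF : ∀ v, ¬ F.Adj v (p v)) :
    ∃ G : SimpleGraph (Fin n), (∀ v w, G.Adj v w ↔ F.Adj v w ∨ w = p v) ∧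
      ∀ v, (nbrs G v).card = (nbrs F v).card + 1 := by
  refine ⟨⟨fun v w => F.Adj v w ∨ w = p v, ⟨?_⟩, ⟨?_⟩⟩, fun v w => Iff.rfl, fun v => ?_⟩
  · rintro v w (h | rfl)
    · exact Or.inl h.symm
    · exact Or.inr (hp v).symm
  · rintro v (h | h)
    · exact F.loopless.irrefl v h
    · exact hp' v h.symm
  · rw [← Finset.card_insert_of_notMem (a := p v) (by simpa [mem_nbrs] using hF v)]
    congr 1
    ext w
    simp only [mem_nbrs, Finset.mem_insert]
    tauto

lemma IsSubrealization.card_eq_of_maximal {n : ℕ} {d e : Fin n → ℕ} (hd : Antitone d)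
    (hde : ∀ v, d v = e v + 1) {p : Fin n → Fin n} (hp : ∀ v, p (p v) = v)
    (hp' : ∀ v, p v ≠ v) (heven : Even (∑ v, e v)) {r : Fin n} (hpr : ∀ v, v < r → p v ≤ r)
    (hbound : ∑ i ∈ Finset.univ.filter (fun i : Fin n => (i : ℕ) < (r : ℕ) + 1), d i ≤
      ((r : ℕ) + 1) * r + ∑ i ∈ Finset.univ.filter (fun i : Fin n => (r : ℕ) + 1 ≤ (i : ℕ)),
        min (d i - if (r : ℕ) + 1 ≤ (p i : ℕ) then 1 else 0) ((r : ℕ) + 1))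
    {F : SimpleGraph (Fin n)} (hF : IsSubrealization e p r F)
    (hmax : ∀ G', IsSubrealization e p r G' → (nbrs G' r).card ≤ (nbrs F r).card) :
    (nbrs F r).card = e r := by
  refine (hF.le r).antisymm (not_lt.1 fun hr => ?_)
  have he : Antitone e := fun v w h => by
    have := hd h
    rw [hde, hde] at this
    omega
  obtain ⟨G, hG, hGcard⟩ := exists_sup_involution F hp hp' hF.avoid
  have hk : (r : ℕ) + 1 ≤ n := r.2
  have hlt : ∑ i ∈ Finset.univ.filter (fun i : Fin n => (i : ℕ) < (r : ℕ) + 1),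
      (nbrs G i).card <
      ∑ i ∈ Finset.univ.filter (fun i : Fin n => (i : ℕ) < (r : ℕ) + 1), d i := by
    refine Finset.sum_lt_sum (fun i _ => ?_) ⟨r, by simp, ?_⟩
    · rw [hGcard, hde]
      exact Nat.succ_le_succ (hF.le i)
    · rw [hGcard, hde]
      exact Nat.succ_lt_succ hr
  have hlow : ((r : ℕ) + 1) * r ≤
      ∑ i ∈ Finset.univ.filter (fun i : Fin n => (i : ℕ) < (r : ℕ) + 1),
        lowDegree G (r + 1) i := by
    calc ((r : ℕ) + 1) * r
        = ∑ i ∈ Finset.univ.filter (fun i : Fin n => (i : ℕ) < (r : ℕ) + 1), (r : ℕ) := by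
          rw [Finset.sum_const, card_filter_val_lt hk, smul_eq_mul]
      _ ≤ _ := Finset.sum_le_sum fun i hi => ?_
    have hi' : (i : ℕ) < (r : ℕ) + 1 := by simpa using hi
    have h1 := card_erase_filter_val_lt hk hi'
    rw [Nat.add_sub_cancel] at h1
    rw [lowDegree]
    refine h1.ge.trans ?_
    refine Finset.card_le_card fun w => ?_
    simp only [Finset.mem_filter, mem_nbrs, Finset.mem_erase, Finset.mem_univ, true_and]
    rintro ⟨hwi, hw⟩
    refine ⟨(hG i w).2 ?_, hw⟩
    by_cases hwp : w = p i
    · exact Or.inr hwp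
    left
    have hir : i ≤ r := Fin.le_def.2 (by omega)
    have hwr : w ≤ r := Fin.le_def.2 (by omega)
    rcases hir.eq_or_lt with rfl | hir
    · exact (hF.adj_below hp he heven hmax hr (lt_of_le_of_ne hwr hwi) hwp).symm
    rcases hwr.eq_or_lt with rfl | hwr
    · exact hF.adj_below hp he heven hmax hr hir fun h => hwp (by rw [h, hp])
    exact hF.clique_below hp hp' hpr he heven hmax hr hir hwr hwi.symm hwp
  have hhigh : ∑ i ∈ Finset.univ.filter (fun i : Fin n => (r : ℕ) + 1 ≤ (i : ℕ)),
        min (d i - if (r : ℕ) + 1 ≤ (p i : ℕ) then 1 else 0) ((r : ℕ) + 1) ≤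
      ∑ i ∈ Finset.univ.filter (fun i : Fin n => (r : ℕ) + 1 ≤ (i : ℕ)),
        lowDegree G (r + 1) i := by
    refine Finset.sum_le_sum fun j hj => ?_
    have hj : r < j := by
      simp only [Finset.mem_filter, Finset.mem_univ, true_and] at hj
      exact Fin.lt_def.2 (by omega)
    have hlow' : ∀ w, F.Adj j w → (w : ℕ) < (r : ℕ) + 1 := by
      intro w hw
      by_contra h
      exact hF.indep j w hj (Fin.lt_def.2 (by omega)) hw
    rcases (hF.le j).eq_or_lt with hdj | hdj
    · refine (min_le_left _ _).trans ?_
      split_ifs with hpj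
      · rw [hde, Nat.add_sub_cancel, ← hdj]
        refine Finset.card_le_card fun w hw => ?_
        rw [mem_nbrs] at hw
        simp only [Finset.mem_filter, mem_nbrs]
        exact ⟨(hG j w).2 (Or.inl hw), hlow' w hw⟩
      · rw [hde, Nat.sub_zero, ← hdj, ← hGcard]
        refine Finset.card_le_card fun w hw => ?_
        rw [mem_nbrs] at hw
        simp only [Finset.mem_filter, mem_nbrs]
        refine ⟨hw, ?_⟩
        rcases (hG j w).1 hw with h | rfl
        · exact hlow' w h
        · omega
    · refine (min_le_right _ _).trans ?_
      rw [lowDegree]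
      conv_lhs => rw [← card_filter_val_lt hk]
      refine Finset.card_le_card fun w => ?_
      simp only [Finset.mem_filter, mem_nbrs, Finset.mem_univ, true_and]
      refine fun hw => ⟨(hG j w).2 ?_, hw⟩
      by_cases hwp : w = p j
      · exact Or.inr hwp
      · exact Or.inl (hF.adj_above hp he heven hmax hr hj hdj (Fin.le_def.2 (by omega)) hwp)
  have := sum_card_nbrs_lt G ((r : ℕ) + 1)
  omega

lemma exists_realization_avoiding {n : ℕ} {d e : Fin n → ℕ} (hd : Antitone d)
    (hde : ∀ v, d v = e v + 1) {p : Fin n → Fin n} (hp : ∀ v, p (p v) = v)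
    (hp' : ∀ v, p v ≠ v) (hpr : ∀ v r, v < r → p v ≤ r) (heven : Even (∑ v, e v))
    (hbound : ∀ r : Fin n,
      ∑ i ∈ Finset.univ.filter (fun i : Fin n => (i : ℕ) < (r : ℕ) + 1), d i ≤
      ((r : ℕ) + 1) * r + ∑ i ∈ Finset.univ.filter (fun i : Fin n => (r : ℕ) + 1 ≤ (i : ℕ)),
        min (d i - if (r : ℕ) + 1 ≤ (p i : ℕ) then 1 else 0) ((r : ℕ) + 1)) :
    ∃ F : SimpleGraph (Fin n), (∀ v, ¬ F.Adj v (p v)) ∧ ∀ v, (nbrs F v).card = e v := by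
  have key : ∀ m ≤ n, ∃ F : SimpleGraph (Fin n), (∀ v, ¬ F.Adj v (p v)) ∧
      (∀ v, (nbrs F v).card ≤ e v) ∧ (∀ v : Fin n, (v : ℕ) < m → (nbrs F v).card = e v) ∧
      ∀ v w : Fin n, m ≤ v → m ≤ w → ¬ F.Adj v w := by
    intro m
    induction m with
    | zero =>
      intro _
      exact ⟨⊥, by simp, by simp [nbrs], by simp, by simp⟩
    | succ m ih =>
      intro hm
      obtain ⟨F₀, h1, h2, h3, h4⟩ := ih (by omega)
      let r : Fin n := ⟨m, hm⟩
      have hF₀ : IsSubrealization e p r F₀ :=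
        ⟨h1, h2, fun v hv => h3 v hv, fun v w hv hw => h4 v w (le_of_lt hv) (le_of_lt hw)⟩
      obtain ⟨F, hF, hmax⟩ := Set.exists_max_image {F | IsSubrealization e p r F}
        (fun F => (nbrs F r).card) (Set.toFinite _) ⟨F₀, hF₀⟩
      have hr := hF.card_eq_of_maximal hd hde hp hp' heven (fun v => hpr v r) (hbound r) hmax
      refine ⟨F, hF.avoid, hF.le, fun v hv => ?_, fun v w hv hw => hF.indep v w hv hw⟩
      rcases (Nat.lt_succ_iff.1 hv).eq_or_lt with h | h
      · have : v = r := Fin.ext h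
        rw [this, hr]
      · exact hF.sat v h
  obtain ⟨F, h1, -, h3, -⟩ := key n le_rfl
  exact ⟨F, h1, fun v => h3 v v.2⟩

lemma RealizesMplus.even_card {n : ℕ} {d : Fin n → ℕ} (h : RealizesMplus d) : Even n := by
  obtain ⟨G, -, hG⟩ := h
  by_contra hn
  rw [Nat.not_even_iff_odd] at hn
  obtain ⟨m, rfl⟩ := hn
  obtain ⟨h1, -⟩ := hG ⟨2 * m, by omega⟩ (by simp)
  simp at h1

theorem stmt_2 {n : ℕ} (d : Fin n → ℕ) (hd : Antitone d) (hd1 : ∀ i, 1 ≤ d i) :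
    RealizesMplus d ↔
      (Even (∑ i, d i) ∧ Even n ∧
        ∀ k : ℕ, 1 ≤ k → k ≤ n →
          (Even k →
            (∑ i ∈ Finset.univ.filter (fun i : Fin n => (i : ℕ) < k), d i) ≤
              k * (k - 1) +
                ∑ i ∈ Finset.univ.filter (fun i : Fin n => k ≤ (i : ℕ)),
                  min (d i - 1) k) ∧
          (Odd k →
            (∑ i ∈ Finset.univ.filter (fun i : Fin n => (i : ℕ) < k), d i) ≤
              k * (k - 1) +
                (∑ i ∈ Finset.univ.filter (fun i : Fin n => (i : ℕ) = k),
                  min (d i) k) +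
                ∑ i ∈ Finset.univ.filter (fun i : Fin n => k + 1 ≤ (i : ℕ)),
                  min (d i - 1) k)) := by
  constructor
  · intro h
    have hn := h.even_card
    obtain ⟨G, hG, hM⟩ := (realizesMplus_iff hn d).1 h
    refine ⟨?_, hn, fun k _ hkn => ?_⟩
    · simpa only [hG] using even_sum_card_nbrs G
    · have hle := sum_le_of_perfect_matching G hM hkn
      simp only [hG] at hle
      obtain ⟨h1, h2⟩ := sum_min_partner hn d k
      refine ⟨fun hk => by rwa [h1 hk] at hle, fun hk => ?_⟩
      rwa [h2 hk, ← add_assoc] at hle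
  · rintro ⟨heven, hn, hk⟩
    rw [realizesMplus_iff hn]
    have hde : ∀ v, d v = (d v - 1) + 1 := fun v => by
      have := hd1 v
      omega
    obtain ⟨F, hF, hFd⟩ := exists_realization_avoiding (e := fun v => d v - 1) hd hde
      (partner_partner hn) (partner_ne hn)
      (fun v r hvr => by
        rw [Fin.lt_def] at hvr
        rw [Fin.le_def, partner_val]
        split_ifs <;> omega)
      (by
        have h1 : ∑ v, d v = ∑ v, (d v - 1) + n := by
          rw [Finset.sum_congr rfl fun v _ => hde v, Finset.sum_add_distrib]
          simp
        rw [h1] at heven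
        exact (Nat.even_add.1 heven).2 hn)
      (fun r => by
        obtain ⟨h1, h2⟩ := sum_min_partner hn d (r + 1)
        obtain ⟨h3, h4⟩ := hk (r + 1) (by omega) r.2
        rw [Nat.add_sub_cancel] at h3 h4
        rcases Nat.even_or_odd ((r : ℕ) + 1) with h | h
        · rw [h1 h]
          exact h3 h
        · rw [h2 h, ← add_assoc]
          exact h4 h)
    obtain ⟨G, hG, hGcard⟩ := exists_sup_involution F (partner_partner hn) (partner_ne hn) hF
    exact ⟨G, fun v => by rw [hGcard, hFd]; exact (hde v).symm,
      fun v => (hG v _).2 (Or.inr rfl)⟩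
end

section
/- Let (d_1, d_2, …, d_n) be a graphic sequence with n an even integer and d_n ≥ n/2. If Σ_{i=1}^{n/2} d_i ≤ (√(2 − 4/n) − 0.5)·n²/2, then the sequence (d_1, d_2, …, d_n) can realize M⁺ = {(1,2), (3,4), …, (n−1,n)}. -/
section Orbits

open Function

variable {α : Type*}

theorem Equiv.Perm.sameCycle_iff_exists_iterate [Finite α] (σ : Equiv.Perm α) (a b : α) :
    σ.SameCycle a b ↔ ∃ k < minimalPeriod σ a, σ^[k] a = b := by
  constructor
  · intro h
    obtain ⟨i, -, hi⟩ := h.exists_pow_eq'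
    have hpos : 0 < minimalPeriod σ a :=
      minimalPeriod_pos_of_mem_periodicPts (σ.injective.mem_periodicPts a)
    refine ⟨i % minimalPeriod σ a, Nat.mod_lt _ hpos, ?_⟩
    rw [iterate_mod_minimalPeriod_eq, Equiv.Perm.iterate_eq_pow, hi]
  · rintro ⟨k, -, rfl⟩
    rw [Equiv.Perm.iterate_eq_pow]
    exact ⟨k, by simp⟩

open Classical in
theorem Equiv.Perm.card_sameCycle [Fintype α] (σ : Equiv.Perm α) (a : α) :
    (Finset.univ.filter (σ.SameCycle a)).card = minimalPeriod σ a := by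
  have : Finset.univ.filter (σ.SameCycle a)
      = (Finset.range (minimalPeriod σ a)).image (fun k => σ^[k] a) := by
    ext b
    simp [σ.sameCycle_iff_exists_iterate a b]
  rw [this, Finset.card_image_of_injOn, Finset.card_range]
  have := iterate_injOn_Iio_minimalPeriod (f := σ) (x := a)
  intro i hi j hj h
  exact this (by simpa using hi) (by simpa using hj) h

/-- On a set of even size, orbits of odd length come in pairs. -/
theorem Equiv.Perm.exists_odd_orbit [Fintype α] (σ : Equiv.Perm α)
    (hα : Even (Fintype.card α)) (a : α) (ha : Odd (minimalPeriod σ a)) :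
    ∃ b, ¬ σ.SameCycle a b ∧ Odd (minimalPeriod σ b) := by
  classical
  by_contra! hcon
  let s : Setoid α := Equiv.Perm.SameCycle.setoid σ
  have hcard : ∀ b : α, (Finset.univ.filter fun x => (Quotient.mk s x) = Quotient.mk s b).card
      = minimalPeriod σ b := by
    intro b
    rw [← σ.card_sameCycle b]
    congr 1
    ext x
    simp only [Finset.mem_filter, Finset.mem_univ, true_and, Quotient.eq]
    exact Equiv.Perm.sameCycle_comm
  have htot := Finset.card_eq_sum_card_fiberwise (f := Quotient.mk s) (s := Finset.univ)
    (t := Finset.univ) (fun _ _ => by simp)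
  rw [← Finset.add_sum_erase _ _ (Finset.mem_univ (Quotient.mk s a)), hcard,
    Finset.card_univ] at htot
  have hev : Even (∑ q ∈ Finset.univ.erase (Quotient.mk s a),
      (Finset.univ.filter fun x => (Quotient.mk s x) = q).card) := by
    refine Finset.even_sum _ fun q hq => ?_
    induction q using Quotient.inductionOn with
    | h b =>
      rw [hcard, ← Nat.not_odd_iff_even]
      exact hcon b fun hab => Finset.ne_of_mem_erase hq (Quotient.sound hab.symm)
  rw [htot] at hα
  exact Nat.not_even_iff_odd.2 (ha.add_even hev) hα

/-- Alternately colour the orbit of `a`, starting with `P` at `a`. The colouring is consistent except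
for a defect at `a` when the orbit is odd. -/
theorem Equiv.Perm.exists_alternating [Finite α] [DecidableEq α] (σ : Equiv.Perm α) (a : α) :
    ∃ P N : α → ℤ,
      (∀ b, σ.SameCycle a b → P b = 1 ∧ N b = 0 ∨ P b = 0 ∧ N b = 1) ∧
      (∀ b, ¬ σ.SameCycle a b → P b = 0 ∧ N b = 0) ∧
      (∀ b, P (σ⁻¹ b) - N b = if b = a ∧ Odd (minimalPeriod σ a) then 1 else 0) ∧
      (∀ b, P b - N (σ⁻¹ b) = if b = a ∧ Odd (minimalPeriod σ a) then 1 else 0) := by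
  classical
  set l := minimalPeriod σ a with hl
  have hpos : 0 < l := minimalPeriod_pos_of_mem_periodicPts (σ.injective.mem_periodicPts a)
  have hinj : ∀ i < l, ∀ j < l, σ^[i] a = σ^[j] a → i = j := fun i hi j hj h =>
    iterate_injOn_Iio_minimalPeriod (f := σ) (x := a) hi hj h
  have hper : σ^[l] a = a := iterate_minimalPeriod
  have hval : ∀ k < l, ∀ r : ℕ,
      (∃ i < l, i % 2 = r ∧ σ^[i] a = σ^[k] a) ↔ k % 2 = r := by
    intro k hk r
    constructor
    · rintro ⟨i, hi, hr, h⟩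
      rwa [← hinj i hi k hk h]
    · exact fun h => ⟨k, hk, h, rfl⟩
  refine ⟨fun b => if ∃ i < l, i % 2 = 0 ∧ σ^[i] a = b then 1 else 0,
    fun b => if ∃ i < l, i % 2 = 1 ∧ σ^[i] a = b then 1 else 0, ?_, ?_, ?_, ?_⟩
  · intro b hb
    obtain ⟨k, hk, rfl⟩ := (σ.sameCycle_iff_exists_iterate a b).1 hb
    simp only [hval k hk]
    rcases Nat.mod_two_eq_zero_or_one k with h | h <;> simp [h]
  · intro b hb
    rw [σ.sameCycle_iff_exists_iterate a b] at hb
    push Not at hb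
    constructor <;> exact if_neg fun ⟨i, hi, _, h⟩ => hb i hi h
  all_goals
    intro b
    dsimp only
    by_cases hb : σ.SameCycle a b
    · obtain ⟨k, hk, rfl⟩ := (σ.sameCycle_iff_exists_iterate a b).1 hb
      rcases k with _ | k
      · have hlast : σ⁻¹ (σ^[0] a) = σ^[l - 1] a := by
          rw [Equiv.Perm.inv_eq_iff_eq, ← Function.iterate_succ_apply' σ, Nat.succ_eq_add_one,
            Nat.sub_add_cancel hpos, hper, iterate_zero, id]
        simp only [hlast, hval 0 hk, hval (l - 1) (by omega)]
        simp only [Nat.odd_iff, iterate_zero, id, true_and]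
        rcases Nat.mod_two_eq_zero_or_one l with h | h
        · have h' : (l - 1) % 2 = 1 := by omega
          simp [h, h']
        · have h' : (l - 1) % 2 = 0 := by omega
          simp [h, h']
      · have hpred : σ⁻¹ (σ^[k + 1] a) = σ^[k] a := by
          rw [Equiv.Perm.inv_eq_iff_eq, Function.iterate_succ_apply']
        have hne : σ^[k + 1] a ≠ a := fun h => by
          have := hinj (k + 1) hk 0 hpos h
          omega
        simp only [hpred, hval k (by omega), hval (k + 1) hk, hne, false_and, if_false]
        split_ifs <;> omega
    · have hb' : ¬ σ.SameCycle a (σ⁻¹ b) := by simpa using hb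
      have hne : b ≠ a := by
        rintro rfl
        exact hb (Equiv.Perm.SameCycle.refl _ _)
      rw [σ.sameCycle_iff_exists_iterate] at hb hb'
      push Not at hb hb'
      rw [if_neg, if_neg, if_neg]
      · simp
      · tauto
      · rintro ⟨i, hi, -, h⟩
        first | exact hb i hi h | exact hb' i hi h
      · rintro ⟨i, hi, -, h⟩
        first | exact hb i hi h | exact hb' i hi h

end Orbits

section Symmetrization

variable {V : Type*} [Fintype V] [DecidableEq V]

/-- A `0/1` matrix supported on `H` whose row and column sums are both given by `f`. -/
structure IsFactorMatrix (H : V → V → Prop) (f : V → ℤ) (A : V → V → ℤ) : Prop where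
  zero_or_one : ∀ i j, A i j = 0 ∨ A i j = 1
  supp : ∀ i j, A i j = 1 → H i j
  row : ∀ i, ∑ j, A i j = f i
  col : ∀ j, ∑ i, A i j = f j

/-- The positions where `A` has an entry `1` with mirror entry `0`. -/
abbrev AsymArc (A : V → V → ℤ) : Type _ := {a : V × V // A a.1 a.2 = 1 ∧ A a.2 a.1 = 0}

namespace IsFactorMatrix

variable {H : V → V → Prop} {f : V → ℤ} {A : V → V → ℤ}

/-- Changing `A` by removing the arcs in `N`, adding the reversals of the arcs in `P`, and adding a
symmetric matrix `E`; all of it keeping the row and column sums. -/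
theorem exists_card_asymArc_lt (hA : IsFactorMatrix H f A) (hH : ∀ i j, H i j → H j i)
    (σ : Equiv.Perm (AsymArc A)) (hσ : ∀ a, (σ a).1.1 = a.1.2)
    (P N : AsymArc A → ℤ)
    (hPN : ∀ a, P a = 0 ∧ N a = 0 ∨ P a = 1 ∧ N a = 0 ∨ P a = 0 ∧ N a = 1)
    (E : V → V → ℤ) (hE : ∀ i j, E i j = E j i)
    (hEA : ∀ i j, E i j ≠ 0 → H i j ∧ A i j = A j i ∧ (A i j + E i j = 0 ∨ A i j + E i j = 1))
    (hrow : ∀ p, (∑ a, if a.1.1 = p then P (σ⁻¹ a) - N a else 0) + ∑ j, E p j = 0)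
    (hcol : ∀ p, (∑ a, if a.1.1 = p then P a - N (σ⁻¹ a) else 0) + ∑ j, E p j = 0)
    (a₀ : AsymArc A) (ha₀ : P a₀ + N a₀ = 1) :
    ∃ B, IsFactorMatrix H f B ∧ Fintype.card (AsymArc B) < Fintype.card (AsymArc A) := by
  set ext : (AsymArc A → ℤ) → V → V → ℤ := fun Q i j => ∑ a : AsymArc A, if a.1 = (i, j) then Q a else 0
    with hext
  have ext_arc : ∀ Q (i j : V) (h : A i j = 1 ∧ A j i = 0), ext Q i j = Q ⟨(i, j), h⟩ := by
    intro Q i j h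
    rw [hext]
    dsimp only
    rw [Finset.sum_eq_single ⟨(i, j), h⟩]
    · simp
    · intro b _ hb
      rw [if_neg fun h' => hb (Subtype.ext h')]
    · simp
  have ext_nonarc : ∀ Q (i j : V), ¬ (A i j = 1 ∧ A j i = 0) → ext Q i j = 0 := by
    intro Q i j h
    refine Finset.sum_eq_zero fun a _ => if_neg fun h' => h ?_
    have := a.2
    rwa [h'] at this
  have ext_row : ∀ Q p, ∑ j, ext Q p j = ∑ a : AsymArc A, if a.1.1 = p then Q a else 0 := by
    intro Q p
    rw [hext]
    dsimp only
    rw [Finset.sum_comm]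
    refine Finset.sum_congr rfl fun a _ => ?_
    by_cases h : a.1.1 = p <;> simp [Prod.ext_iff, h]
  have ext_col : ∀ Q p, ∑ i, ext Q i p = ∑ a : AsymArc A, if a.1.1 = p then Q (σ⁻¹ a) else 0 := by
    intro Q p
    rw [← Equiv.sum_comp σ, hext]
    dsimp only
    rw [Finset.sum_comm]
    refine Finset.sum_congr rfl fun a _ => ?_
    rw [hσ, Equiv.Perm.inv_def, Equiv.symm_apply_apply]
    by_cases h : a.1.2 = p <;> simp [Prod.ext_iff, h]
  set B : V → V → ℤ := fun i j => A i j + ext P j i - ext N i j + E i j with hB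
  have E_arc : ∀ i j, A i j = 1 → A j i = 0 → E i j = 0 ∧ E j i = 0 := by
    intro i j h h'
    have : E i j = 0 := by
      by_contra h0
      have := (hEA i j h0).2.1
      omega
    exact ⟨this, hE i j ▸ this⟩
  have B_arc : ∀ i j (h : A i j = 1 ∧ A j i = 0),
      B i j = 1 - N ⟨(i, j), h⟩ ∧ B j i = P ⟨(i, j), h⟩ := by
    intro i j h
    have h' : ¬ (A j i = 1 ∧ A i j = 0) := by omega
    obtain ⟨e1, e2⟩ := E_arc i j h.1 h.2
    simp only [hB, ext_arc _ _ _ h, ext_nonarc _ _ _ h', e1, e2, h.1, h.2]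
    constructor <;> ring
  have B_sym : ∀ i j, A i j = A j i → B i j = A i j + E i j := by
    intro i j h
    simp only [hB]
    rw [ext_nonarc _ _ _ (by omega), ext_nonarc _ _ _ (by omega)]
    ring
  have cases3 : ∀ i j, A i j = A j i ∨ (A i j = 1 ∧ A j i = 0) ∨ (A j i = 1 ∧ A i j = 0) := by
    intro i j
    have := hA.zero_or_one i j
    have := hA.zero_or_one j i
    omega
  have arc_of : ∀ i j, B i j = 1 → B j i = 0 → ∃ h : A i j = 1 ∧ A j i = 0,
      P ⟨(i, j), h⟩ = 0 ∧ N ⟨(i, j), h⟩ = 0 := by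
    intro i j h1 h2
    rcases cases3 i j with h | h | h
    · rw [B_sym i j h] at h1
      rw [B_sym j i h.symm, hE j i] at h2
      omega
    · refine ⟨h, ?_⟩
      obtain ⟨e1, e2⟩ := B_arc i j h
      omega
    · obtain ⟨e1, e2⟩ := B_arc j i h
      have := hPN ⟨(j, i), h⟩
      omega
  have ite_sub : ∀ p (Q R : AsymArc A → ℤ), (∑ a : AsymArc A, if a.1.1 = p then Q a - R a else 0)
      = (∑ a : AsymArc A, if a.1.1 = p then Q a else 0)
        - ∑ a : AsymArc A, if a.1.1 = p then R a else 0 := by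
    intro p Q R
    rw [← Finset.sum_sub_distrib]
    refine Finset.sum_congr rfl fun a _ => ?_
    split_ifs <;> simp
  refine ⟨B, ⟨?_, ?_, ?_, ?_⟩, ?_⟩
  · intro i j
    rcases cases3 i j with h | h | h
    · rw [B_sym i j h]
      by_cases h0 : E i j = 0
      · simpa [h0] using hA.zero_or_one i j
      · exact (hEA i j h0).2.2
    · have := (B_arc i j h).1
      have := hPN ⟨(i, j), h⟩
      omega
    · have := (B_arc j i h).2
      have := hPN ⟨(j, i), h⟩
      omega
  · intro i j hij
    rcases cases3 i j with h | h | h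
    · rw [B_sym i j h] at hij
      by_cases h0 : E i j = 0
      · exact hA.supp i j (by omega)
      · exact (hEA i j h0).1
    · exact hA.supp i j h.1
    · exact hH _ _ (hA.supp j i h.1)
  · intro p
    simp only [hB, Finset.sum_add_distrib, Finset.sum_sub_distrib]
    rw [hA.row, ext_col, ext_row]
    linarith [ite_sub p (fun a => P (σ⁻¹ a)) N, hrow p]
  · intro p
    simp only [hB, Finset.sum_add_distrib, Finset.sum_sub_distrib]
    rw [hA.col, ext_col, ext_row, Finset.sum_congr rfl fun j _ => hE j p]
    linarith [ite_sub p P (fun a => N (σ⁻¹ a)), hcol p]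
  · have hinj : Function.Injective (fun b : AsymArc B =>
        (⟨b.1, (arc_of b.1.1 b.1.2 b.2.1 b.2.2).1⟩ : AsymArc A)) := by
      intro b b' h
      simpa [Subtype.ext_iff] using h
    refine Fintype.card_lt_of_injective_of_notMem _ hinj (b := a₀) ?_
    rintro ⟨b, rfl⟩
    dsimp only at ha₀
    obtain ⟨h, h1, h2⟩ := arc_of b.1.1 b.1.2 b.2.1 b.2.2
    rw [show (⟨b.1, (arc_of b.1.1 b.1.2 b.2.1 b.2.2).1⟩ : AsymArc A) = ⟨(b.1.1, b.1.2), h⟩ from rfl,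
      h1, h2] at ha₀
    omega

omit [DecidableEq V] in
/-- The arcs of `A` decompose into closed trails: some permutation sends each arc to one leaving its
head. -/
theorem exists_successor (hA : IsFactorMatrix H f A) :
    ∃ σ : Equiv.Perm (AsymArc A), ∀ a, (σ a).1.1 = a.1.2 := by
  have hcard : ∀ p, Nonempty ({a : AsymArc A // a.1.2 = p} ≃ {a : AsymArc A // a.1.1 = p}) := by
    intro p
    let e₁ : {a : AsymArc A // a.1.2 = p} ≃ {j // A j p = 1 ∧ A p j = 0} :=
      { toFun := fun a => ⟨a.1.1.1, by simpa only [a.2] using a.1.2⟩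
        invFun := fun j => ⟨⟨(j.1, p), j.2⟩, rfl⟩
        left_inv := by
          rintro ⟨⟨⟨i, j⟩, h⟩, rfl⟩
          rfl
        right_inv := fun j => rfl }
    let e₂ : {a : AsymArc A // a.1.1 = p} ≃ {j // A p j = 1 ∧ A j p = 0} :=
      { toFun := fun a => ⟨a.1.1.2, by simpa only [a.2] using a.1.2⟩
        invFun := fun j => ⟨⟨(p, j.1), j.2⟩, rfl⟩
        left_inv := by
          rintro ⟨⟨⟨i, j⟩, h⟩, rfl⟩
          rfl
        right_inv := fun j => rfl }
    have h : (Fintype.card {j // A j p = 1 ∧ A p j = 0} : ℤ)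
        = Fintype.card {j // A p j = 1 ∧ A j p = 0} := by
      rw [Fintype.card_subtype, Fintype.card_subtype, Finset.card_filter, Finset.card_filter]
      push_cast
      rw [← sub_eq_zero, ← Finset.sum_sub_distrib]
      refine Eq.trans ?_ (sub_eq_zero.2 ((hA.col p).trans (hA.row p).symm))
      rw [← Finset.sum_sub_distrib]
      refine Finset.sum_congr rfl fun j _ => ?_
      rcases hA.zero_or_one j p with h | h <;> rcases hA.zero_or_one p j with h' | h' <;>
        simp [h, h']
    exact ⟨e₁.trans ((Fintype.equivOfCardEq (by exact_mod_cast h)).trans e₂.symm)⟩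
  let e := fun p => (hcard p).some
  exact ⟨Equiv.ofFiberEquiv (f := fun a : AsymArc A => a.1.2) (g := fun a => a.1.1) e,
    fun a => Equiv.ofFiberEquiv_map e a⟩

omit [DecidableEq V] in
theorem even_card_asymArc (hA : IsFactorMatrix H f A) (hloop : ∀ i, ¬ H i i)
    (hf : Even (∑ i, f i)) : Even (Fintype.card (AsymArc A)) := by
  have h1 : (Fintype.card (AsymArc A) : ℤ)
      = ∑ i, f i - ∑ x : V × V, A x.1 x.2 * A x.2 x.1 := by
    rw [Finset.sum_congr rfl fun i _ => (hA.row i).symm, ← Fintype.sum_prod_type',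
      ← Finset.sum_sub_distrib, Fintype.card_subtype, Finset.card_filter]
    push_cast
    refine Finset.sum_congr rfl fun x _ => ?_
    rcases hA.zero_or_one x.1 x.2 with h | h <;> rcases hA.zero_or_one x.2 x.1 with h' | h' <;>
      simp [h, h']
  have h2 : Even (∑ x : V × V, A x.1 x.2 * A x.2 x.1) := by
    rw [← ZMod.intCast_eq_zero_iff_even]
    push_cast
    refine Finset.sum_involution (fun x _ => x.swap) ?_ ?_ (by simp) (by simp)
    · intro x _
      rw [Prod.fst_swap, Prod.snd_swap, mul_comm ((A x.2 x.1 : ℤ) : ZMod 2)]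
      exact CharTwo.add_self_eq_zero _
    · rintro ⟨i, j⟩ _ hne heq
      obtain rfl : j = i := congrArg Prod.fst heq
      have h0 : A j j = 0 := (hA.zero_or_one j j).resolve_right fun h => hloop j (hA.supp j j h)
      simp [h0] at hne
  have h3 : Even (Fintype.card (AsymArc A) : ℤ) := h1 ▸ hf.sub h2
  exact_mod_cast h3

/-- A non-symmetric `A` can be made more symmetric. -/
theorem exists_card_asymArc_lt_of_asymArc (hA : IsFactorMatrix H f A) (hH : ∀ i j, H i j → H j i)
    (hloop : ∀ i, ¬ H i i)
    (hdense : ∀ p q r, q ≠ r → q ≠ p → r ≠ p → H p q ∨ H p r)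
    (hf : Even (∑ i, f i)) (a₀ : AsymArc A) :
    ∃ B, IsFactorMatrix H f B ∧ Fintype.card (AsymArc B) < Fintype.card (AsymArc A) := by
  obtain ⟨σ, hσ⟩ := hA.exists_successor
  by_contra hmin
  have hodd : ∀ a, Odd (Function.minimalPeriod σ a) := by
    intro a
    by_contra hev
    obtain ⟨P, N, h1, h2, h3, h4⟩ := σ.exists_alternating a
    simp only [hev, and_false, if_false] at h3 h4
    refine hmin (hA.exists_card_asymArc_lt hH σ hσ P N ?_ (fun _ _ => 0) (fun _ _ => rfl)
      (by simp) ?_ ?_ a ?_)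
    · intro b
      by_cases hb : σ.SameCycle a b
      · have := h1 b hb
        tauto
      · have := h2 b hb
        tauto
    · intro p
      simp only [h3, ite_self, Finset.sum_const_zero, add_zero]
    · intro p
      simp only [h4, ite_self, Finset.sum_const_zero, add_zero]
    · have := h1 a (Equiv.Perm.SameCycle.refl _ _)
      omega
  have halt : ∀ a (s : ℤ), s = 1 ∨ s = -1 → ∃ P N : AsymArc A → ℤ,
      (∀ b, σ.SameCycle a b → P b = 1 ∧ N b = 0 ∨ P b = 0 ∧ N b = 1) ∧
      (∀ b, ¬ σ.SameCycle a b → P b = 0 ∧ N b = 0) ∧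
      (∀ b, P (σ⁻¹ b) - N b = if b = a then s else 0) ∧
      (∀ b, P b - N (σ⁻¹ b) = if b = a then s else 0) := by
    intro a s hs
    obtain ⟨P, N, h1, h2, h3, h4⟩ := σ.exists_alternating a
    simp only [hodd, and_true] at h3 h4
    rcases hs with rfl | rfl
    · exact ⟨P, N, h1, h2, h3, h4⟩
    · refine ⟨N, P, fun b hb => ?_, fun b hb => (h2 b hb).symm, fun b => ?_, fun b => ?_⟩
      · have := h1 b hb
        tauto
      · rw [← neg_sub, h4 b]
        split_ifs <;> simp
      · rw [← neg_sub, h3 b]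
        split_ifs <;> simp
  have hsum : ∀ (a b : AsymArc A) (s t : ℤ) p,
      (∑ c : AsymArc A, if c.1.1 = p then ((if c = a then s else 0) + if c = b then t else 0) else 0)
        = (if a.1.1 = p then s else 0) + if b.1.1 = p then t else 0 := by
    have hone : ∀ (a : AsymArc A) (s : ℤ) p,
        (∑ c : AsymArc A, if c = a then (if c.1.1 = p then s else 0) else 0)
          = if a.1.1 = p then s else 0 := by
      intro a s p
      rw [Finset.sum_ite_eq' Finset.univ a, if_pos (Finset.mem_univ a)]
    intro a b s t p
    rw [← hone a s p, ← hone b t p, ← Finset.sum_add_distrib]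
    refine Finset.sum_congr rfl fun c _ => ?_
    split_ifs <;> simp
  have hpair : ∀ a b, ¬ σ.SameCycle a b → ∀ s t : ℤ, (s = 1 ∨ s = -1) → (t = 1 ∨ t = -1) →
      ∀ E : V → V → ℤ, (∀ i j, E i j = E j i) →
      (∀ i j, E i j ≠ 0 → H i j ∧ A i j = A j i ∧ (A i j + E i j = 0 ∨ A i j + E i j = 1)) →
      (∀ p, ((if a.1.1 = p then s else 0) + if b.1.1 = p then t else 0) + ∑ j, E p j = 0) →
      False := by
    intro a b hcyc s t hs ht E hE hEA hbal
    obtain ⟨P, N, h1, h2, h3, h4⟩ := halt a s hs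
    obtain ⟨P', N', h1', h2', h3', h4'⟩ := halt b t ht
    have hdisj : ∀ c, σ.SameCycle a c → ¬ σ.SameCycle b c := fun c h h' => hcyc (h.trans h'.symm)
    refine hmin (hA.exists_card_asymArc_lt hH σ hσ (fun c => P c + P' c) (fun c => N c + N' c) ?_
      E hE hEA ?_ ?_ a ?_)
    · intro c
      by_cases hc : σ.SameCycle a c
      · have := h1 c hc
        have := h2' c (hdisj c hc)
        omega
      · have := h2 c hc
        by_cases hc' : σ.SameCycle b c
        · have := h1' c hc'
          omega
        · have := h2' c hc'
          omega
    · intro p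
      simp only [add_sub_add_comm, h3, h3', hsum, hbal]
    · intro p
      simp only [add_sub_add_comm, h4, h4', hsum, hbal]
    · have := h1 a (Equiv.Perm.SameCycle.refl _ _)
      have := h2' a (hdisj a (Equiv.Perm.SameCycle.refl _ _))
      omega
  have htail : ∀ a b : AsymArc A, a.1.1 = b.1.1 → σ.SameCycle a b := by
    intro a b hab
    by_contra hcyc
    refine hpair a b hcyc 1 (-1) (Or.inl rfl) (Or.inr rfl) (fun _ _ => 0) (fun _ _ => rfl)
      (by simp) fun p => ?_
    rw [hab]
    split_ifs <;> simp
  have hloop' : ∀ a : AsymArc A, a.1.1 ≠ a.1.2 := fun a h => by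
    have := a.2
    rw [h] at this
    omega
  have hcross : ∀ a b : AsymArc A, ¬ σ.SameCycle a b → ¬ (A a.1.1 b.1.1 = 1 ∧ A b.1.1 a.1.1 = 0) := by
    intro a b hab h
    have h1 : σ.SameCycle a ⟨(a.1.1, b.1.1), h⟩ := htail _ _ rfl
    have h2 : σ.SameCycle (σ ⟨(a.1.1, b.1.1), h⟩) b := htail _ _ (hσ _)
    exact hab (h1.trans (Equiv.Perm.sameCycle_apply_left.1 h2))
  have hjoin : ∀ a b : AsymArc A, ¬ σ.SameCycle a b → ¬ H a.1.1 b.1.1 := by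
    intro a b hab hHab
    have hne : a.1.1 ≠ b.1.1 := fun h => hab (htail _ _ h)
    have hsymm : A a.1.1 b.1.1 = A b.1.1 a.1.1 := by
      have := hcross a b hab
      have := hcross b a fun h => hab h.symm
      have := hA.zero_or_one a.1.1 b.1.1
      have := hA.zero_or_one b.1.1 a.1.1
      omega
    obtain ⟨s, hs, hAs⟩ : ∃ s : ℤ, (s = 1 ∨ s = -1) ∧
        (A a.1.1 b.1.1 - s = 0 ∨ A a.1.1 b.1.1 - s = 1) := by
      rcases hA.zero_or_one a.1.1 b.1.1 with h | h
      · exact ⟨-1, by simp [h]⟩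
      · exact ⟨1, by simp [h]⟩
    refine hpair a b hab s s hs hs
      (fun i j => -((if a.1.1 = i then (if j = b.1.1 then s else 0) else 0)
        + if b.1.1 = i then (if j = a.1.1 then s else 0) else 0)) ?_ ?_ ?_
    · have hswap : ∀ x y i j : V, (if x = i then (if j = y then s else 0) else 0)
          = if y = j then (if i = x then s else 0) else 0 := by
        intro x y i j
        by_cases h : x = i <;> by_cases h' : y = j <;> simp [h, h', eq_comm]
      intro i j
      rw [hswap a.1.1 b.1.1 i j, hswap b.1.1 a.1.1 i j, add_comm]
    · intro i j hij
      by_cases hi : a.1.1 = i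
      · subst hi
        by_cases hj : j = b.1.1
        · subst hj
          simp only [if_true, hne.symm, if_false, add_zero]
          exact ⟨hHab, hsymm, by simpa [← sub_eq_add_neg] using hAs⟩
        · simp [hj, hne.symm] at hij
      · by_cases hi' : b.1.1 = i
        · subst hi'
          by_cases hj : j = a.1.1
          · subst hj
            simp only [if_true, hne, if_false, zero_add]
            exact ⟨hH _ _ hHab, hsymm.symm, by simpa [← sub_eq_add_neg, ← hsymm] using hAs⟩
          · simp [hj, hne] at hij
        · simp [hi, hi'] at hij
    · intro p
      rw [Finset.sum_neg_distrib, Finset.sum_add_distrib]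
      by_cases hp : a.1.1 = p <;> by_cases hp' : b.1.1 = p <;> simp [hp, hp']
  obtain ⟨b, hab, -⟩ := σ.exists_odd_orbit (hA.even_card_asymArc hloop hf) a₀ (hodd a₀)
  have hab' : ¬ σ.SameCycle a₀ (σ b) := by rwa [Equiv.Perm.sameCycle_apply_right]
  rcases hdense a₀.1.1 b.1.1 (σ b).1.1 (by rw [hσ]; exact hloop' b)
    (fun h => hab (htail _ _ h.symm)) (fun h => hab' (htail _ _ h.symm)) with h | h
  · exact hjoin a₀ b hab h
  · exact hjoin a₀ (σ b) hab' h

theorem exists_symmetric (hA : IsFactorMatrix H f A) (hH : ∀ i j, H i j → H j i)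
    (hloop : ∀ i, ¬ H i i)
    (hdense : ∀ p q r, q ≠ r → q ≠ p → r ≠ p → H p q ∨ H p r)
    (hf : Even (∑ i, f i)) :
    ∃ B, IsFactorMatrix H f B ∧ ∀ i j, B i j = B j i := by
  induction hk : Fintype.card (AsymArc A) using Nat.strong_induction_on generalizing A with
  | _ k ih =>
    by_cases hne : Nonempty (AsymArc A)
    · obtain ⟨a₀⟩ := hne
      obtain ⟨B, hB, hlt⟩ := hA.exists_card_asymArc_lt_of_asymArc hH hloop hdense hf a₀
      exact ih _ (hk ▸ hlt) hB rfl
    · refine ⟨A, hA, fun i j => ?_⟩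
      have h1 : ¬ (A i j = 1 ∧ A j i = 0) := fun h => hne ⟨⟨(i, j), h⟩⟩
      have h2 : ¬ (A j i = 1 ∧ A i j = 0) := fun h => hne ⟨⟨(j, i), h⟩⟩
      have := hA.zero_or_one i j
      have := hA.zero_or_one j i
      omega

end IsFactorMatrix

end Symmetrization

section Existence

variable {V : Type*} [Fintype V] [DecidableEq V]

/-- A Hall-type criterion for the existence of a `0/1` matrix supported on `H` with prescribed row and
column sums `f`. Each position of `H` is assigned to one of `f j` slots of its column `j` (entry `1`) or
one of `g i` slots of its row `i` (entry `0`). -/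
theorem exists_isFactorMatrix (H : V → V → Prop) [DecidableRel H] (f g : V → ℕ)
    (hfg : ∀ i, f i + g i = (Finset.univ.filter (H i)).card)
    (hall : ∀ E : Finset (V × V), (∀ e ∈ E, H e.1 e.2) →
      E.card ≤ ∑ i ∈ E.image Prod.fst, g i + ∑ j ∈ E.image Prod.snd, f j) :
    ∃ A, IsFactorMatrix H (fun i => (f i : ℤ)) A := by
  classical
  let r : {e : V × V // H e.1 e.2} → (Σ i, Fin (g i)) ⊕ (Σ j, Fin (f j)) → Prop :=
    fun e => Sum.elim (fun x => x.1 = e.1.1) (fun x => x.1 = e.1.2)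
  obtain ⟨φ, hinj, hφ⟩ := (Fintype.all_card_le_filter_rel_iff_exists_injective r).1 (by
    intro E
    have := hall (E.map (Function.Embedding.subtype _)) (by
      intro e he
      simp only [Finset.mem_map, Function.Embedding.subtype_apply] at he
      obtain ⟨e', -, rfl⟩ := he
      exact e'.2)
    rw [Finset.card_map] at this
    refine this.trans (le_of_eq ?_)
    have hset : (Finset.univ.filter fun s => ∃ e ∈ E, r e s)
        = ((((E.map (Function.Embedding.subtype _)).image Prod.fst).sigma
            fun _ => Finset.univ).disjSum
          (((E.map (Function.Embedding.subtype _)).image Prod.snd).sigma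
            fun _ => Finset.univ)) := by
      ext s
      rcases s with ⟨i, k⟩ | ⟨j, k⟩
      · simp [r, eq_comm]
      · simp [r, eq_comm]
    rw [hset, Finset.card_disjSum, Finset.card_sigma, Finset.card_sigma]
    simp)
  have hcard : Fintype.card {e : V × V // H e.1 e.2}
      = Fintype.card ((Σ i, Fin (g i)) ⊕ (Σ j, Fin (f j))) := by
    rw [Fintype.card_sum, Fintype.card_sigma, Fintype.card_sigma]
    simp only [Fintype.card_fin]
    rw [← Finset.sum_add_distrib, Finset.sum_congr rfl fun i _ => (add_comm _ _).trans (hfg i),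
      Fintype.card_subtype, Finset.card_filter, Fintype.sum_prod_type]
    simp only [Finset.card_filter]
  let ψ := (Equiv.ofBijective φ ((Fintype.bijective_iff_injective_and_card φ).2 ⟨hinj, hcard⟩)).symm
  have hψ : ∀ s, φ (ψ s) = s := fun s =>
    Equiv.apply_symm_apply (Equiv.ofBijective φ _) s
  have hl : ∀ i (k : Fin (g i)), (ψ (Sum.inl ⟨i, k⟩)).1.1 = i := by
    intro i k
    have := hφ (ψ (Sum.inl ⟨i, k⟩))
    rw [hψ] at this
    exact this.symm
  have hr : ∀ j (k : Fin (f j)), (ψ (Sum.inr ⟨j, k⟩)).1.2 = j := by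
    intro j k
    have := hφ (ψ (Sum.inr ⟨j, k⟩))
    rw [hψ] at this
    exact this.symm
  let Q : V → V → Prop := fun i j => ∃ k : Fin (f j), (ψ (Sum.inr ⟨j, k⟩)).1.1 = i
  have hQ : ∀ i j, Q i j → H i j := by
    rintro i j ⟨k, rfl⟩
    have := (ψ (Sum.inr ⟨j, k⟩)).2
    rwa [hr] at this
  refine ⟨fun i j => if Q i j then 1 else 0, ⟨fun i j => ?_, fun i j hij => ?_, fun i => ?_,
    fun j => ?_⟩⟩
  · by_cases h : Q i j <;> simp [h]
  · by_contra h
    rw [if_neg fun h' => h (hQ i j h')] at hij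
    exact zero_ne_one hij
  · have himg : (Finset.univ.filter fun j => ¬ Q i j ∧ H i j)
        = Finset.univ.image fun k : Fin (g i) => (ψ (Sum.inl ⟨i, k⟩)).1.2 := by
      ext j
      simp only [Finset.mem_filter, Finset.mem_univ, true_and, Finset.mem_image]
      constructor
      · rintro ⟨hnQ, hH⟩
        obtain ⟨s, hs⟩ := ψ.surjective ⟨(i, j), hH⟩
        rcases s with ⟨i', k⟩ | ⟨j', k⟩
        · have := hl i' k
          rw [hs] at this
          obtain rfl : i = i' := this
          exact ⟨k, by rw [hs]⟩
        · have := hr j' k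
          rw [hs] at this
          obtain rfl : j = j' := this
          exact absurd ⟨k, by rw [hs]⟩ hnQ
      · rintro ⟨k, rfl⟩
        constructor
        · rintro ⟨k', hk'⟩
          have : ψ (Sum.inr ⟨_, k'⟩) = ψ (Sum.inl ⟨i, k⟩) :=
            Subtype.ext (Prod.ext (hk'.trans (hl i k).symm) (hr _ _))
          simpa using ψ.injective this
        · have := (ψ (Sum.inl ⟨i, k⟩)).2
          rwa [hl] at this
    have hcardg : (Finset.univ.filter fun j => ¬ Q i j ∧ H i j).card = g i := by
      rw [himg, Finset.card_image_of_injective, Finset.card_univ, Fintype.card_fin]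
      intro k k' hkk
      have : ψ (Sum.inl ⟨i, k⟩) = ψ (Sum.inl ⟨i, k'⟩) :=
        Subtype.ext (Prod.ext ((hl i k).trans (hl i k').symm) hkk)
      simpa using ψ.injective this
    have hsplit := Finset.card_filter_add_card_filter_not (s := Finset.univ.filter (H i)) (Q i)
    rw [Finset.filter_filter, Finset.filter_filter, ← hfg i] at hsplit
    have e1 : (Finset.univ.filter fun j => H i j ∧ Q i j) = Finset.univ.filter (Q i) := by
      ext j
      simpa using hQ i j
    have e2 : (Finset.univ.filter fun j => H i j ∧ ¬ Q i j)
        = Finset.univ.filter fun j => ¬ Q i j ∧ H i j := by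
      ext j
      simp [and_comm]
    rw [e1, e2, hcardg] at hsplit
    rw [Finset.sum_boole]
    exact_mod_cast Nat.add_right_cancel hsplit
  · have himg : (Finset.univ.filter fun i => Q i j)
        = Finset.univ.image fun k : Fin (f j) => (ψ (Sum.inr ⟨j, k⟩)).1.1 := by
      ext i
      simp [Q]
    rw [Finset.sum_boole, himg, Finset.card_image_of_injective, Finset.card_univ, Fintype.card_fin]
    intro k k' hkk
    have : ψ (Sum.inr ⟨j, k⟩) = ψ (Sum.inr ⟨j, k'⟩) :=
      Subtype.ext (Prod.ext hkk ((hr j k).trans (hr j k').symm))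
    simpa using ψ.injective this

/-- A Hall-type criterion for a degree sequence `d` to be realized by a graph containing the perfect
matching `{i, m i}`. -/
theorem exists_simpleGraph_of_matching (m : V → V) (hm : Function.Involutive m)
    (hm' : ∀ i, m i ≠ i) (hV : Even (Fintype.card V)) (d : V → ℕ) (hpos : ∀ i, 1 ≤ d i)
    (hlt : ∀ i, d i < Fintype.card V) (heven : Even (∑ i, d i))
    (hXY : ∀ X Y : Finset V, Disjoint X Y → (X.card : ℤ) * Y.card
      ≤ ∑ i ∈ X, ((Fintype.card V : ℤ) - 1 - d i) + ∑ j ∈ Y, ((d j : ℤ) - 1)) :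
    ∃ G : SimpleGraph V, (∀ i, (G.neighborSet i).ncard = d i) ∧ ∀ i, G.Adj i (m i) := by
  classical
  set H : V → V → Prop := fun i j => i ≠ j ∧ m i ≠ j with hHdef
  have hcardH : ∀ i, (Finset.univ.filter (H i)).card + 2 = Fintype.card V := by
    intro i
    have : Finset.univ.filter (H i) = (Finset.univ.erase i).erase (m i) := by
      ext j
      simp [hHdef, and_comm, eq_comm]
    have hV2 : 1 < Fintype.card V := Fintype.one_lt_card_iff.2 ⟨_, _, hm' i⟩
    rw [this, Finset.card_erase_of_mem (by simp [hm']), Finset.card_erase_of_mem (by simp),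
      Finset.card_univ]
    omega
  obtain ⟨A₀, hA₀⟩ := exists_isFactorMatrix H (fun i => d i - 1)
    (fun i => Fintype.card V - 1 - d i) (fun i => by
      have := hcardH i
      have := hlt i
      have := hpos i
      omega) (by
    intro E hE
    set S := E.image Prod.fst with hS
    set T := E.image Prod.snd with hT
    set M := S.filter fun i => m i ∈ T with hM
    have hcount : E.card + (S ∩ T).card + M.card ≤ S.card * T.card := by
      rw [← Finset.card_product,
        ← Finset.card_image_of_injective (S ∩ T) (f := fun i => (i, i)) fun i j h => congrArg Prod.fst h,
        ← Finset.card_image_of_injective M (f := fun i => (i, m i)) fun i j h => congrArg Prod.fst h,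
        ← Finset.card_union_of_disjoint, ← Finset.card_union_of_disjoint]
      · refine Finset.card_le_card ?_
        rintro ⟨i, j⟩ h
        simp only [Finset.mem_union, Finset.mem_image, Finset.mem_inter, Prod.mk.injEq] at h
        rw [Finset.mem_product]
        rcases h with (h | ⟨a, h, rfl, rfl⟩) | ⟨a, h, rfl, rfl⟩
        · exact ⟨Finset.mem_image_of_mem Prod.fst h, Finset.mem_image_of_mem Prod.snd h⟩
        · exact h
        · exact Finset.mem_filter.1 h
      · rw [Finset.disjoint_right]
        rintro ⟨i, j⟩ h h'
        simp only [Finset.mem_union, Finset.mem_image, Prod.mk.injEq] at h h'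
        obtain ⟨a, -, rfl, rfl⟩ := h
        rcases h' with h | ⟨b, -, h1, h2⟩
        · exact (hE _ h).2 rfl
        · exact hm' a (h2.symm.trans h1)
      · rw [Finset.disjoint_right]
        rintro ⟨i, j⟩ h h'
        simp only [Finset.mem_image, Prod.mk.injEq] at h
        obtain ⟨a, -, rfl, rfl⟩ := h
        exact (hE _ h').1 rfl
    have hMcard : S.card + T.card ≤ M.card + Fintype.card V := by
      have h1 : M.card + (S.filter fun i => m i ∉ T).card = S.card :=
        Finset.card_filter_add_card_filter_not _
      have h2 : (S.filter fun i => m i ∉ T).card ≤ Tᶜ.card :=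
        Finset.card_le_card_of_injOn m (fun i hi => by simpa using (Finset.mem_filter.1 hi).2)
          hm.injective.injOn
      have h3 := Finset.card_add_card_compl T
      omega
    have hU := Finset.card_le_univ (S ∪ T)
    have hUI := Finset.card_union_add_card_inter S T
    have hSX := Finset.card_sdiff_add_card_inter S T
    have hTY := Finset.card_sdiff_add_card_inter T S
    have hmain := hXY (S \ T) (T \ S) (by
      rw [Finset.disjoint_left]
      intro i hi
      simp_all)
    have hsumS := Finset.sum_inter_add_sum_sdiff S T fun i => (Fintype.card V : ℤ) - 1 - d i
    have hsumT := Finset.sum_inter_add_sum_sdiff T S fun i => (d i : ℤ) - 1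
    rw [Finset.inter_comm T S] at hTY hsumT
    have hsumI : ∑ i ∈ S ∩ T, ((Fintype.card V : ℤ) - 1 - d i) + ∑ i ∈ S ∩ T, ((d i : ℤ) - 1)
        = (S ∩ T).card * ((Fintype.card V : ℤ) - 2) := by
      rw [← Finset.sum_add_distrib, Finset.sum_congr rfl fun i _ =>
        show _ = (Fintype.card V : ℤ) - 2 by ring]
      rw [Finset.sum_const, nsmul_eq_mul]
    have hcastS : ((∑ i ∈ S, (Fintype.card V - 1 - d i) : ℕ) : ℤ)
        = ∑ i ∈ S, ((Fintype.card V : ℤ) - 1 - d i) := by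
      push_cast
      refine Finset.sum_congr rfl fun i _ => ?_
      have := hlt i
      omega
    have hcastT : ((∑ i ∈ T, (d i - 1) : ℕ) : ℤ) = ∑ i ∈ T, ((d i : ℤ) - 1) := by
      push_cast
      refine Finset.sum_congr rfl fun i _ => ?_
      have := hpos i
      omega
    zify at hcount
    rw [← Nat.cast_le (α := ℤ), Nat.cast_add, hcastS, hcastT]
    have hslack : 0 ≤ ((S ∩ T).card : ℤ) * (Fintype.card V - 1 - (S ∪ T).card) + M.card := by
      rcases Nat.lt_or_ge (S ∪ T).card (Fintype.card V) with h | h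
      · have : (0 : ℤ) ≤ Fintype.card V - 1 - (S ∪ T).card := by omega
        positivity
      · have h' : ((S ∪ T).card : ℤ) = Fintype.card V := by omega
        rw [h']
        have : (S ∩ T).card ≤ M.card := by omega
        have : ((S ∩ T).card : ℤ) ≤ M.card := by exact_mod_cast this
        linarith
    have eS : (S.card : ℤ) = (S \ T).card + (S ∩ T).card := by omega
    have eT : (T.card : ℤ) = (T \ S).card + (S ∩ T).card := by omega
    have eU : ((S ∪ T).card : ℤ) = (S \ T).card + (T \ S).card + (S ∩ T).card := by omega
    rw [eS, eT] at hcount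
    rw [eU] at hslack
    nlinarith)
  obtain ⟨A, hA, hsym⟩ := hA₀.exists_symmetric
    (fun i j h => ⟨h.1.symm, fun h' => h.2 (by rw [← h', hm])⟩) (fun i h => h.1 rfl)
    (fun p q r hqr hqp hrp => by
      by_cases h : m p = q
      · exact Or.inr ⟨hrp.symm, fun h' => hqr (h.symm.trans h')⟩
      · exact Or.inl ⟨hqp.symm, h⟩)
    (by
      have : ∑ i, ((d i - 1 : ℕ) : ℤ) = (∑ i, d i : ℕ) - (Fintype.card V : ℤ) := by
        push_cast
        rw [Finset.sum_congr rfl fun i _ => Nat.cast_sub (hpos i)]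
        simp
      rw [this]
      exact ((Int.even_coe_nat _).2 heven).sub ((Int.even_coe_nat _).2 hV))
  refine ⟨⟨fun i j => A i j = 1 ∨ m i = j, ⟨fun i j h => ?_⟩, ⟨fun i h => ?_⟩⟩, fun i => ?_,
    fun i => Or.inr rfl⟩
  · rcases h with h | rfl
    · exact Or.inl (hsym i j ▸ h)
    · exact Or.inr (hm i)
  · rcases h with h | h
    · exact (hA.supp i i h).1 rfl
    · exact hm' i h
  · have hset : {j | A i j = 1 ∨ m i = j}
        = (insert (m i) (Finset.univ.filter fun j => A i j = 1) : Finset V) := by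
      ext j
      simp [eq_comm, or_comm]
    have hrow : ((Finset.univ.filter fun j => A i j = 1).card : ℤ) = (d i - 1 : ℕ) := by
      rw [← hA.row i, Finset.card_filter]
      push_cast
      refine Finset.sum_congr rfl fun j _ => ?_
      rcases hA.zero_or_one i j with h | h <;> simp [h]
    change Set.ncard {j | A i j = 1 ∨ m i = j} = d i
    rw [hset, Set.ncard_coe_finset, Finset.card_insert_of_notMem]
    · have := hpos i
      omega
    · intro h
      exact (hA.supp _ _ (Finset.mem_filter.1 h).2).2 rfl

end Existence

section DegreeSum

/-- If `L` consists of the indices of `k` largest values of `d`, then the average of `d` over a set with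
at least `k` elements is at most the average over `L`. -/
theorem card_mul_sum_le_of_forall_le {V : Type*} [DecidableEq V] (d : V → ℕ) (L X : Finset V) (τ : ℕ)
    (hL : ∀ i ∈ L, τ ≤ d i) (hL' : ∀ i ∉ L, d i ≤ τ) (hcard : L.card ≤ X.card) :
    L.card * ∑ i ∈ X, d i ≤ (∑ i ∈ L, d i) * X.card := by
  have h1 := Finset.sum_inter_add_sum_sdiff X L fun i => d i
  have h2 := Finset.sum_inter_add_sum_sdiff L X fun i => d i
  have h3 := Finset.card_sdiff_add_card_inter X L
  have h4 := Finset.card_sdiff_add_card_inter L X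
  rw [Finset.inter_comm L X] at h2 h4
  have h5 := Finset.sum_le_card_nsmul (X \ L) (fun i => d i) τ fun i hi => hL' i (Finset.mem_sdiff.1 hi).2
  have h6 := Finset.card_nsmul_le_sum (L \ X) (fun i => d i) τ fun i hi => hL i (Finset.mem_sdiff.1 hi).1
  have h7 := Finset.card_nsmul_le_sum L (fun i => d i) τ hL
  rw [smul_eq_mul] at h5 h6 h7
  obtain ⟨t, ht⟩ := Nat.exists_eq_add_of_le hcard
  have h8 : (X \ L).card = (L \ X).card + t := by omega
  rw [h8] at h5
  have h9 : ∑ i ∈ X, d i ≤ ∑ i ∈ L, d i + t * τ := by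
    rw [add_mul] at h5
    omega
  rw [ht]
  nlinarith [Nat.mul_le_mul_left L.card h9, Nat.mul_le_mul_left t h7]

theorem card_mul_card_le_of_sum_le {k : ℕ} {d : Fin (2 * k) → ℕ} (hd : Antitone d)
    (hlt : ∀ i, d i < 2 * k) (hmin : ∀ i, k ≤ d i) {r : ℝ} (hr : r ^ 2 = 8 * (k : ℝ) ^ 2 - 8 * k)
    (hsum : ∑ i ∈ Finset.univ.filter (fun i : Fin (2 * k) => (i : ℕ) < k), (d i : ℝ) ≤ (r - k) * k)
    (X Y : Finset (Fin (2 * k))) (hdisj : Disjoint X Y) :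
    (X.card : ℤ) * Y.card ≤ ∑ i ∈ X, ((2 * k : ℤ) - 1 - d i) + ∑ j ∈ Y, ((d j : ℤ) - 1) := by
  have hY : (Y.card : ℤ) * (k - 1) ≤ ∑ j ∈ Y, ((d j : ℤ) - 1) := by
    rw [← nsmul_eq_mul]
    refine Finset.card_nsmul_le_sum _ _ _ fun i _ => ?_
    have := hmin i
    omega
  rcases Nat.lt_or_ge X.card k with hX | hX
  · have hX0 : 0 ≤ ∑ i ∈ X, ((2 * k : ℤ) - 1 - d i) := Finset.sum_nonneg fun i _ => by
      have := hlt i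
      omega
    have : (X.card : ℤ) ≤ k - 1 := by omega
    nlinarith [Int.natCast_nonneg Y.card]
  · have hXY : X.card + Y.card ≤ 2 * k := by
      rw [← Finset.card_union_of_disjoint hdisj]
      simpa using Finset.card_le_univ (X ∪ Y)
    rcases Nat.eq_zero_or_pos k with rfl | hk
    · have hX0 : X = ∅ := Finset.card_eq_zero.1 (by omega)
      have hY0 : Y = ∅ := Finset.card_eq_zero.1 (by omega)
      simp [hX0, hY0]
    set L := Finset.univ.filter (fun i : Fin (2 * k) => (i : ℕ) < k) with hLdef
    have hLcard : L.card = k := by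
      rw [hLdef, Fin.card_filter_val_lt]
      omega
    have hle := card_mul_sum_le_of_forall_le d L X (d ⟨k - 1, by omega⟩)
      (fun i hi => hd (by
        rw [hLdef, Finset.mem_filter] at hi
        rw [Fin.le_def]
        dsimp only
        omega))
      (fun i hi => hd (by
        simp only [hLdef, Finset.mem_filter, Finset.mem_univ, true_and] at hi
        rw [Fin.le_def]
        dsimp only
        omega)) (hLcard.trans_le hX)
    rw [hLcard] at hle
    have hk' : (0 : ℝ) < k := by exact_mod_cast hk
    have hXle : ∑ i ∈ X, (d i : ℝ) ≤ (r - k) * X.card := by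
      have hle' : (k : ℝ) * ∑ i ∈ X, (d i : ℝ) ≤ (∑ i ∈ L, (d i : ℝ)) * X.card := by
        exact_mod_cast hle
      refine le_of_mul_le_mul_left ?_ hk'
      calc _ ≤ _ := hle'
        _ ≤ (r - k) * k * X.card := mul_le_mul_of_nonneg_right hsum (Nat.cast_nonneg _)
        _ = _ := by ring
    have hsumX : ∑ i ∈ X, ((2 * k : ℤ) - 1 - d i) = X.card * (2 * k - 1) - ∑ i ∈ X, (d i : ℤ) := by
      rw [Finset.sum_sub_distrib, Finset.sum_const, nsmul_eq_mul]
    rw [hsumX]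
    refine le_trans ?_ (add_le_add_right hY _)
    rw [← Int.cast_le (R := ℝ)]
    push_cast
    have hX' : (k : ℝ) ≤ X.card := by exact_mod_cast hX
    have hXY' : (X.card : ℝ) + Y.card ≤ 2 * k := by exact_mod_cast hXY
    nlinarith [sq_nonneg ((X.card : ℝ) - r / 2),
      mul_nonneg (sub_nonneg.2 hXY') (show (0 : ℝ) ≤ X.card + 1 - k by linarith)]

end DegreeSum

theorem stmt_3 {n : ℕ} (hne : Even n) (d : Fin n → ℕ) (hd : Antitone d)
    (hgraphic : ∃ G : SimpleGraph (Fin n), ∀ i, (G.neighborSet i).ncard = d i)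
    (hmin : ∀ i, n / 2 ≤ d i)
    (hsum : (∑ i ∈ Finset.univ.filter (fun i : Fin n => (i : ℕ) < n / 2),
        (d i : ℝ)) ≤ (Real.sqrt (2 - 4 / (n : ℝ)) - 0.5) * (n : ℝ) ^ 2 / 2) :
    RealizesMplus d := by
  classical
  obtain ⟨k, rfl⟩ := hne.two_dvd
  rw [Nat.mul_div_cancel_left k two_pos] at hmin hsum
  obtain ⟨G, hG⟩ := hgraphic
  have hdeg : ∀ i, G.degree i = d i := fun i => by
    rw [← hG i, ← G.card_neighborSet_eq_degree, Set.ncard_eq_toFinset_card', Set.toFinset_card]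
  have hlt : ∀ i, d i < 2 * k := fun i => by
    simpa [hdeg] using G.degree_lt_card_verts i
  have heven : Even (∑ i, d i) := by
    rw [← Finset.sum_congr rfl fun i _ => hdeg i, G.sum_degrees_eq_twice_card_edges]
    exact even_two_mul _
  let m : Fin (2 * k) → Fin (2 * k) := fun i =>
    ⟨if (i : ℕ) % 2 = 0 then i + 1 else i - 1, by
      have := i.2
      split_ifs <;> omega⟩
  have hm : Function.Involutive m := fun i => by
    ext
    simp only [m]
    split_ifs <;> omega
  have hm' : ∀ i, m i ≠ i := fun i h => by
    have := congrArg Fin.val h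
    simp only [m] at this
    split_ifs at this <;> omega
  obtain ⟨G', hG', hadj⟩ := exists_simpleGraph_of_matching m hm hm'
    (by rw [Fintype.card_fin]; exact even_two_mul k) d
    (fun i => by
      have := hmin i
      have := i.2
      omega)
    (by simpa using hlt) heven (fun X Y hdisj => by
      rcases Nat.eq_zero_or_pos k with rfl | hk
      · have hX : X = ∅ := Finset.eq_empty_of_forall_notMem fun i => i.elim0
        have hY : Y = ∅ := Finset.eq_empty_of_forall_notMem fun i => i.elim0
        simp [hX, hY]
      have hk' : (1 : ℝ) ≤ k := by exact_mod_cast hk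
      have hk0 : (k : ℝ) ≠ 0 := by positivity
      have hdiv : (4 : ℝ) / (2 * k) ≤ 2 := by
        rw [div_le_iff₀ (by positivity)]
        linarith
      push_cast at hsum
      have := card_mul_card_le_of_sum_le hd hlt hmin
        (r := Real.sqrt (2 - 4 / (2 * (k : ℝ))) * (2 * k))
        (by
          rw [mul_pow, Real.sq_sqrt (by linarith)]
          field_simp
          ring)
        (hsum.trans_eq (by ring)) X Y hdisj
      simpa using this)
  refine ⟨G', hG', fun i hi => ?_⟩
  have hi' : (i : ℕ) + 1 < 2 * k := by
    have := i.2
    omega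
  refine ⟨hi', ?_⟩
  have : m i = ⟨(i : ℕ) + 1, hi'⟩ := by simp [m, hi]
  exact this ▸ hadj i
end

section
/- Let n ≥ 3 be an integer, and let (d_1^1, …, d_n^1) and (d_1^2, …, d_n^2) be two graphic sequences with d_n^1 ≥ 1 and d_n^2 ≥ 1. If d_1^1 · d_1^2 < n/2, then the two sequences pack, i.e., there exist edge-disjoint simple graphs G_1 and G_2 on the common vertex set [n] with deg_{G_j}(i) = d_i^j for all i ∈ [n] and j ∈ {1,2}. -/
namespace SimpleGraph

variable {V : Type*}

/-- The 2-switch of `G` replacing the edges `uv`, `wz` by `vw`, `uz`. -/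
def twoSwitch (G : SimpleGraph V) (u v w z : V) : SimpleGraph V :=
  (G \ (edge u v ⊔ edge w z)) ⊔ (edge v w ⊔ edge u z)

theorem ncard_neighborSet_twoSwitch [Finite V] {G : SimpleGraph V} {u v w z : V}
    (huv : G.Adj u v) (hwz : G.Adj w z) (hvw : v ≠ w) (huz : u ≠ z)
    (hvw' : ¬ G.Adj v w) (huz' : ¬ G.Adj u z) (x : V) :
    ((G.twoSwitch u v w z).neighborSet x).ncard = (G.neighborSet x).ncard := by
  have huw : u ≠ w := by rintro rfl; exact hvw' huv.symm
  have hvz : v ≠ z := by rintro rfl; exact huz' huv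
  have h1 := huv.ne
  have h2 := hwz.ne
  have key (p q : V) (hp : ¬ G.Adj x p) (hq : G.Adj x q)
      (h : ∀ y, (G.twoSwitch u v w z).Adj x y ↔ y = p ∨ (G.Adj x y ∧ y ≠ q)) :
      ((G.twoSwitch u v w z).neighborSet x).ncard = (G.neighborSet x).ncard := by
    rw [show (G.twoSwitch u v w z).neighborSet x = insert p (G.neighborSet x \ {q}) by
      ext y; simp [h]]
    exact Set.ncard_exchange hp hq
  by_cases hxu : x = u
  · subst hxu
    refine key z v huz' huv fun y => ?_
    simp only [twoSwitch, sup_adj, sdiff_adj, edge_adj]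
    grind
  by_cases hxv : x = v
  · subst hxv
    refine key w u hvw' huv.symm fun y => ?_
    simp only [twoSwitch, sup_adj, sdiff_adj, edge_adj]
    grind
  by_cases hxw : x = w
  · subst hxw
    refine key v z (fun h => hvw' h.symm) hwz fun y => ?_
    simp only [twoSwitch, sup_adj, sdiff_adj, edge_adj]
    grind
  by_cases hxz : x = z
  · subst hxz
    refine key u w (fun h => huz' h.symm) hwz.symm fun y => ?_
    simp only [twoSwitch, sup_adj, sdiff_adj, edge_adj]
    grind
  congr 1
  ext y
  simp only [twoSwitch, mem_neighborSet, sup_adj, sdiff_adj, edge_adj]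
  grind

theorem inf_twoSwitch_lt {G H : SimpleGraph V} {u v w z : V}
    (huv : G.Adj u v) (huv' : H.Adj u v) (hvw : ¬ H.Adj v w) (huz : ¬ H.Adj u z) :
    H ⊓ G.twoSwitch u v w z < H ⊓ G := by
  refine lt_of_le_not_ge (fun x y => ?_) fun h => ?_
  · simp only [twoSwitch, inf_adj, sup_adj, sdiff_adj, edge_adj]
    grind [SimpleGraph.adj_comm]
  · have hne := huv.ne
    have := (h (show (H ⊓ G).Adj u v from ⟨huv', huv⟩)).2
    simp only [twoSwitch, sup_adj, sdiff_adj, edge_adj] at this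
    grind [SimpleGraph.adj_comm]

/-- If `H` and `G` share the edge `uv` and `2ab < |V|`, then some edge of `G` can be switched
with `uv` along non-edges of `H ⊔ G`. -/
theorem exists_adj_not_adj_of_common_adj [Finite V] {G H : SimpleGraph V} {a b : ℕ} (hba : b ≤ a)
    (hH : ∀ x, (H.neighborSet x).ncard ≤ a) (hG : ∀ x, (G.neighborSet x).ncard ≤ b)
    (hG1 : ∀ x, 1 ≤ (G.neighborSet x).ncard) (hab : 2 * (a * b) < Nat.card V)
    {u v : V} (huv : G.Adj u v) (huv' : H.Adj u v) :
    ∃ w z, G.Adj w z ∧ v ≠ w ∧ u ≠ z ∧ ¬ G.Adj v w ∧ ¬ G.Adj u z ∧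
      ¬ H.Adj v w ∧ ¬ H.Adj u z := by
  classical
  have := Fintype.ofFinite V
  by_contra! hcon
  let NG (x : V) : Finset V := (G.neighborSet x).toFinset
  let NH (x : V) : Finset V := (H.neighborSet x).toFinset
  have mG (x y : V) : y ∈ NG x ↔ G.Adj x y := by simp [NG]
  have mH (x y : V) : y ∈ NH x ↔ H.Adj x y := by simp [NH]
  have cG (x : V) : (NG x).card ≤ b := by
    simpa [NG, Set.ncard_eq_toFinset_card'] using hG x
  have cH (x : V) : (NH x).card ≤ a := by
    simpa [NH, Set.ncard_eq_toFinset_card'] using hH x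
  have cGe (x y : V) (h : G.Adj x y) : ((NG x).erase y).card ≤ b - 1 := by
    rw [Finset.card_erase_of_mem ((mG _ _).2 h)]; exact Nat.sub_le_sub_right (cG x) 1
  have cHe (x y : V) (h : H.Adj x y) : ((NH x).erase y).card ≤ a - 1 := by
    rw [Finset.card_erase_of_mem ((mH _ _).2 h)]; exact Nat.sub_le_sub_right (cH x) 1
  have hcov : (Finset.univ : Finset V) ⊆ ({v} ∪ NH v ∪ (NG v).erase u) ∪
      ((NG u).erase v ∪ ((NG u).erase v).biUnion (fun y => (NG y).erase u) ∪
        ((NH u).erase v).biUnion NG) := by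
    intro x _
    obtain ⟨y, hy⟩ : (G.neighborSet x).Nonempty :=
      (Set.ncard_pos).1 (hG1 x)
    have hy : G.Adj x y := hy
    simp only [Finset.mem_union, Finset.mem_singleton, Finset.mem_erase, Finset.mem_biUnion,
      mG, mH]
    have := hcon x y hy
    grind [SimpleGraph.adj_comm]
  have hb : 1 ≤ b := (hG1 u).trans (hG u)
  have hcard := Finset.card_le_card hcov
  have h1 : ({v} ∪ NH v ∪ (NG v).erase u).card ≤ 1 + a + (b - 1) :=
    (Finset.card_union_le _ _).trans <| add_le_add
      ((Finset.card_union_le _ _).trans <| add_le_add (by simp) (cH v)) (cGe v u huv.symm)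
  have h2 : (((NG u).erase v).biUnion (fun y => (NG y).erase u)).card ≤ (b - 1) * (b - 1) := by
    refine (Finset.card_biUnion_le_card_mul _ _ (b - 1) fun y hy => cGe y u ?_).trans
      (Nat.mul_le_mul_right _ (cGe u v huv))
    exact ((mG _ _).1 (Finset.mem_of_mem_erase hy)).symm
  have h3 : (((NH u).erase v).biUnion NG).card ≤ (a - 1) * b :=
    (Finset.card_biUnion_le_card_mul _ _ b fun y _ => cG y).trans
      (Nat.mul_le_mul_right _ (cHe u v huv'))
  have h4 := (Finset.card_union_le ((NG u).erase v ∪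
      ((NG u).erase v).biUnion (fun y => (NG y).erase u)) (((NH u).erase v).biUnion NG))
  have h5 := Finset.card_union_le ((NG u).erase v)
      (((NG u).erase v).biUnion (fun y => (NG y).erase u))
  have h6 := Finset.card_union_le ({v} ∪ NH v ∪ (NG v).erase u)
      ((NG u).erase v ∪ ((NG u).erase v).biUnion (fun y => (NG y).erase u) ∪
        ((NH u).erase v).biUnion NG)
  have h7 := cGe u v huv
  rw [Finset.card_univ, ← Nat.card_eq_fintype_card] at hcard
  obtain ⟨c, rfl⟩ := Nat.exists_eq_add_of_le' hb
  obtain ⟨e, rfl⟩ := Nat.exists_eq_add_of_le hba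
  have h8 : c + 1 + e - 1 = c + e := by omega
  simp only [Nat.add_sub_cancel, h8] at *
  nlinarith [Nat.zero_le (c * e)]

/-- If `H` and `G` have maximum degrees at most `a ≥ b`, `G` has no isolated vertices and
`2ab < |V|`, then some graph with the same degrees as `G` is disjoint from `H`. -/
theorem exists_disjoint_same_degrees [Finite V] {G H : SimpleGraph V} {a b : ℕ} (hba : b ≤ a)
    (hH : ∀ x, (H.neighborSet x).ncard ≤ a) (hG : ∀ x, (G.neighborSet x).ncard ≤ b)
    (hG1 : ∀ x, 1 ≤ (G.neighborSet x).ncard) (hab : 2 * (a * b) < Nat.card V) :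
    ∃ G' : SimpleGraph V, Disjoint H G' ∧
      ∀ x, (G'.neighborSet x).ncard = (G.neighborSet x).ncard := by
  induction hI : H ⊓ G using WellFoundedLT.induction generalizing G with
  | ind I ih =>
    subst hI
    by_cases hd : H ⊓ G = ⊥
    · exact ⟨G, disjoint_iff.2 hd, fun _ => rfl⟩
    obtain ⟨u, v, huv', huv⟩ := ne_bot_iff_exists_adj.1 hd
    obtain ⟨w, z, hwz, hvw, huz, hGvw, hGuz, hHvw, hHuz⟩ :=
      exists_adj_not_adj_of_common_adj hba hH hG hG1 hab huv huv'
    have hs := ncard_neighborSet_twoSwitch huv hwz hvw huz hGvw hGuz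
    obtain ⟨G', hdis, hdeg⟩ := ih _ (inf_twoSwitch_lt huv huv' hHvw hHuz)
      (fun x => (hs x).trans_le (hG x)) (fun x => (hG1 x).trans_eq (hs x).symm) rfl
    exact ⟨G', hdis, fun x => (hdeg x).trans (hs x)⟩

end SimpleGraph

theorem stmt_4 {n : ℕ} (hn : 3 ≤ n) (d1 d2 : Fin n → ℕ)
    (hd1 : Antitone d1) (hd2 : Antitone d2)
    (hg1 : ∃ G : SimpleGraph (Fin n), ∀ i, (G.neighborSet i).ncard = d1 i)
    (hg2 : ∃ G : SimpleGraph (Fin n), ∀ i, (G.neighborSet i).ncard = d2 i)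
    (hpos1 : ∀ i, 1 ≤ d1 i) (hpos2 : ∀ i, 1 ≤ d2 i)
    (hprod : 2 * (d1 ⟨0, by omega⟩ * d2 ⟨0, by omega⟩) < n) :
    ∃ G1 G2 : SimpleGraph (Fin n), Disjoint G1.edgeSet G2.edgeSet ∧
      (∀ i, (G1.neighborSet i).ncard = d1 i) ∧
      (∀ i, (G2.neighborSet i).ncard = d2 i) := by
  obtain ⟨G1, h1⟩ := hg1
  obtain ⟨G2, h2⟩ := hg2
  have hm1 (i : Fin n) : d1 i ≤ d1 ⟨0, by omega⟩ := hd1 (Nat.zero_le _)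
  have hm2 (i : Fin n) : d2 i ≤ d2 ⟨0, by omega⟩ := hd2 (Nat.zero_le _)
  simp only [SimpleGraph.disjoint_edgeSet]
  rcases le_total (d2 ⟨0, by omega⟩) (d1 ⟨0, by omega⟩) with h | h
  · obtain ⟨G', hdis, hdeg⟩ := SimpleGraph.exists_disjoint_same_degrees (H := G1) (G := G2) h
      (by simpa [h1] using hm1) (by simpa [h2] using hm2) (by simpa only [h2] using hpos2)
      (by simpa using hprod)
    exact ⟨G1, G', hdis, h1, fun i => (hdeg i).trans (h2 i)⟩
  · obtain ⟨G', hdis, hdeg⟩ := SimpleGraph.exists_disjoint_same_degrees (H := G2) (G := G1) h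
      (by simpa [h2] using hm2) (by simpa [h1] using hm1) (by simpa only [h1] using hpos1)
      (by simpa [mul_comm (d2 _)] using hprod)
    exact ⟨G', G2, hdis.symm, fun i => (hdeg i).trans (h1 i), h2⟩
end

section
/- Let h, n ∈ ℕ with h ≥ 1, let d_1 ≥ d_2 ≥ … ≥ d_n ≥ 1 be integers, and suppose n is a multiple of h+1. Let F_h be the h-regular graph on [n] that is the disjoint union of the complete graphs on the vertex sets {1,…,h+1}, {h+2,…,2(h+1)}, …, {n−h,…,n}. If there exists a graph G with V(G) = [n], deg_G(i) = d_i for all i ∈ [n], and F_h ⊆ G (as a subgraph), then Σ_{i=1}^n d_i is even, and for every k ∈ [n], letting s ∈ {0,…,h} be the residue of k modulo h+1: Σ_{i=1}^k d_i ≤ k(k−1) + Σ_{i=k+1}^{k+1+h−s} min{d_i − h + s, k} + Σ_{i=k+h−s+2}^n min{d_i − h, k} (sums over indices exceeding n are omitted). -/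
/-- The canonical `h`-factor on `[n]` (for `n` a multiple of `h+1`): the
disjoint union of complete graphs on the consecutive blocks
`{1,…,h+1}, {h+2,…,2(h+1)}, …, {n−h,…,n}` (0-indexed: two distinct vertices
are adjacent iff they lie in the same block of `⌊·/(h+1)⌋`). -/
def canonicalFactor (n h : ℕ) : SimpleGraph (Fin n) :=
  SimpleGraph.fromRel (fun i j => (i : ℕ) / (h + 1) = (j : ℕ) / (h + 1))

open Classical in
/-- A vertex `j` of a clique on the interval `[a, b)`, with `k ≤ a`, has at least `b - a - 1`
neighbours that are not among the first `k` vertices. -/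
theorem SimpleGraph.card_adj_lt_le_min {n : ℕ} (G : SimpleGraph (Fin n)) {k a b : ℕ}
    (hka : k ≤ a) (hb : b ≤ n) (hkn : k ≤ n) (j : Fin n) (haj : a ≤ j) (hjb : (j : ℕ) < b)
    (hclique : ∀ i : Fin n, a ≤ i → (i : ℕ) < b → j ≠ i → G.Adj j i) :
    (Finset.univ.filter fun i : Fin n => (i : ℕ) < k ∧ G.Adj i j).card ≤
      min (G.degree j - (b - a - 1)) k := by
  refine le_min ?_ ?_
  · have hcard : (Finset.univ.filter fun i : Fin n => a ≤ (i : ℕ) ∧ (i : ℕ) < b).card = b - a := by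
      rw [← Nat.card_Ico a b, ← Finset.card_map Fin.valEmbedding]
      congr 1
      ext x
      simp only [Finset.mem_map, Finset.mem_filter, Finset.mem_univ, true_and,
        Fin.valEmbedding_apply, Finset.mem_Ico]
      exact ⟨fun ⟨i, hi, hx⟩ => hx ▸ hi, fun hx => ⟨⟨x, hx.2.trans_le hb⟩, hx, rfl⟩⟩
    have herase := Finset.card_erase_of_mem
      (s := Finset.univ.filter fun i : Fin n => a ≤ (i : ℕ) ∧ (i : ℕ) < b) (a := j)
      (by simp [haj, hjb])
    have hdisj : Disjoint (Finset.univ.filter fun i : Fin n => (i : ℕ) < k ∧ G.Adj i j)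
        ((Finset.univ.filter fun i : Fin n => a ≤ (i : ℕ) ∧ (i : ℕ) < b).erase j) := by
      rw [Finset.disjoint_left]
      intro i hi hi'
      simp only [Finset.mem_filter, Finset.mem_univ, true_and, Finset.mem_erase] at hi hi'
      omega
    have hsub : (Finset.univ.filter fun i : Fin n => (i : ℕ) < k ∧ G.Adj i j) ∪
        ((Finset.univ.filter fun i : Fin n => a ≤ (i : ℕ) ∧ (i : ℕ) < b).erase j) ⊆
          G.neighborFinset j := by
      intro i hi
      simp only [Finset.mem_union, Finset.mem_filter, Finset.mem_univ, true_and,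
        Finset.mem_erase, SimpleGraph.mem_neighborFinset] at hi ⊢
      rcases hi with hi | hi
      · exact hi.2.symm
      · exact hclique i hi.2.1 hi.2.2 (Ne.symm hi.1)
    have hle := Finset.card_le_card hsub
    rw [Finset.card_union_of_disjoint hdisj, SimpleGraph.card_neighborFinset_eq_degree] at hle
    omega
  · calc _ ≤ (Finset.univ.filter fun i : Fin n => (i : ℕ) < k).card :=
          Finset.card_le_card fun i hi => by
            simp only [Finset.mem_filter, Finset.mem_univ, true_and] at hi ⊢
            exact hi.1
      _ = k := by rw [Fin.card_filter_val_lt, min_eq_right hkn]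

open Classical in
/-- The degrees of the first `k` vertices sum to at most `k * (k - 1)` plus the number of edges
joining them to the remaining vertices. -/
theorem SimpleGraph.sum_degree_lt_le {n : ℕ} (G : SimpleGraph (Fin n)) {k : ℕ} (hkn : k ≤ n) :
    ∑ i ∈ Finset.univ.filter (fun i : Fin n => (i : ℕ) < k), G.degree i ≤
      k * (k - 1) + ∑ j ∈ Finset.univ.filter (fun j : Fin n => k ≤ (j : ℕ)),
        (Finset.univ.filter fun i : Fin n => (i : ℕ) < k ∧ G.Adj i j).card := by
  have hcard : (Finset.univ.filter fun i : Fin n => (i : ℕ) < k).card = k := by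
    rw [Fin.card_filter_val_lt, min_eq_right hkn]
  have hsplit : ∀ i ∈ Finset.univ.filter (fun i : Fin n => (i : ℕ) < k), G.degree i ≤ (k - 1) +
      ((Finset.univ.filter fun j : Fin n => k ≤ (j : ℕ)).filter fun j => G.Adj i j).card := by
    intro i hi
    have hsub : G.neighborFinset i ⊆ (Finset.univ.filter fun j : Fin n => (j : ℕ) < k).erase i ∪
        ((Finset.univ.filter fun j : Fin n => k ≤ (j : ℕ)).filter fun j => G.Adj i j) := by
      intro j hj
      rw [SimpleGraph.mem_neighborFinset] at hj
      have := hj.ne'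
      simp only [Finset.mem_union, Finset.mem_erase, Finset.mem_filter, Finset.mem_univ, true_and]
      rcases lt_or_ge (j : ℕ) k with h | h
      · exact Or.inl ⟨this, h⟩
      · exact Or.inr ⟨h, hj⟩
    rw [← SimpleGraph.card_neighborFinset_eq_degree]
    refine (Finset.card_le_card hsub).trans ((Finset.card_union_le _ _).trans ?_)
    rw [Finset.card_erase_of_mem hi, hcard]
  refine (Finset.sum_le_sum hsplit).trans ?_
  rw [Finset.sum_add_distrib, Finset.sum_const, hcard, smul_eq_mul]
  have hcomm := Finset.sum_card_bipartiteAbove_eq_sum_card_bipartiteBelow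
    (s := Finset.univ.filter fun i : Fin n => (i : ℕ) < k)
    (t := Finset.univ.filter fun j : Fin n => k ≤ (j : ℕ)) G.Adj
  simp only [Finset.bipartiteAbove, Finset.bipartiteBelow] at hcomm
  rw [hcomm]
  simp only [Finset.filter_filter, le_refl]

theorem canonicalFactor_adj {n h : ℕ} {i j : Fin n} :
    (canonicalFactor n h).Adj i j ↔ i ≠ j ∧ (i : ℕ) / (h + 1) = (j : ℕ) / (h + 1) := by
  simp [canonicalFactor, eq_comm (a := (j : ℕ) / (h + 1))]

theorem stmt_13 {n h : ℕ} (hh : 1 ≤ h) (d : Fin n → ℕ) (hd : Antitone d)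
    (hd1 : ∀ i, 1 ≤ d i) (hdvd : (h + 1) ∣ n)
    (hG : ∃ G : SimpleGraph (Fin n), (∀ i, (G.neighborSet i).ncard = d i) ∧
      canonicalFactor n h ≤ G) :
    Even (∑ i, d i) ∧
    ∀ k : ℕ, 1 ≤ k → k ≤ n →
      (∑ i ∈ Finset.univ.filter (fun i : Fin n => (i : ℕ) < k), d i) ≤
        k * (k - 1) +
          (∑ i ∈ Finset.univ.filter
              (fun i : Fin n => k ≤ (i : ℕ) ∧ (i : ℕ) ≤ k + (h - k % (h + 1))),
            min (d i - (h - k % (h + 1))) k) +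
          ∑ i ∈ Finset.univ.filter
              (fun i : Fin n => k + (h - k % (h + 1)) + 1 ≤ (i : ℕ)),
            min (d i - h) k := by
  classical
  obtain ⟨G, hdeg, hle⟩ := hG
  obtain rfl : d = fun i => G.degree i := by
    funext i
    rw [← hdeg i, ← SimpleGraph.card_neighborFinset_eq_degree, ← Set.ncard_coe_finset,
      SimpleGraph.coe_neighborFinset]
  refine ⟨by rw [G.sum_degrees_eq_twice_card_edges]; exact even_two_mul _, fun k hk hkn => ?_⟩
  refine (G.sum_degree_lt_le hkn).trans ?_
  rw [add_assoc]
  refine Nat.add_le_add_left ?_ _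
  obtain ⟨m, rfl⟩ := hdvd
  have hs : k % (h + 1) < h + 1 := Nat.mod_lt _ h.succ_pos
  have hkdiv := Nat.div_add_mod k (h + 1)
  rw [← Finset.sum_filter_add_sum_filter_not _
    (fun j : Fin ((h + 1) * m) => (j : ℕ) ≤ k + (h - k % (h + 1))),
    Finset.filter_filter, Finset.filter_filter]
  have hfilter : (Finset.univ.filter fun j : Fin ((h + 1) * m) =>
      k ≤ (j : ℕ) ∧ ¬ (j : ℕ) ≤ k + (h - k % (h + 1))) =
      Finset.univ.filter fun j : Fin ((h + 1) * m) => k + (h - k % (h + 1)) + 1 ≤ (j : ℕ) := by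
    ext j
    simp only [Finset.mem_filter, Finset.mem_univ, true_and]
    omega
  rw [hfilter]
  have hend : ∀ (q : ℕ) (j : Fin ((h + 1) * m)), (h + 1) * q ≤ j →
      (h + 1) * q + (h + 1) ≤ (h + 1) * m := by
    intro q j hj
    have : q < m := Nat.lt_of_mul_lt_mul_left (hj.trans_lt j.isLt)
    simpa [Nat.mul_succ] using Nat.mul_le_mul_left (h + 1) (Nat.succ_le_of_lt this)
  have hadj : ∀ (q : ℕ) (j i : Fin ((h + 1) * m)), (h + 1) * q ≤ j →
      (j : ℕ) < (h + 1) * q + (h + 1) → (h + 1) * q ≤ i → (i : ℕ) < (h + 1) * q + (h + 1) → j ≠ i → G.Adj j i := by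
    intro q j i hj hj' hi hi' hne
    refine hle (canonicalFactor_adj.2 ⟨hne, ?_⟩)
    rw [Nat.div_eq_of_lt_le (k := q) (by linarith) (by linarith),
      Nat.div_eq_of_lt_le (k := q) (by linarith) (by linarith)]
  refine Nat.add_le_add (Finset.sum_le_sum fun j hj => ?_) (Finset.sum_le_sum fun j hj => ?_)
  · simp only [Finset.mem_filter, Finset.mem_univ, true_and] at hj
    have hb := hend (k / (h + 1)) j (by omega)
    have key := G.card_adj_lt_le_min (b := (h + 1) * (k / (h + 1)) + (h + 1)) le_rfl hb hkn j hj.1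
      (by omega) fun i hi hi' hne => hadj (k / (h + 1)) j i (by omega) (by omega) (by omega) hi' hne
    rwa [show (h + 1) * (k / (h + 1)) + (h + 1) - k - 1 = h - k % (h + 1) by omega] at key
  · simp only [Finset.mem_filter, Finset.mem_univ, true_and] at hj
    have hjdiv := Nat.div_add_mod (j : ℕ) (h + 1)
    have hjmod : (j : ℕ) % (h + 1) < h + 1 := Nat.mod_lt _ h.succ_pos
    have hquot : k / (h + 1) + 1 ≤ (j : ℕ) / (h + 1) := by
      rw [Nat.le_div_iff_mul_le h.succ_pos]
      nlinarith [show (h + 1) * (k / (h + 1)) + (h + 1) ≤ j by omega]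
    have hstart := Nat.mul_le_mul_left (h + 1) hquot
    rw [Nat.mul_succ] at hstart
    have hb := hend ((j : ℕ) / (h + 1)) j (by omega)
    have key := G.card_adj_lt_le_min (k := k) (a := (h + 1) * ((j : ℕ) / (h + 1)))
      (b := (h + 1) * ((j : ℕ) / (h + 1)) + (h + 1)) (by omega) hb hkn j (by omega)
      (by omega) fun i hi hi' hne => hadj ((j : ℕ) / (h + 1)) j i (by omega) (by omega) hi hi' hne
    rwa [show (h + 1) * ((j : ℕ) / (h + 1)) + (h + 1) - (h + 1) * ((j : ℕ) / (h + 1)) - 1 = h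
      by omega] at key
end

section
/- Let k ≥ 1 be an integer and let G be a simple graph containing two vertex-disjoint subgraphs H_1 and H_2, each of which is a complete graph on 2k+1 vertices. Then there exists a simple graph G' on the same vertex set as G such that deg_{G'}(v) = deg_G(v) for every vertex v; every edge of G with at least one endpoint outside V(H_1) ∪ V(H_2) is an edge of G' and vice versa; and the induced subgraph of G' on V(H_1) ∪ V(H_2) contains a spanning 2k-regular subgraph whose edge set is the disjoint union of 2k perfect matchings of V(H_1) ∪ V(H_2). -/
/-- `M` is a perfect matching of the (even-sized) vertex set `S`: a set of
non-loop edges with both endpoints in `S` such that every vertex of `S` lies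
in exactly one edge of `M`. -/
def IsPerfectMatchingOf {V : Type*} (S : Finset V) (M : Finset (Sym2 V)) : Prop :=
  (∀ e ∈ M, ¬ e.IsDiag ∧ ∀ v ∈ e, v ∈ S) ∧ ∀ v ∈ S, ∃! e, e ∈ M ∧ v ∈ e

/-- In `ZMod (2 * k + 1)` doubling is injective. -/
lemma ZMod.add_self_injective_of_odd (k : ℕ) {x y : ZMod (2 * k + 1)} (h : x + x = y + y) :
    x = y := by
  have hn : (2 * (k : ZMod (2 * k + 1)) + 1) = 0 := by
    exact_mod_cast ZMod.natCast_self (2 * k + 1)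
  linear_combination (x - y) * hn - (k : ZMod (2 * k + 1)) * h

/-- In `ZMod (2 * k + 1)` there are sets closed under negation of every even size up to `2 * k`. -/
lemma ZMod.exists_neg_invariant_card_eq (k s : ℕ) (hs : s ≤ k) :
    ∃ S : Finset (ZMod (2 * k + 1)), S.card = 2 * s ∧ 0 ∉ S ∧ ∀ x, x ∈ S ↔ -x ∈ S := by
  induction s with
  | zero => exact ⟨∅, by simp⟩
  | succ s ih =>
    obtain ⟨S, hcard, h0, hneg⟩ := ih (by omega)
    obtain ⟨x, -, hx⟩ : ∃ x ∈ (Finset.univ : Finset (ZMod (2 * k + 1))), x ∉ insert 0 S := by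
      apply Finset.exists_mem_notMem_of_card_lt_card
      rw [Finset.card_insert_of_notMem h0, hcard, Finset.card_univ, ZMod.card]
      omega
    rw [Finset.mem_insert, not_or] at hx
    have hxn : x ≠ -x := fun h =>
      hx.1 (ZMod.add_self_injective_of_odd k (by linear_combination h))
    refine ⟨insert x (insert (-x) S), ?_, ?_, fun y => ?_⟩
    · rw [Finset.card_insert_of_notMem, Finset.card_insert_of_notMem, hcard]
      · ring
      · rw [← hneg]; exact hx.2
      · simp [hxn, hx.2]
    · simp [h0, hx.1, eq_comm]
    · simp only [Finset.mem_insert, neg_eq_iff_eq_neg, neg_neg, ← hneg y]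
      tauto

lemma ZMod.exists_perm_neg_iff_of_even (k : ℕ) (p : ZMod (2 * k + 1) → Prop) [DecidablePred p]
    (hp : Even (Fintype.card {x // p x})) :
    ∃ σ : Equiv.Perm (ZMod (2 * k + 1)), ∀ x, p (σ x) ↔ p (σ (-x)) := by
  obtain ⟨s, hs⟩ := hp
  have hle := Fintype.card_subtype_le p
  rw [ZMod.card] at hle
  obtain ⟨S, hcard, -, hneg⟩ := ZMod.exists_neg_invariant_card_eq k s (by omega)
  have e : {x // x ∈ S} ≃ {x // p x} :=
    Fintype.equivOfCardEq (by rw [Fintype.card_coe]; omega)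
  have key : ∀ x, p (e.extendSubtype x) ↔ x ∈ S := fun x =>
    ⟨fun h => by_contra fun hx => e.extendSubtype_not_mem x hx h, e.extendSubtype_mem x⟩
  exact ⟨e.extendSubtype, fun x => by rw [key, key, hneg]⟩

/-- A predicate on `ZMod (2 * k + 1)` becomes invariant under negation after a permutation. -/
lemma ZMod.exists_perm_neg_iff (k : ℕ) (p : ZMod (2 * k + 1) → Prop) :
    ∃ σ : Equiv.Perm (ZMod (2 * k + 1)), ∀ x, p (σ x) ↔ p (σ (-x)) := by
  classical
  by_cases hp : Even (Fintype.card {x // p x})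
  · exact ZMod.exists_perm_neg_iff_of_even k p hp
  · obtain ⟨σ, hσ⟩ := ZMod.exists_perm_neg_iff_of_even k (fun x => ¬ p x) (by
      have hle := Fintype.card_subtype_le p
      rw [Fintype.card_subtype_compl]
      rw [ZMod.card] at hle ⊢
      rw [Nat.even_sub hle]
      simp [hp])
    exact ⟨σ, fun x => not_iff_not.mp (hσ x)⟩

/-- The edges `x — φ x` of a fixed-point-free involution form a perfect matching. -/
lemma isPerfectMatchingOf_image_involutive {V ι : Type*} [DecidableEq V] [Fintype ι]
    {S : Finset V} {g : ι → V} (hg : Function.Injective g) (hS : ∀ v, v ∈ S ↔ ∃ i, g i = v)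
    {φ : ι → ι} (hφ : Function.Involutive φ) (hfix : ∀ i, φ i ≠ i) :
    IsPerfectMatchingOf S (Finset.univ.image fun i => s(g i, g (φ i))) := by
  refine ⟨fun e he => ?_, fun v hv => ?_⟩
  · obtain ⟨i, -, rfl⟩ := Finset.mem_image.mp he
    refine ⟨fun h => hfix i (hg (Sym2.mk_isDiag_iff.mp h)).symm, fun v hv => (hS v).mpr ?_⟩
    rcases Sym2.mem_iff.mp hv with rfl | rfl
    exacts [⟨_, rfl⟩, ⟨_, rfl⟩]
  · obtain ⟨i, rfl⟩ := (hS v).mp hv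
    refine ⟨s(g i, g (φ i)),
      ⟨Finset.mem_image_of_mem _ (Finset.mem_univ i), Sym2.mem_mk_left _ _⟩, ?_⟩
    rintro e ⟨he, hie⟩
    obtain ⟨j, -, rfl⟩ := Finset.mem_image.mp he
    rcases Sym2.mem_iff.mp hie with h | h
    · rw [hg h]
    · rw [hg h, hφ j, Sym2.eq_swap]

lemma disjoint_image_involutive {V ι : Type*} [DecidableEq V] [Fintype ι]
    {g : ι → V} (hg : Function.Injective g) {φ ψ : ι → ι} (hψ : Function.Involutive ψ)
    (hne : ∀ i, φ i ≠ ψ i) :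
    Disjoint (Finset.univ.image fun i => s(g i, g (φ i)))
      (Finset.univ.image fun i => s(g i, g (ψ i))) := by
  rw [Finset.disjoint_left]
  intro e he he'
  obtain ⟨i, -, rfl⟩ := Finset.mem_image.mp he
  obtain ⟨j, -, h⟩ := Finset.mem_image.mp he'
  rcases Sym2.eq_iff.mp h with ⟨h₁, h₂⟩ | ⟨h₁, h₂⟩
  · rw [hg h₁] at h₂
    exact hne i (hg h₂).symm
  · apply hne i
    rw [← hg h₂, hψ j]
    exact (hg (h₁.trans (by rw [hg h₂]))).symm

/-- The involution on two copies of `ZMod n` that reflects each copy by `x ↦ c - x` and exchanges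
the two copies of each fixed point of the reflection. -/
def twoCopyReflection {n : ℕ} (c : ZMod n) (i : ZMod n × Bool) : ZMod n × Bool :=
  if i.1 + i.1 = c then (i.1, !i.2) else (c - i.1, i.2)

lemma twoCopyReflection_involutive {n : ℕ} (c : ZMod n) :
    Function.Involutive (twoCopyReflection c) := by
  rintro ⟨x, t⟩
  by_cases h : x + x = c
  · simp [twoCopyReflection, h]
  · have h' : ¬ (c - x + (c - x) = c) := fun h' => h (by linear_combination -h')
    simp [twoCopyReflection, h, h']

lemma twoCopyReflection_ne_self {n : ℕ} (c : ZMod n) (i : ZMod n × Bool) :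
    twoCopyReflection c i ≠ i := by
  obtain ⟨x, t⟩ := i
  by_cases h : x + x = c
  · simp [twoCopyReflection, h]
  · have h' : ¬ (c - x = x) := fun h' => h (by linear_combination -h')
    simp [twoCopyReflection, h, h']

lemma twoCopyReflection_ne {n : ℕ} {c d : ZMod n} (hcd : c ≠ d) (i : ZMod n × Bool) :
    twoCopyReflection c i ≠ twoCopyReflection d i := by
  obtain ⟨x, t⟩ := i
  intro h
  simp only [twoCopyReflection] at h
  split_ifs at h with h₁ h₂ h₂
  · exact hcd (h₁.symm.trans h₂)
  · simpa using congrArg Prod.snd h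
  · simpa using congrArg Prod.snd h
  · exact hcd (by simpa using congrArg Prod.fst h)

/-- The graph obtained from `G` by replacing, for every `i` with `X i`, the edge `g i — g (ρ i)` by
`g i — g (τ i)`, where `ρ` and `τ` are involutions. -/
def SimpleGraph.switch {V ι : Type*} (G : SimpleGraph V) (g : ι → V) (hg : Function.Injective g)
    (X : ι → Prop) (ρ τ : ι → ι) (hρ : Function.Involutive ρ) (hτ : Function.Involutive τ)
    (hXρ : ∀ i, X i → X (ρ i)) (hXτ : ∀ i, X i → X (τ i)) (hfix : ∀ i, τ i ≠ i) :
    SimpleGraph V where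
  Adj u v := (G.Adj u v ∧ ¬ ∃ i, X i ∧ g i = u ∧ g (ρ i) = v) ∨
    ∃ i, X i ∧ g i = u ∧ g (τ i) = v
  symm := ⟨by
    rintro u v (⟨h, h'⟩ | ⟨i, hi, rfl, rfl⟩)
    · refine .inl ⟨h.symm, ?_⟩
      rintro ⟨i, hi, rfl, rfl⟩
      exact h' ⟨ρ i, hXρ i hi, rfl, by rw [hρ]⟩
    · exact .inr ⟨τ i, hXτ i hi, rfl, by rw [hτ]⟩⟩
  loopless := ⟨by
    rintro u (⟨h, -⟩ | ⟨i, -, rfl, h⟩)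
    · exact G.loopless.irrefl u h
    · exact hfix i (hg h)⟩

lemma SimpleGraph.ncard_neighborSet_switch {V ι : Type*} [Finite V] (G : SimpleGraph V)
    (g : ι → V) (hg : Function.Injective g)
    (X : ι → Prop) (ρ τ : ι → ι) (hρ : Function.Involutive ρ) (hτ : Function.Involutive τ)
    (hXρ : ∀ i, X i → X (ρ i)) (hXτ : ∀ i, X i → X (τ i)) (hfix : ∀ i, τ i ≠ i)
    (hadj : ∀ i, X i → G.Adj (g i) (g (ρ i))) (hnadj : ∀ i, X i → ¬ G.Adj (g i) (g (τ i)))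
    (v : V) :
    ((G.switch g hg X ρ τ hρ hτ hXρ hXτ hfix).neighborSet v).ncard =
      (G.neighborSet v).ncard := by
  by_cases hv : ∃ i, X i ∧ g i = v
  · obtain ⟨i, hi, rfl⟩ := hv
    rw [← Set.ncard_exchange (s := G.neighborSet (g i)) (hnadj i hi) (hadj i hi)]
    congr 1
    ext w
    have h₁ : ∀ ρ : ι → ι, (∃ j, X j ∧ g j = g i ∧ g (ρ j) = w) ↔ w = g (ρ i) := fun ρ =>
      ⟨fun ⟨j, _, hj, hw⟩ => by rw [← hw, hg hj], fun hw => ⟨i, hi, rfl, hw.symm⟩⟩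
    simp only [SimpleGraph.mem_neighborSet, SimpleGraph.switch, h₁, Set.mem_insert_iff,
      Set.mem_sdiff, Set.mem_singleton_iff]
    tauto
  · congr 1
    ext w
    have h₁ : ∀ ρ : ι → ι, ¬ ∃ j, X j ∧ g j = v ∧ g (ρ j) = w := fun ρ ⟨j, hj, hjv, _⟩ =>
      hv ⟨j, hj, hjv⟩
    simp only [SimpleGraph.mem_neighborSet, SimpleGraph.switch, h₁, not_false_eq_true, and_true,
      or_false]

/-- Two disjoint sets of size `2 * k + 1` can be indexed by two copies of `ZMod (2 * k + 1)` so
that a relation between corresponding vertices is invariant under negation of the index. -/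
lemma exists_indexing_neg_iff {V : Type*} [DecidableEq V] (k : ℕ) (r : V → V → Prop)
    (A B : Finset V) (hA : A.card = 2 * k + 1) (hB : B.card = 2 * k + 1) (hAB : Disjoint A B) :
    ∃ g : ZMod (2 * k + 1) × Bool → V, Function.Injective g ∧
      (∀ v, v ∈ A ∪ B ↔ ∃ i, g i = v) ∧ (∀ x, g (x, true) ∈ A) ∧ (∀ x, g (x, false) ∈ B) ∧
      ∀ x, r (g (x, true)) (g (x, false)) ↔ r (g (-x, true)) (g (-x, false)) := by
  have a : ZMod (2 * k + 1) ≃ A :=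
    Fintype.equivOfCardEq (by rw [ZMod.card, Fintype.card_coe, hA])
  have b : ZMod (2 * k + 1) ≃ B :=
    Fintype.equivOfCardEq (by rw [ZMod.card, Fintype.card_coe, hB])
  obtain ⟨σ, hσ⟩ := ZMod.exists_perm_neg_iff k fun x => r (a x) (b x)
  refine ⟨fun i => if i.2 then a (σ i.1) else b (σ i.1), ?_, fun v => ?_, ?_, ?_, ?_⟩
  · have hne : ∀ x y, (a x : V) ≠ b y := fun x y h =>
      Finset.disjoint_left.mp hAB (a x).2 (h ▸ (b y).2)
    rintro ⟨x, _ | _⟩ ⟨y, _ | _⟩ h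
    · simpa using h
    · exact absurd h.symm (hne _ _)
    · exact absurd h (hne _ _)
    · simpa using h
  · rw [Finset.mem_union]
    constructor
    · rintro (h | h)
      · exact ⟨(σ.symm (a.symm ⟨v, h⟩), true), by simp⟩
      · exact ⟨(σ.symm (b.symm ⟨v, h⟩), false), by simp⟩
    · rintro ⟨⟨x, _ | _⟩, rfl⟩
      · exact .inr (b _).2
      · exact .inl (a _).2
  · exact fun x => (a _).2
  · exact fun x => (b _).2
  · simpa using hσ

theorem stmt_14 {V : Type*} [Fintype V] [DecidableEq V] (k : ℕ) (hk : 1 ≤ k)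
    (G : SimpleGraph V) (A B : Finset V)
    (hA : A.card = 2 * k + 1) (hB : B.card = 2 * k + 1) (hAB : Disjoint A B)
    (hAclique : ∀ u ∈ A, ∀ v ∈ A, u ≠ v → G.Adj u v)
    (hBclique : ∀ u ∈ B, ∀ v ∈ B, u ≠ v → G.Adj u v) :
    ∃ G' : SimpleGraph V,
      (∀ v, (G'.neighborSet v).ncard = (G.neighborSet v).ncard) ∧
      (∀ u v : V, (u ∉ A ∪ B ∨ v ∉ A ∪ B) → (G.Adj u v ↔ G'.Adj u v)) ∧
      ∃ Ms : Fin (2 * k) → Finset (Sym2 V),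
        (∀ j, IsPerfectMatchingOf (A ∪ B) (Ms j)) ∧
        (∀ j j', j ≠ j' → Disjoint (Ms j) (Ms j')) ∧
        (∀ j, ∀ e ∈ Ms j, e ∈ G'.edgeSet) := by
  obtain ⟨g, hg, hrange, hgA, hgB, hp⟩ := exists_indexing_neg_iff k G.Adj A B hA hB hAB
  have hclique : ∀ x y t, x ≠ y → G.Adj (g (x, t)) (g (y, t)) := by
    rintro x y (_ | _) hxy
    · exact hBclique _ (hgB x) _ (hgB y) (hg.ne (by simpa using hxy))
    · exact hAclique _ (hgA x) _ (hgA y) (hg.ne (by simpa using hxy))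
  have hcross : ∀ x t, G.Adj (g (x, t)) (g (x, !t)) ↔ G.Adj (g (x, true)) (g (x, false)) := by
    rintro x (_ | _)
    · exact G.adj_comm _ _
    · exact Iff.rfl
  have hne_neg : ∀ x : ZMod (2 * k + 1), x ≠ 0 → x ≠ -x := fun x hx h =>
    hx (ZMod.add_self_injective_of_odd k (by linear_combination h))
  let X : ZMod (2 * k + 1) × Bool → Prop := fun i =>
    i.1 ≠ 0 ∧ ¬ G.Adj (g (i.1, true)) (g (i.1, false))
  let G' := G.switch g hg X (fun i => (-i.1, i.2)) (fun i => (i.1, !i.2))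
    (fun i => by simp) (fun i => by simp)
    (fun i hi => ⟨neg_ne_zero.mpr hi.1, fun h => hi.2 ((hp i.1).mpr h)⟩) (fun i hi => hi)
    (fun i h => by simpa using congrArg Prod.snd h)
  refine ⟨G', fun v => ?_, fun u v huv => ?_, fun j => Finset.univ.image fun i =>
    s(g i, g (twoCopyReflection ((j.val + 1 : ℕ) : ZMod (2 * k + 1)) i)), fun j => ?_,
    fun j j' hj => ?_, fun j e he => ?_⟩
  · exact G.ncard_neighborSet_switch g hg X _ _ _ _ _ _ _
      (fun i hi => hclique _ _ _ (hne_neg _ hi.1)) (fun i hi => by rw [hcross]; exact hi.2) v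
  · have h₁ : ∀ ρ : ZMod (2 * k + 1) × Bool → ZMod (2 * k + 1) × Bool,
        ¬ ∃ i, X i ∧ g i = u ∧ g (ρ i) = v := by
      rintro ρ ⟨i, -, rfl, rfl⟩
      exact huv.elim (fun h => h ((hrange _).mpr ⟨_, rfl⟩)) fun h => h ((hrange _).mpr ⟨_, rfl⟩)
    simp only [G', SimpleGraph.switch, h₁, not_false_eq_true, and_true, or_false]
  · exact isPerfectMatchingOf_image_involutive hg hrange (twoCopyReflection_involutive _)
      (twoCopyReflection_ne_self _)
  · refine disjoint_image_involutive hg (twoCopyReflection_involutive _)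
      (twoCopyReflection_ne fun h => hj (Fin.ext ?_))
    rw [ZMod.natCast_eq_natCast_iff', Nat.mod_eq_of_lt (by omega),
      Nat.mod_eq_of_lt (by omega)] at h
    omega
  · obtain ⟨⟨x, t⟩, -, rfl⟩ := Finset.mem_image.mp he
    have hc : ((j.val + 1 : ℕ) : ZMod (2 * k + 1)) ≠ 0 := fun h => by
      rw [ZMod.natCast_eq_zero_iff] at h
      have := Nat.le_of_dvd (by omega) h
      omega
    generalize ((j.val + 1 : ℕ) : ZMod (2 * k + 1)) = c at hc
    rw [SimpleGraph.mem_edgeSet]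
    by_cases h : x + x = c
    · have hx : x ≠ 0 := by
        rintro rfl
        exact hc (by simpa using h.symm)
      rw [twoCopyReflection, if_pos h]
      by_cases hpx : G.Adj (g (x, true)) (g (x, false))
      · refine .inl ⟨(hcross x t).mpr hpx, ?_⟩
        rintro ⟨i, hi, hi₁, hi₂⟩
        rw [hg hi₁] at hi
        exact hi.2 hpx
      · exact .inr ⟨(x, t), ⟨hx, hpx⟩, rfl, rfl⟩
    · rw [twoCopyReflection, if_neg h]
      refine .inl ⟨hclique _ _ _ fun h' => h (by linear_combination h'), ?_⟩
      rintro ⟨i, -, hi₁, hi₂⟩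
      rw [hg hi₁] at hi₂
      have := congrArg Prod.fst (hg hi₂)
      exact hc (by linear_combination -this)
end

section
/- Let n > 2 be an even integer, let d* = ⌊(√2 − 1/n − 1/2)·n⌋ and k* = ⌊(d* + n/2 + 1)/2⌋, and let π* = (d_1, …, d_n) be the weakly decreasing sequence whose first k* entries equal d* and whose remaining n − k* entries equal n/2. Then π* satisfies the Erdős–Gallai inequalities: for every k ∈ [n], Σ_{i=1}^k d_i ≤ k(k−1) + Σ_{i=k+1}^n min{d_i, k}. -/
/-- `d* = ⌊(√2 − 1/n − 1/2)·n⌋`. -/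
noncomputable def dstar (n : ℕ) : ℕ :=
  ⌊(Real.sqrt 2 - 1 / (n : ℝ) - 1 / 2) * (n : ℝ)⌋₊

/-- `k* = ⌊(d* + n/2 + 1)/2⌋`. -/
noncomputable def kstar (n : ℕ) : ℕ := (dstar n + n / 2 + 1) / 2

/-- The sequence `π*`: the first `k*` entries equal `d*`, the remaining
`n − k*` entries equal `n/2`. -/
noncomputable def piStar (n : ℕ) : Fin n → ℕ :=
  fun i => if (i : ℕ) < kstar n then dstar n else n / 2

theorem sum_range_ite_lt (a b K j : ℕ) :
    ∑ i ∈ Finset.range j, (if i < K then a else b) = min j K * a + (j - K) * b := by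
  induction j with
  | zero => simp
  | succ j ih =>
    rw [Finset.sum_range_succ, ih]
    split_ifs with h
    · rw [min_eq_left h.le, min_eq_left (by omega), Nat.sub_eq_zero_of_le h.le,
        Nat.sub_eq_zero_of_le (by omega)]
      ring
    · rw [min_eq_right (by omega), min_eq_right (by omega), Nat.succ_sub (by omega)]
      simp only [Nat.succ_eq_add_one]
      ring

theorem Fin.sum_filter_lt (n k : ℕ) (hk : k ≤ n) (f : ℕ → ℕ) :
    ∑ i ∈ Finset.univ.filter (fun i : Fin n => (i : ℕ) < k), f i = ∑ i ∈ Finset.range k, f i := by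
  rw [Finset.sum_filter, Fin.sum_univ_eq_sum_range (fun i => if i < k then f i else 0) n,
    ← Finset.sum_filter]
  congr 1
  ext i
  simp only [Finset.mem_filter, Finset.mem_range]
  omega

theorem Fin.sum_filter_le (n k : ℕ) (f : ℕ → ℕ) :
    ∑ i ∈ Finset.univ.filter (fun i : Fin n => k ≤ (i : ℕ)), f i = ∑ i ∈ Finset.Ico k n, f i := by
  rw [Finset.sum_filter, Fin.sum_univ_eq_sum_range (fun i => if k ≤ i then f i else 0) n,
    ← Finset.sum_filter]
  congr 1
  ext i
  simp only [Finset.mem_filter, Finset.mem_range, Finset.mem_Ico]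
  omega

theorem dstar_two_mul_sq_le (m : ℕ) (hm : 2 ≤ m) : (dstar (2 * m) + m + 1) ^ 2 ≤ 8 * m ^ 2 := by
  have hmR : (2 : ℝ) ≤ m := by exact_mod_cast hm
  have hs : (1.4 : ℝ) ≤ √2 := Real.le_sqrt_of_sq_le (by norm_num)
  have hs2 : √2 ^ 2 = (2 : ℝ) := Real.sq_sqrt (by norm_num)
  have hx : (√2 - 1 / ((2 * m : ℕ) : ℝ) - 1 / 2) * ((2 * m : ℕ) : ℝ) = 2 * √2 * m - 1 - m := by
    push_cast
    field_simp
  have h : (dstar (2 * m) : ℝ) ≤ 2 * √2 * m - 1 - m := by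
    rw [← hx]
    exact Nat.floor_le (by rw [hx]; nlinarith)
  have h' : ((dstar (2 * m) : ℝ) + m + 1) ^ 2 ≤ 8 * m ^ 2 := by
    calc ((dstar (2 * m) : ℝ) + m + 1) ^ 2 ≤ (2 * √2 * m) ^ 2 := by
          gcongr
          linarith
      _ = 4 * √2 ^ 2 * m ^ 2 := by ring
      _ = 8 * m ^ 2 := by rw [hs2]; ring
  exact_mod_cast h'

theorem le_dstar_two_mul (m : ℕ) (hm : 2 ≤ m) : m ≤ dstar (2 * m) := by
  have hmR : (2 : ℝ) ≤ m := by exact_mod_cast hm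
  have hs : (1.4 : ℝ) ≤ √2 := Real.le_sqrt_of_sq_le (by norm_num)
  have hx : (√2 - 1 / ((2 * m : ℕ) : ℝ) - 1 / 2) * ((2 * m : ℕ) : ℝ) = 2 * √2 * m - 1 - m := by
    push_cast
    field_simp
  unfold dstar
  rw [hx]
  apply Nat.le_floor
  nlinarith

/-- The Erdős–Gallai inequalities for a sequence of length `2 * m` with `K` entries equal to `d`
followed by entries equal to `m`, where `K = ⌊(d + m + 1) / 2⌋` and `d + m + 1 ≤ √8 * m`. -/
theorem erdosGallai_two_values (m d K k : ℕ) (hmd : m ≤ d) (hsq : (d + m + 1) ^ 2 ≤ 8 * m ^ 2)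
    (hK : K = (d + m + 1) / 2) (hk : 1 ≤ k) (hkn : k ≤ 2 * m) :
    ∑ i ∈ Finset.range k, (if i < K then d else m) ≤
      k * (k - 1) + ∑ i ∈ Finset.Ico k (2 * m), min (if i < K then d else m) k := by
  have hs : d + m + 1 ≤ 3 * m := by nlinarith
  have hKm : m ≤ K := by omega
  have hKd : K ≤ d := by omega
  have hmain : (K : ℤ) * (d + m + 1 - K) ≤ 2 * m ^ 2 := by
    have h : ((d : ℤ) + m + 1) ^ 2 ≤ 8 * m ^ 2 := by exact_mod_cast hsq
    nlinarith [sq_nonneg ((d : ℤ) + m + 1 - 2 * K)]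
  have hmin : ∀ i, min (if i < K then d else m) k = if i < K then min d k else min m k :=
    fun i => apply_ite (min · k) _ _ _
  have htail := Finset.sum_range_add_sum_Ico (fun i => if i < K then min d k else min m k) hkn
  simp only [hmin]
  rw [sum_range_ite_lt, sum_range_ite_lt, min_eq_right (by omega : K ≤ 2 * m)] at htail
  rw [sum_range_ite_lt]
  generalize ∑ i ∈ Finset.Ico k (2 * m), (if i < K then min d k else min m k) = T at htail ⊢
  obtain ⟨j, rfl⟩ : ∃ j, k = j + 1 := ⟨k - 1, by omega⟩
  rw [Nat.add_sub_cancel]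
  obtain ⟨r, hr⟩ : ∃ r, 2 * m = K + r := ⟨2 * m - K, by omega⟩
  have hrK : 2 * m - K = r := by omega
  rw [hrK] at htail
  have hrZ : (2 * m : ℤ) = K + r := by exact_mod_cast hr
  rcases le_or_gt (j + 1) K with hkK | hkK
  · rw [min_eq_left hkK, Nat.sub_eq_zero_of_le hkK] at htail ⊢
    rw [min_eq_right (hkK.trans hKd)] at htail
    rcases le_or_gt (j + 1) m with hkm | hkm
    · rw [min_eq_right hkm] at htail
      have hd : d + 1 ≤ K + r := by omega
      nlinarith [Nat.mul_le_mul_left (j + 1) hd]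
    · rw [min_eq_left hkm.le] at htail
      zify at *
      rw [show (r : ℤ) = 2 * m - K by linarith] at htail
      have h1 : ((j : ℤ) + 1) * (d + 1 - K) ≤ K * (d + 1 - K) :=
        mul_le_mul_of_nonneg_right hkK (by linarith)
      nlinarith
  · obtain ⟨t, ht⟩ : ∃ t, j + 1 = K + t := ⟨j + 1 - K, by omega⟩
    have htK : j + 1 - K = t := by omega
    rw [min_eq_right hkK.le, htK] at htail ⊢
    rw [min_eq_left (by omega : m ≤ j + 1)] at htail
    have ht1 : 1 ≤ t := by omega
    zify at *
    rw [show (r : ℤ) = 2 * m - K by linarith] at htail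
    rw [show (j : ℤ) = K + t - 1 by linarith]
    have h1 : (0 : ℤ) ≤ t * (K - m) := mul_nonneg (by linarith) (by linarith)
    have h2 : (0 : ℤ) ≤ t * (t - 1) := mul_nonneg (by linarith) (by linarith)
    nlinarith

/-- `π*` satisfies the Erdős–Gallai inequalities. -/
theorem stmt_15 {n : ℕ} (hn : 2 < n) (hne : Even n) :
    ∀ k : ℕ, 1 ≤ k → k ≤ n →
      (∑ i ∈ Finset.univ.filter (fun i : Fin n => (i : ℕ) < k), piStar n i) ≤
        k * (k - 1) +
          ∑ i ∈ Finset.univ.filter (fun i : Fin n => k ≤ (i : ℕ)),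
            min (piStar n i) k := by
  intro k hk hkn
  obtain ⟨m, rfl⟩ := hne.exists_two_nsmul
  rw [smul_eq_mul] at *
  have hhalf : 2 * m / 2 = m := by omega
  unfold piStar
  rw [hhalf,
    Fin.sum_filter_lt _ k hkn (fun i => if i < kstar (2 * m) then dstar (2 * m) else m),
    Fin.sum_filter_le _ k (fun i => min (if i < kstar (2 * m) then dstar (2 * m) else m) k)]
  exact erdosGallai_two_values m _ _ k (le_dstar_two_mul m (by omega))
    (dstar_two_mul_sq_le m (by omega)) (by rw [kstar, hhalf]) hk hkn
end

section
/- Let n ≥ 20 be an even integer such that α := n(√2 − 1/n − 1/2) − ⌊n(√2 − 1/n − 1/2)⌋ satisfies α ≤ 1/4. Let d* = ⌊(√2 − 1/n − 1/2)·n⌋, k* = ⌊(d* + n/2 + 1)/2⌋, and let π* = (d_1, …, d_n) be the sequence whose first k* entries equal d* and whose remaining n − k* entries equal n/2. Then π* fails condition (*) at k = k*; consequently π* cannot realize M⁺ = {(1,2), (3,4), …, (n−1,n)}. Explicitly: k*·d* > k*(k*−1) + min{d_{k*+1}, k*}·[k* odd] + Σ_{i=k*+1+[k* odd]}^n min{d_i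 − 1, k*}. -/
open Finset in
/-- The necessity of condition (*) for realizing `M⁺`. -/
theorem RealizesMplus.sum_le {n : ℕ} {d : Fin n → ℕ} (h : RealizesMplus d) (k : ℕ) :
    ∑ i ∈ univ.filter (fun i : Fin n => (i : ℕ) < k), d i ≤
      k * (k - 1) +
        (if Odd k then ∑ i ∈ univ.filter (fun i : Fin n => (i : ℕ) = k), min (d i) k else 0) +
        ∑ i ∈ univ.filter (fun i : Fin n => k + (if Odd k then 1 else 0) ≤ (i : ℕ)),
          min (d i - 1) k := by
  classical
  obtain ⟨G, hdeg, hM⟩ := h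
  set A : Finset (Fin n) := univ.filter (fun i : Fin n => (i : ℕ) < k) with hA
  have hAk : #A ≤ k := by
    rw [hA, Fin.card_filter_val_lt]
    exact min_le_right _ _
  have hcard (i : Fin n) : #(univ.filter (G.Adj i)) = d i := by
    rw [← hdeg i, ← Set.ncard_coe_finset]
    congr 1
    ext j
    simp
  have hsplit (i : Fin n) : d i = #(A.filter (G.Adj i)) + #(Aᶜ.filter (G.Adj i)) := by
    rw [← hcard i, ← card_union_of_disjoint
      (disjoint_filter_filter disjoint_compl_right), ← filter_union, union_compl]
  have hinner : ∑ i ∈ A, #(A.filter (G.Adj i)) ≤ k * (k - 1) := by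
    calc ∑ i ∈ A, #(A.filter (G.Adj i)) ≤ ∑ _i ∈ A, (k - 1) := by
          refine sum_le_sum fun i hi => ?_
          have hsub : A.filter (G.Adj i) ⊆ A.erase i := by
            intro j hj
            rw [mem_filter] at hj
            exact mem_erase.2 ⟨hj.2.ne', hj.1⟩
          have := card_le_card hsub
          rw [card_erase_of_mem hi] at this
          omega
      _ ≤ k * (k - 1) := by
          rw [sum_const, smul_eq_mul]
          exact Nat.mul_le_mul_right _ hAk
  have hcross : ∑ i ∈ A, #(Aᶜ.filter (G.Adj i)) = ∑ j ∈ Aᶜ, #(A.filter (G.Adj j)) := by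
    rw [show ∑ j ∈ Aᶜ, #(A.filter (G.Adj j)) = ∑ j ∈ Aᶜ, #(A.filter (G.Adj · j)) by
      simp only [G.adj_comm]]
    exact sum_card_bipartiteAbove_eq_sum_card_bipartiteBelow G.Adj
  have hle (j : Fin n) : #(A.filter (G.Adj j)) ≤ min (d j) k :=
    le_min (by have := hsplit j; omega) ((card_filter_le _ _).trans hAk)
  have hle_pred (j : Fin n) (hj : k + (if Odd k then 1 else 0) ≤ (j : ℕ)) :
      #(A.filter (G.Adj j)) ≤ min (d j - 1) k := by
    refine le_min ?_ ((card_filter_le _ _).trans hAk)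
    obtain ⟨l, hl, hkl⟩ : ∃ l, G.Adj j l ∧ k ≤ (l : ℕ) := by
      rcases Nat.mod_two_eq_zero_or_one j with hj2 | hj2
      · obtain ⟨h1, h2⟩ := hM j hj2
        refine ⟨_, h2, ?_⟩
        simp only
        omega
      · obtain ⟨h1, h2⟩ := hM ⟨j - 1, by omega⟩ (by simp only; omega)
        refine ⟨⟨j - 1, by omega⟩, ?_, ?_⟩
        · convert h2.symm
          simp only
          omega
        · simp only
          split_ifs at hj with hk
          · omega
          · rw [Nat.not_odd_iff] at hk
            omega
    have hpos : 0 < #(Aᶜ.filter (G.Adj j)) :=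
      card_pos.2 ⟨l, by simp [hA, hl, hkl]⟩
    have := hsplit j
    omega
  have houter : ∑ j ∈ Aᶜ, #(A.filter (G.Adj j)) ≤
      (if Odd k then ∑ i ∈ univ.filter (fun i : Fin n => (i : ℕ) = k), min (d i) k else 0) +
        ∑ i ∈ univ.filter (fun i : Fin n => k + (if Odd k then 1 else 0) ≤ (i : ℕ)),
          min (d i - 1) k := by
    have hpred := sum_le_sum fun j
      (hj : j ∈ univ.filter (fun i : Fin n => k + (if Odd k then 1 else 0) ≤ (i : ℕ))) =>
      hle_pred j (mem_filter.1 hj).2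
    by_cases hk : Odd k
    · simp only [if_pos hk] at hpred ⊢
      have hAc : Aᶜ = univ.filter (fun i : Fin n => (i : ℕ) = k) ∪
          univ.filter (fun i : Fin n => k + 1 ≤ (i : ℕ)) := by
        ext i
        simp only [hA, mem_compl, mem_filter, mem_univ, true_and, mem_union]
        omega
      rw [hAc, sum_union (disjoint_filter.2 fun i _ h1 h2 => by omega)]
      exact add_le_add (sum_le_sum fun j _ => hle j) hpred
    · simp only [if_neg hk, add_zero, zero_add] at hpred ⊢
      have hAc : Aᶜ = univ.filter (fun i : Fin n => k ≤ (i : ℕ)) := by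
        ext i
        simp [hA]
      rwa [hAc]
  calc ∑ i ∈ A, d i = ∑ i ∈ A, #(A.filter (G.Adj i)) + ∑ i ∈ A, #(Aᶜ.filter (G.Adj i)) := by
        rw [← sum_add_distrib]
        exact sum_congr rfl fun i _ => hsplit i
    _ ≤ _ := by
        rw [hcross, add_assoc]
        exact add_le_add hinner houter

/-- With `n = 2m`, the number `s = d* + m + 1` is `⌊2√2 m⌋`, and the bound on the fractional part
becomes a quadratic inequality. -/
theorem dstar_bounds {n m : ℕ} (hn : 20 ≤ n) (hm : n = m + m)
    (hα : Int.fract ((Real.sqrt 2 - 1 / (n : ℝ) - 1 / 2) * (n : ℝ)) ≤ 1 / 4) :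
    (dstar n + m + 1) ^ 2 ≤ 8 * m ^ 2 ∧ 128 * m ^ 2 ≤ (4 * (dstar n + m + 1) + 1) ^ 2 := by
  have hm0 : (10 : ℝ) ≤ m := by exact_mod_cast (by omega : 10 ≤ m)
  have hx : (Real.sqrt 2 - 1 / (n : ℝ) - 1 / 2) * (n : ℝ) = Real.sqrt 2 * (2 * m) - 1 - m := by
    have : (n : ℝ) = 2 * m := by rw [hm]; push_cast; ring
    rw [this]
    field_simp
  have h2 : (1.4 : ℝ) ≤ Real.sqrt 2 := Real.le_sqrt_of_sq_le (by norm_num)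
  have hsq : Real.sqrt 2 ^ 2 = 2 := Real.sq_sqrt (by norm_num)
  have hx0 : 0 ≤ Real.sqrt 2 * (2 * m) - 1 - m := by nlinarith
  rw [hx] at hα
  have hd : ((dstar n : ℕ) : ℝ) = (⌊Real.sqrt 2 * (2 * m) - 1 - m⌋ : ℝ) := by
    rw [dstar, hx]
    exact natCast_floor_eq_intCast_floor hx0
  have hfl := Int.floor_add_fract (Real.sqrt 2 * (2 * m) - 1 - m)
  have hfr := Int.fract_nonneg (Real.sqrt 2 * (2 * m) - 1 - m)
  rw [← hd] at hfl
  have hlow : (dstar n : ℝ) + m + 1 ≤ Real.sqrt 2 * (2 * m) := by linarith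
  have hup : Real.sqrt 2 * (8 * m) ≤ 4 * ((dstar n : ℝ) + m + 1) + 1 := by linarith
  have e1 : (Real.sqrt 2 * (2 * m)) ^ 2 = 8 * (m : ℝ) ^ 2 := by rw [mul_pow, hsq]; ring
  have e2 : (Real.sqrt 2 * (8 * m)) ^ 2 = 128 * (m : ℝ) ^ 2 := by rw [mul_pow, hsq]; ring
  constructor
  · have := pow_le_pow_left₀ (by positivity) hlow 2
    rw [e1] at this
    exact_mod_cast this
  · have := pow_le_pow_left₀ (by positivity) hup 2
    rw [e2] at this
    exact_mod_cast this

theorem lt_mul_of_bounds {n m k d : ℕ} (hm0 : 10 ≤ m)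
    (hup : 128 * m ^ 2 ≤ (4 * (d + m + 1) + 1) ^ 2)
    (hs : 10000 * (d + m + 1) ≤ 28285 * m)
    (hk : d + m + 1 = 2 * k ∨ d + m + 1 = 2 * k + 1) (hm : n = m + m) (hmk : m ≤ k)
    (hkn : k < n) :
    k * (k - 1) + (n - k) * (m - 1) + 1 < k * d := by
  subst hm
  zify [hkn.le, (by omega : 1 ≤ k), (by omega : 1 ≤ m)] at *
  rcases hk with h | h
  · have hd : (d : ℤ) = 2 * k - m - 1 := by linarith
    rw [hd] at hup hs ⊢
    nlinarith
  · have hd : (d : ℤ) = 2 * k - m := by linarith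
    rw [hd] at hup hs ⊢
    nlinarith

/-- `π*` fails condition (*) at `k = k*`, and consequently cannot realize
`M⁺`. -/
theorem stmt_16 {n : ℕ} (hn : 20 ≤ n) (hne : Even n)
    (hα : Int.fract ((Real.sqrt 2 - 1 / (n : ℝ) - 1 / 2) * (n : ℝ)) ≤ 1 / 4) :
    (kstar n * (kstar n - 1) +
        (if Odd (kstar n) then
          ∑ i ∈ Finset.univ.filter (fun i : Fin n => (i : ℕ) = kstar n),
            min (piStar n i) (kstar n)
        else 0) +
        (∑ i ∈ Finset.univ.filter
            (fun i : Fin n =>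
              kstar n + (if Odd (kstar n) then 1 else 0) ≤ (i : ℕ)),
          min (piStar n i - 1) (kstar n))
      < kstar n * dstar n) ∧
    ¬ RealizesMplus (piStar n) := by
  obtain ⟨m, hm⟩ := hne
  obtain ⟨hlow, hup⟩ := dstar_bounds hn hm hα
  have hhalf : n / 2 = m := by omega
  have hks : kstar n = (dstar n + m + 1) / 2 := by rw [kstar, hhalf]
  have hpi (i : Fin n) : piStar n i = if (i : ℕ) < kstar n then dstar n else m := by
    rw [piStar, hhalf]
  simp only [hpi]
  have hs_up : 10000 * (dstar n + m + 1) ≤ 28285 * m := by nlinarith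
  have hs_low : 2 * m + 2 ≤ dstar n + m + 1 := by nlinarith
  have hmk : m ≤ kstar n := by omega
  have hkn : kstar n < n := by omega
  have hk2 : dstar n + m + 1 = 2 * kstar n ∨ dstar n + m + 1 = 2 * kstar n + 1 := by omega
  have hsum_le (c : ℕ) (hc : kstar n ≤ c) (hcn : c ≤ n) :
      ∑ i ∈ Finset.univ.filter (fun i : Fin n => c ≤ (i : ℕ)),
        min ((if (i : ℕ) < kstar n then dstar n else m) - 1) (kstar n) = (n - c) * (m - 1) := by
    have hcard : (Finset.univ.filter (fun i : Fin n => c ≤ (i : ℕ))).card = n - c := by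
      have h := Finset.card_filter_add_card_filter_not (s := (Finset.univ : Finset (Fin n)))
        (fun i => (i : ℕ) < c)
      simp only [not_lt, Fin.card_filter_val_lt, Finset.card_univ, Fintype.card_fin] at h
      omega
    rw [← hcard, ← smul_eq_mul, ← Finset.sum_const]
    refine Finset.sum_congr rfl fun i hi => ?_
    have := (Finset.mem_filter.1 hi).2
    rw [if_neg (by omega)]
    omega
  have hsum_eq : ∑ i ∈ Finset.univ.filter (fun i : Fin n => (i : ℕ) = kstar n),
      min (if (i : ℕ) < kstar n then dstar n else m) (kstar n) = m := by
    rw [show Finset.univ.filter (fun i : Fin n => (i : ℕ) = kstar n) = {⟨kstar n, hkn⟩} by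
      ext i
      simp [Fin.ext_iff], Finset.sum_singleton]
    simp [hmk]
  have hmain : kstar n * (kstar n - 1) + (n - kstar n) * (m - 1) + 1 < kstar n * dstar n := by
    exact lt_mul_of_bounds (by omega) hup hs_up hk2 hm hmk hkn
  have hfail : kstar n * (kstar n - 1) +
        (if Odd (kstar n) then
          ∑ i ∈ Finset.univ.filter (fun i : Fin n => (i : ℕ) = kstar n),
            min (if (i : ℕ) < kstar n then dstar n else m) (kstar n)
        else 0) +
        (∑ i ∈ Finset.univ.filter
            (fun i : Fin n =>
              kstar n + (if Odd (kstar n) then 1 else 0) ≤ (i : ℕ)),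
          min ((if (i : ℕ) < kstar n then dstar n else m) - 1) (kstar n))
      < kstar n * dstar n := by
    by_cases hk : Odd (kstar n)
    · simp only [if_pos hk]
      rw [hsum_eq, hsum_le _ (by omega) (by omega)]
      obtain ⟨a, ha⟩ : ∃ a, n - kstar n = a + 1 := ⟨n - kstar n - 1, by omega⟩
      rw [ha, add_mul] at hmain
      rw [show n - (kstar n + 1) = a by omega]
      omega
    · simp only [if_neg hk, add_zero]
      rw [hsum_le _ le_rfl hkn.le]
      omega
  refine ⟨hfail, fun hreal => ?_⟩
  have h := hreal.sum_le (kstar n)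
  simp only [hpi] at h
  have hLHS : ∑ i ∈ Finset.univ.filter (fun i : Fin n => (i : ℕ) < kstar n),
      (if (i : ℕ) < kstar n then dstar n else m) = kstar n * dstar n := by
    rw [Finset.sum_congr rfl fun i hi => if_pos (Finset.mem_filter.1 hi).2, Finset.sum_const,
      Fin.card_filter_val_lt, min_eq_right hkn.le, smul_eq_mul]
  omega
end

section
/- Let (d_1, d_2, d_3, d_4, d_5) be a weakly decreasing sequence of non-negative integers. There exists a graph G on vertex set [5] with deg_G(i) = d_i for all i containing the 5-cycle C with edge set {(1,3),(3,5),(4,5),(2,4),(1,2)} if and only if there exists a graph G' on [5] with deg_{G'}(i) = d_i for all i containing the 5-cycle C' with edge set {(1,2),(2,3),(3,5),(4,5),(1,4)}. -/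
/-- The 5-cycle `C` visiting (1-indexed) vertices 1,3,5,4,2 in order,
0-indexed: edges {0,2},{2,4},{4,3},{3,1},{1,0}. -/
def C5a : Set (Sym2 (Fin 5)) :=
  {s((0 : Fin 5), (2 : Fin 5)), s((2 : Fin 5), (4 : Fin 5)),
   s((4 : Fin 5), (3 : Fin 5)), s((3 : Fin 5), (1 : Fin 5)),
   s((1 : Fin 5), (0 : Fin 5))}

/-- The 5-cycle `C'` visiting (1-indexed) vertices 1,2,3,5,4 in order,
0-indexed: edges {0,1},{1,2},{2,4},{4,3},{3,0}. -/
def C5b : Set (Sym2 (Fin 5)) :=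
  {s((0 : Fin 5), (1 : Fin 5)), s((1 : Fin 5), (2 : Fin 5)),
   s((2 : Fin 5), (4 : Fin 5)), s((4 : Fin 5), (3 : Fin 5)),
   s((3 : Fin 5), (0 : Fin 5))}

/-- In a graph containing the 5-cycle `σ 0, σ 1, …, σ 4`, the degree of `σ i` is `2` plus the number
of chords at `σ i`. -/
lemma ncard_neighborSet_of_cycle {V : Type*} (σ : Fin 5 ≃ V) (G : SimpleGraph V)
    [DecidableRel G.Adj] (h : ∀ i, G.Adj (σ i) (σ (i + 1))) (i : Fin 5) :
    (G.neighborSet (σ i)).ncard =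
      2 + (decide (G.Adj (σ i) (σ (i + 2)))).toNat
        + (decide (G.Adj (σ (i + 3)) (σ (i + 3 + 2)))).toNat := by
  have himage : G.neighborSet (σ i) =
      (fun k => σ (i + k)) '' {k | G.Adj (σ i) (σ (i + k))} := by
    ext v
    simp only [SimpleGraph.mem_neighborSet, Set.mem_image, Set.mem_ofPred_eq]
    constructor
    · intro hv
      exact ⟨σ.symm v - i, by simpa using hv, by simp⟩
    · rintro ⟨k, hk, rfl⟩
      exact hk
  have hinj : Function.Injective fun k => σ (i + k) :=
    σ.injective.comp (add_right_injective i)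
  have hprev : G.Adj (σ i) (σ (i + 4)) := by
    have := (h (i + 4)).symm
    rwa [add_assoc, show (4 + 1 : Fin 5) = 0 from rfl, add_zero] at this
  have hchord : G.Adj (σ (i + 3)) (σ (i + 3 + 2)) ↔ G.Adj (σ i) (σ (i + 3)) := by
    rw [add_assoc, show (3 + 2 : Fin 5) = 0 from rfl, add_zero, G.adj_comm]
  have hset : {k | G.Adj (σ i) (σ (i + k))} =
      ((Finset.univ.filter fun k => G.Adj (σ i) (σ (i + k)) : Finset (Fin 5)) :
        Set (Fin 5)) := by
    simp
  rw [himage, Set.ncard_image_of_injective _ hinj, hset, Set.ncard_coe_finset,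
    Finset.card_filter, Fin.sum_univ_five]
  simp only [hchord, add_zero, SimpleGraph.irrefl, h i, hprev, if_true, if_false,
    Bool.toNat, Bool.cond_decide]
  ring

/-- The degree sequence of the 5-cycle `σ 0, σ 1, …, σ 4` together with those chords
`{σ i, σ (i + 2)}` for which `x i` is true. -/
def cycleWithChordsDegree {V : Type*} (σ : Fin 5 ≃ V) (x : Fin 5 → Bool) (v : V) : ℕ :=
  2 + (x (σ.symm v)).toNat + (x (σ.symm v + 3)).toNat

/-- The degree sequences of graphs on five vertices containing a given 5-cycle, parametrized by the
set of chords present. -/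
lemma exists_graph_with_cycle_iff {V : Type*} (σ : Fin 5 ≃ V) (d : V → ℕ) :
    (∃ G : SimpleGraph V, (∀ v, (G.neighborSet v).ncard = d v) ∧
        ∀ i, G.Adj (σ i) (σ (i + 1))) ↔
      ∃ x : Fin 5 → Bool, ∀ v, d v = cycleWithChordsDegree σ x v := by
  classical
  constructor
  · rintro ⟨G, hdeg, hcycle⟩
    exact ⟨fun i => decide (G.Adj (σ i) (σ (i + 2))), fun v => by
      obtain ⟨i, rfl⟩ := σ.surjective v
      rw [← hdeg, ncard_neighborSet_of_cycle σ G hcycle, cycleWithChordsDegree,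
        Equiv.symm_apply_apply]⟩
  · rintro ⟨x, hx⟩
    let H : SimpleGraph (Fin 5) :=
      SimpleGraph.fromRel fun i j => j = i + 1 ∨ (j = i + 2 ∧ x i = true)
    have hcycle : ∀ i, (H.comap σ.symm).Adj (σ i) (σ (i + 1)) := by
      intro i
      simp [H]
    have hchord : ∀ i, (H.comap σ.symm).Adj (σ i) (σ (i + 2)) ↔ x i = true := by
      intro i
      simp only [H, SimpleGraph.comap_adj, Equiv.symm_apply_apply, SimpleGraph.fromRel_adj]
      fin_cases i <;> simp
    refine ⟨H.comap σ.symm, fun v => ?_, hcycle⟩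
    obtain ⟨i, rfl⟩ := σ.surjective v
    rw [ncard_neighborSet_of_cycle σ _ hcycle, hx, cycleWithChordsDegree,
      Equiv.symm_apply_apply]
    simp only [hchord, Bool.decide_eq_true]

/-- The order in which `C5a` visits the vertices. -/
def cycleOrderA : Fin 5 ≃ Fin 5 :=
  ⟨![0, 2, 4, 3, 1], ![0, 4, 1, 3, 2], by decide, by decide⟩

/-- The order in which `C5b` visits the vertices. -/
def cycleOrderB : Fin 5 ≃ Fin 5 :=
  ⟨![0, 1, 2, 4, 3], ![0, 1, 2, 4, 3], by decide, by decide⟩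

lemma C5a_subset_edgeSet_iff (G : SimpleGraph (Fin 5)) :
    C5a ⊆ G.edgeSet ↔ ∀ i, G.Adj (cycleOrderA i) (cycleOrderA (i + 1)) := by
  simp [C5a, Set.insert_subset_iff, Fin.forall_fin_succ, cycleOrderA]

lemma C5b_subset_edgeSet_iff (G : SimpleGraph (Fin 5)) :
    C5b ⊆ G.edgeSet ↔ ∀ i, G.Adj (cycleOrderB i) (cycleOrderB (i + 1)) := by
  simp [C5b, Set.insert_subset_iff, Fin.forall_fin_succ, cycleOrderB]

lemma exists_cycleOrderB_degree_eq : ∀ x : Fin 5 → Bool,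
    Antitone (cycleWithChordsDegree cycleOrderA x) →
      ∃ y : Fin 5 → Bool, ∀ v,
        cycleWithChordsDegree cycleOrderA x v = cycleWithChordsDegree cycleOrderB y v := by
  unfold Antitone
  decide +kernel

lemma exists_cycleOrderA_degree_eq : ∀ x : Fin 5 → Bool,
    Antitone (cycleWithChordsDegree cycleOrderB x) →
      ∃ y : Fin 5 → Bool, ∀ v,
        cycleWithChordsDegree cycleOrderB x v = cycleWithChordsDegree cycleOrderA y v := by
  unfold Antitone
  decide +kernel

theorem stmt_17 (d : Fin 5 → ℕ) (hd : Antitone d) :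
    (∃ G : SimpleGraph (Fin 5), (∀ i, (G.neighborSet i).ncard = d i) ∧
        C5a ⊆ G.edgeSet) ↔
      (∃ G : SimpleGraph (Fin 5), (∀ i, (G.neighborSet i).ncard = d i) ∧
        C5b ⊆ G.edgeSet) := by
  simp only [C5a_subset_edgeSet_iff, C5b_subset_edgeSet_iff, exists_graph_with_cycle_iff]
  constructor
  · rintro ⟨x, hx⟩
    obtain rfl : d = cycleWithChordsDegree cycleOrderA x := funext hx
    exact exists_cycleOrderB_degree_eq x hd
  · rintro ⟨x, hx⟩
    obtain rfl : d = cycleWithChordsDegree cycleOrderB x := funext hx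
    exact exists_cycleOrderA_degree_eq x hd
end

section
/- Let G be any simple graph on vertex set [12] = {1,…,12} whose degree sequence is given by deg_G(i) = d_i where (d_1, …, d_12) = (11,11,9,9,7,7,6,6,4,4,2,2). Then G has exactly one 2-factor (spanning 2-regular subgraph), namely the disjoint union of the three 4-cycles with vertex sequences 1–12–2–11–1, 3–10–4–9–3, and 5–8–6–7–5. -/
/-- The edge set of the disjoint union of the three 4-cycles
1–12–2–11–1, 3–10–4–9–3, 5–8–6–7–5 (0-indexed: 0–11–1–10–0, 2–9–3–8–2,
4–7–5–6–4). -/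
def threeC4 : Set (Sym2 (Fin 12)) :=
  {s((0 : Fin 12), (11 : Fin 12)), s((11 : Fin 12), (1 : Fin 12)),
   s((1 : Fin 12), (10 : Fin 12)), s((10 : Fin 12), (0 : Fin 12)),
   s((2 : Fin 12), (9 : Fin 12)), s((9 : Fin 12), (3 : Fin 12)),
   s((3 : Fin 12), (8 : Fin 12)), s((8 : Fin 12), (2 : Fin 12)),
   s((4 : Fin 12), (7 : Fin 12)), s((7 : Fin 12), (5 : Fin 12)),
   s((5 : Fin 12), (6 : Fin 12)), s((6 : Fin 12), (4 : Fin 12))}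

/-- Two graphs on a finite vertex set with equal degrees coincide if the vertices can be ranked so
that at each vertex one neighbourhood contains the other up to vertices of lower rank. -/
theorem SimpleGraph.eq_of_ncard_neighborSet_eq {V : Type*} [Finite V] {K L : SimpleGraph V}
    (f : V → ℕ) (hcard : ∀ i, (K.neighborSet i).ncard = (L.neighborSet i).ncard)
    (h : ∀ i, (∀ j, K.Adj i j → L.Adj i j ∨ f j < f i) ∨
      (∀ j, L.Adj i j → K.Adj i j ∨ f j < f i)) : K = L := by
  have key : ∀ n i, f i = n → K.neighborSet i = L.neighborSet i := by
    intro n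
    induction n using Nat.strong_induction_on with
    | _ n ih =>
      rintro i rfl
      have lower : ∀ j, f j < f i → (K.Adj i j ↔ L.Adj i j) := fun j hj => by
        rw [K.adj_comm, L.adj_comm]
        exact Set.ext_iff.mp (ih _ hj j rfl) i
      rcases h i with h | h
      · exact Set.eq_of_subset_of_ncard_le
          (fun j hj => (h j hj).elim id fun hlt => (lower j hlt).1 hj) (hcard i).ge
      · exact (Set.eq_of_subset_of_ncard_le
          (fun j hj => (h j hj).elim id fun hlt => (lower j hlt).2 hj) (hcard i).le).symm
  ext i j
  exact Set.ext_iff.mp (key _ i rfl) j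

/-- The threshold graph on `Fin 12` realizing the degree sequence
`(11,11,9,9,7,7,6,6,4,4,2,2)`. -/
def thresholdGraph : SimpleGraph (Fin 12) where
  Adj i j := i ≠ j ∧ i.val / 2 + j.val / 2 ≤ 5
  symm := ⟨fun _ _ h => ⟨h.1.symm, by omega⟩⟩
  loopless := ⟨fun _ h => h.1 rfl⟩

theorem ncard_neighborSet_thresholdGraph (i : Fin 12) :
    (thresholdGraph.neighborSet i).ncard = ![11, 11, 9, 9, 7, 7, 6, 6, 4, 4, 2, 2] i := by
  have h : thresholdGraph.neighborSet i =
      ({j | i ≠ j ∧ i.val / 2 + j.val / 2 ≤ 5} : Finset (Fin 12)) := by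
    ext j
    simp [thresholdGraph]
  rw [h, Set.ncard_coe_finset]
  clear h
  revert i
  decide

theorem fromEdgeSet_threeC4_adj (i j : Fin 12) :
    (SimpleGraph.fromEdgeSet threeC4).Adj i j ↔ i.val / 2 + j.val / 2 = 5 := by
  simp only [SimpleGraph.fromEdgeSet_adj, threeC4, Set.mem_insert_iff, Set.mem_singleton_iff]
  revert i j
  decide

theorem ncard_neighborSet_fromEdgeSet_threeC4 (i : Fin 12) :
    ((SimpleGraph.fromEdgeSet threeC4).neighborSet i).ncard = 2 := by
  have h : (SimpleGraph.fromEdgeSet threeC4).neighborSet i =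
      ({j | i.val / 2 + j.val / 2 = 5} : Finset (Fin 12)) := by
    ext j
    rw [SimpleGraph.mem_neighborSet, fromEdgeSet_threeC4_adj]
    simp
  rw [h, Set.ncard_coe_finset]
  clear h
  revert i
  decide

theorem eq_thresholdGraph (G : SimpleGraph (Fin 12))
    (hdeg : ∀ i : Fin 12,
      (G.neighborSet i).ncard = ![11, 11, 9, 9, 7, 7, 6, 6, 4, 4, 2, 2] i) :
    G = thresholdGraph := by
  refine SimpleGraph.eq_of_ncard_neighborSet_eq
    (fun i => if i.val / 2 ≤ 2 then 2 * (i.val / 2) else 11 - 2 * (i.val / 2))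
    (fun i => (hdeg i).trans (ncard_neighborSet_thresholdGraph i).symm) fun i => ?_
  by_cases hi : i.val / 2 ≤ 2
  · refine Or.inl fun j hj => or_iff_not_imp_left.mpr fun hn => ?_
    have hlt : ¬ i.val / 2 + j.val / 2 ≤ 5 := fun h => hn ⟨hj.ne, h⟩
    split_ifs <;> omega
  · refine Or.inr fun j hj => Or.inr ?_
    have hle : i.val / 2 + j.val / 2 ≤ 5 := hj.2
    split_ifs <;> omega

theorem eq_fromEdgeSet_threeC4 (H : SimpleGraph (Fin 12)) (hH : H ≤ thresholdGraph)
    (hdeg : ∀ i, (H.neighborSet i).ncard = 2) : H = SimpleGraph.fromEdgeSet threeC4 := by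
  refine SimpleGraph.eq_of_ncard_neighborSet_eq
    (fun i => if i.val / 2 ≤ 2 then 2 * (i.val / 2) + 1 else 10 - 2 * (i.val / 2))
    (fun i => (hdeg i).trans (ncard_neighborSet_fromEdgeSet_threeC4 i).symm) fun i => ?_
  simp only [fromEdgeSet_threeC4_adj]
  by_cases hi : i.val / 2 ≤ 2
  · refine Or.inr fun j hj => Or.inr ?_
    split_ifs <;> omega
  · refine Or.inl fun j hj => or_iff_not_imp_left.mpr fun hn => ?_
    have hle : i.val / 2 + j.val / 2 ≤ 5 := (hH hj).2
    split_ifs <;> omega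

/-- Any graph on `[12]` with degree sequence `(11,11,9,9,7,7,6,6,4,4,2,2)`
has exactly one 2-factor, namely the union of the three 4-cycles above. -/
theorem stmt_18 (G : SimpleGraph (Fin 12))
    (hdeg : ∀ i : Fin 12,
      (G.neighborSet i).ncard = ![11, 11, 9, 9, 7, 7, 6, 6, 4, 4, 2, 2] i) :
    (SimpleGraph.fromEdgeSet threeC4 ≤ G ∧
      ∀ v, ((SimpleGraph.fromEdgeSet threeC4).neighborSet v).ncard = 2) ∧
    ∀ H : SimpleGraph (Fin 12), H ≤ G →
      (∀ v, (H.neighborSet v).ncard = 2) →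
      H = SimpleGraph.fromEdgeSet threeC4 := by
  obtain rfl := eq_thresholdGraph G hdeg
  refine ⟨⟨fun i j h => ?_, ncard_neighborSet_fromEdgeSet_threeC4⟩, eq_fromEdgeSet_threeC4⟩
  exact ⟨h.ne, ((fromEdgeSet_threeC4_adj i j).1 h).le⟩
end
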